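/- Let n ≥ 5 and let M_n denote the mapping class group of the n-punctured sphere, given by its standard presentation. Then M_n is co-Hopfian: every injective group endomorphism of M_n is surjective, hence an automorphism. -/

import Mathlib

/-- Relators for the braid group with generators `σ_0, …, σ_{m-1}`:
the braid relations `σ_i σ_j σ_i = σ_j σ_i σ_j` for `j = i+1`, and the
commutation relations `σ_i σ_j = σ_j σ_i` for `j ≥ i+2`. -/
def braidRels (m : ℕ) : Set (FreeGroup (Fin m)) :=
  { r | ∃ i j : Fin m,
      ((i : ℕ) + 1 = (j : ℕ) ∧
        r = FreeGroup.of i * FreeGroup.of j * FreeGroup.of i *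
            (FreeGroup.of j * FreeGroup.of i * FreeGroup.of j)⁻¹) ∨
      ((i : ℕ) + 2 ≤ (j : ℕ) ∧
        r = FreeGroup.of i * FreeGroup.of j * (FreeGroup.of j * FreeGroup.of i)⁻¹) }

/-- The braid group on `n` strands: the presented group with generators
`σ_1, …, σ_{n-1}` (indexed by `Fin (n-1)`) and the braid relators. -/
abbrev BraidGroup (n : ℕ) : Type := PresentedGroup (braidRels (n - 1))

/-- The standard generator `σ_{i+1}` of the braid group (0-indexed). -/
def braidσ (n : ℕ) (i : Fin (n - 1)) : BraidGroup n := PresentedGroup.of i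

/-- The element `δ = σ_1 σ_2 ⋯ σ_{n-1}` of the braid group. -/
def braidδ (n : ℕ) : BraidGroup n := (List.ofFn (braidσ n)).prod

/-- The full twist `z = (σ_1 σ_2 ⋯ σ_{n-1})^n`. -/
def fullTwist (n : ℕ) : BraidGroup n := braidδ n ^ n

/-- Relators for the mapping class group of the `n`-punctured sphere: the braid relators
together with `σ_1⋯σ_{n-1}·σ_{n-1}⋯σ_1` and `(σ_1⋯σ_{n-1})^n`. -/
def sphereRels (n : ℕ) : Set (FreeGroup (Fin (n - 1))) :=
  braidRels (n - 1) ∪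
    { (List.ofFn (fun i : Fin (n - 1) => FreeGroup.of i)).prod *
        (List.ofFn (fun i : Fin (n - 1) => FreeGroup.of i)).reverse.prod,
      (List.ofFn (fun i : Fin (n - 1) => FreeGroup.of i)).prod ^ n }

/-- The mapping class group of the `n`-punctured sphere, via its standard presentation. -/
abbrev SphereMCG (n : ℕ) : Type := PresentedGroup (sphereRels n)

/-! ### Commutation and retractions in free groups -/

section

namespace FreeGroup

variable {X : Type*}

theorem eq_of_commute_of_of {x y : X} (h : Commute (of x) (of y)) : x = y := by
  classical
  by_contra hxy
  have h1 : (of x * of y : FreeGroup X) = mk [(x, true), (y, true)] := by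
    simp [of]
  have h2 : (of y * of x : FreeGroup X) = mk [(y, true), (x, true)] := by
    simp [of]
  have h3 := h.eq
  rw [h1, h2] at h3
  have := congrArg toWord h3
  simp only [toWord_mk] at this
  rw [IsReduced.reduce_eq, IsReduced.reduce_eq] at this
  · simp at this
    exact hxy this.1
  · simp [IsReduced]
  · simp [IsReduced]

/-- Commuting elements of a free group are powers of a common element. -/
theorem exists_zpow_of_commute {a b : FreeGroup X} (h : Commute a b) :
    ∃ (c : FreeGroup X) (k l : ℤ), a = c ^ k ∧ b = c ^ l := by
  let H : Subgroup (FreeGroup X) := Subgroup.closure {a, b}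
  have hcomm : ∀ x y : H, x * y = y * x := by
    have : IsMulCommutative H := by
      apply Subgroup.isMulCommutative_closure
      intro x hx y hy
      rcases hx with rfl | rfl <;> rcases hy with rfl | rfl
      · rfl
      · exact h
      · exact h.symm
      · rfl
    exact fun x y => this.is_comm.comm x y
  let e := IsFreeGroup.toFreeGroup H
  have hsub : Subsingleton (IsFreeGroup.Generators H) := by
    refine ⟨fun x y => eq_of_commute_of_of ?_⟩
    have := hcomm (e.symm (of x)) (e.symm (of y))
    exact e.symm.injective (by rw [_root_.map_mul, _root_.map_mul]; exact this)
  have hcyc : ∃ c : H, ∀ g : H, ∃ k : ℤ, g = c ^ k := by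
    rcases isEmpty_or_nonempty (IsFreeGroup.Generators H) with hE | ⟨⟨x⟩⟩
    · refine ⟨1, fun g => ⟨0, ?_⟩⟩
      apply e.injective
      exact Subsingleton.elim _ _
    · refine ⟨e.symm (of x), fun g => ?_⟩
      obtain ⟨k, hk⟩ : ∃ k : ℤ, e g = (of x) ^ k := by
        induction e g using FreeGroup.induction_on with
        | C1 => exact ⟨0, by simp⟩
        | of y => exact ⟨1, by rw [Subsingleton.elim y x]; simp⟩
        | inv_of y _ => exact ⟨-1, by rw [Subsingleton.elim y x]; simp⟩
        | mul u v hu hv =>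
          obtain ⟨k, hk⟩ := hu
          obtain ⟨l, hl⟩ := hv
          exact ⟨k + l, by rw [hk, hl, zpow_add]⟩
      exact ⟨k, by rw [← map_zpow, ← hk]; simp⟩
  obtain ⟨c, hc⟩ := hcyc
  obtain ⟨k, hk⟩ := hc ⟨a, Subgroup.subset_closure (by simp)⟩
  obtain ⟨l, hl⟩ := hc ⟨b, Subgroup.subset_closure (by simp)⟩
  exact ⟨c, k, l, by simpa using congrArg Subtype.val hk, by simpa using congrArg Subtype.val hl⟩

theorem exists_zpow_eq_zpow {a b : FreeGroup X} (h : Commute a b) (ha : a ≠ 1) (hb : b ≠ 1) :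
    ∃ p q : ℤ, p ≠ 0 ∧ q ≠ 0 ∧ a ^ p = b ^ q := by
  obtain ⟨c, k, l, rfl, rfl⟩ := exists_zpow_of_commute h
  refine ⟨l, k, ?_, ?_, by rw [← zpow_mul, ← zpow_mul, mul_comm]⟩
  · rintro rfl; simp at hb
  · rintro rfl; simp at ha

theorem eq_zpow_of_commute_of {x : X} {g : FreeGroup X} (h : Commute g (of x)) :
    ∃ k : ℤ, g = of x ^ k := by
  classical
  obtain ⟨c, k, l, rfl, hl⟩ := exists_zpow_of_commute h
  let f : FreeGroup X →* Multiplicative ℤ :=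
    lift (fun y => if y = x then Multiplicative.ofAdd 1 else 1)
  have h1 : l * (f c).toAdd = 1 := by
    have := congrArg (fun z => (f z).toAdd) hl
    simp [f] at this
    exact this.symm
  rcases Int.eq_one_or_neg_one_of_mul_eq_one h1 with rfl | rfl
  · exact ⟨k, by rw [hl]; simp⟩
  · exact ⟨-k, by rw [hl]; simp⟩

/-- A free group on at least two generators has trivial centre. -/
theorem eq_one_of_commute_of_two {x y : X} (hxy : x ≠ y) {g : FreeGroup X}
    (hx : Commute g (of x)) (hy : Commute g (of y)) : g = 1 := by
  classical
  obtain ⟨k, rfl⟩ := eq_zpow_of_commute_of hx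
  obtain ⟨l, hl⟩ := eq_zpow_of_commute_of hy
  let f : FreeGroup X →* Multiplicative ℤ :=
    lift (fun z => if z = x then Multiplicative.ofAdd 1 else 1)
  have := congrArg (fun z => (f z).toAdd) hl
  simp [f, hxy.symm] at this
  simp [this]

/-- The hom killing all generators outside `Y`. -/
noncomputable def keep (Y : Set X) : FreeGroup X →* FreeGroup X :=
  open Classical in lift (fun x => if x ∈ Y then of x else 1)

theorem keep_of_mem {Y : Set X} {x : X} (h : x ∈ Y) : keep Y (of x) = of x := by
  simp [keep, h]

theorem keep_of_notMem {Y : Set X} {x : X} (h : x ∉ Y) : keep Y (of x) = 1 := by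
  simp [keep, h]

theorem keep_keep {Y Z : Set X} (w : FreeGroup X) : keep Y (keep Z w) = keep (Y ∩ Z) w := by
  have : (keep Y).comp (keep Z) = keep (Y ∩ Z) := by
    ext x
    by_cases hz : x ∈ Z <;> by_cases hy : x ∈ Y <;> simp [keep, hz, hy]
  exact DFunLike.congr_fun this w

end FreeGroup

/-- Kernels of retraction-like homs. -/
theorem FreeGroup.ker_eq_of_retract {X : Type*} (f : FreeGroup X →* FreeGroup X)
    (N : Subgroup (FreeGroup X)) [N.Normal] (h1 : N ≤ f.ker)
    (h2 : ∀ x, f (FreeGroup.of x) * (FreeGroup.of x)⁻¹ ∈ N) : f.ker = N := by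
  refine le_antisymm (fun w hw => ?_) h1
  have : ((QuotientGroup.mk' N).comp f) = QuotientGroup.mk' N := by
    ext x
    have := h2 x
    simp only [MonoidHom.comp_apply, QuotientGroup.mk'_apply]
    rw [QuotientGroup.eq_iff_div_mem, div_eq_mul_inv]
    exact this
  have h3 := DFunLike.congr_fun this w
  simp only [MonoidHom.comp_apply, QuotientGroup.mk'_apply] at h3
  rw [MonoidHom.mem_ker] at hw
  rw [hw] at h3
  simpa using h3.symm

theorem FreeGroup.ker_keep {X : Type*} (Y : Set X) :
    (FreeGroup.keep Y).ker = Subgroup.normalClosure (FreeGroup.of '' Yᶜ) := by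
  apply FreeGroup.ker_eq_of_retract
  · apply Subgroup.normalClosure_le_normal
    rintro _ ⟨x, hx, rfl⟩
    exact FreeGroup.keep_of_notMem hx
  · intro x
    by_cases hx : x ∈ Y
    · rw [FreeGroup.keep_of_mem hx]; simp
    · rw [FreeGroup.keep_of_notMem hx]
      rw [one_mul]
      exact inv_mem (Subgroup.subset_normalClosure ⟨x, hx, rfl⟩)

end

/-! ### Automorphisms permuting the generators up to conjugacy -/

section

open FreeGroup (of keep)

/-- `α` sends each generator to a conjugate of the generator given by `τ`. -/
def PermLike {X : Type*} (α : FreeGroup X ≃* FreeGroup X) (τ : Equiv.Perm X) : Prop :=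
  ∀ x, IsConj (of (τ x)) (α (of x))

namespace PermLike

variable {X : Type*} {α β : FreeGroup X ≃* FreeGroup X} {τ τ' : Equiv.Perm X}

theorem mul (h : PermLike α τ) (h' : PermLike β τ') : PermLike (α * β : MulAut _) (τ * τ') := by
  intro x
  have := α.toMonoidHom.map_isConj (h' x)
  exact (h (τ' x)).trans this

theorem one : PermLike (1 : MulAut (FreeGroup X)) 1 := fun _ => IsConj.refl _

theorem pow {α : MulAut (FreeGroup X)} (h : PermLike α τ) (k : ℕ) :
    PermLike (α ^ k : MulAut _) (τ ^ k) := by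
  induction k with
  | zero => simpa using one
  | succ k ih => rw [pow_succ, pow_succ]; exact ih.mul h

theorem symm (h : PermLike α τ) : PermLike α.symm τ.symm := by
  intro x
  have := α.symm.toMonoidHom.map_isConj (h (τ.symm x))
  rw [Equiv.apply_symm_apply] at this
  exact (IsConj.symm (by simpa only [MulEquiv.toMonoidHom_eq_coe, MonoidHom.coe_coe,
      MulEquiv.symm_apply_apply] using this))

theorem keep_eq_one (h : PermLike α τ) {Y : Set X} {w : FreeGroup X} (hw : keep Y w = 1) :
    keep (τ '' Y) (α w) = 1 := by
  have h1 : w ∈ (keep Y).ker := hw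
  have h2 : (keep Y).ker ≤ ((keep (τ '' Y)).comp α.toMonoidHom).ker := by
    rw [FreeGroup.ker_keep]
    apply Subgroup.normalClosure_le_normal
    rintro _ ⟨x, hx, rfl⟩
    have h3 := (keep (τ '' Y)).map_isConj (h x)
    rw [FreeGroup.keep_of_notMem] at h3
    · exact isConj_one_right.mp h3
    · rintro ⟨y, hy, hyx⟩
      exact hx (τ.injective hyx ▸ hy)
  exact h2 h1

theorem keep_ne_one (h : PermLike α τ) {Y : Set X} {w : FreeGroup X} (hw : keep Y w ≠ 1) :
    keep (τ '' Y) (α w) ≠ 1 := by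
  intro h1
  have := h.symm.keep_eq_one h1
  rw [← Set.image_comp] at this
  simp at this
  exact hw this

end PermLike

namespace FreeGroup

variable {X : Type*}

theorem exists_finset_keep_eq (w : FreeGroup X) : ∃ L : Finset X, keep (L : Set X) w = w := by
  classical
  have mono : ∀ (L M : Finset X) (w : FreeGroup X), L ⊆ M → keep (L : Set X) w = w →
      keep (M : Set X) w = w := by
    intro L M w h hw
    rw [← hw, keep_keep, Set.inter_eq_right.mpr (by exact_mod_cast h)]
  induction w using FreeGroup.induction_on with
  | C1 => exact ⟨∅, by simp⟩
  | of x => exact ⟨{x}, keep_of_mem (by simp)⟩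
  | inv_of x h =>
    obtain ⟨L, hL⟩ := h
    exact ⟨L, by rw [_root_.map_inv, hL]⟩
  | mul u v hu hv =>
    obtain ⟨L, hL⟩ := hu
    obtain ⟨M, hM⟩ := hv
    exact ⟨L ∪ M, by rw [_root_.map_mul, mono L _ u (by simp) hL, mono M _ v (by simp) hM]⟩

/-- `x` lies in some minimal finite set of generators detecting `w`. -/
def MinSupp (w : FreeGroup X) (x : X) : Prop :=
  ∃ Y : Finset X, Minimal (fun Z : Finset X => keep (Z : Set X) w ≠ 1) Y ∧ x ∈ Y

theorem exists_minSupp {w : FreeGroup X} {Z : Set X} (h : keep Z w ≠ 1) :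
    ∃ x ∈ Z, MinSupp w x := by
  classical
  obtain ⟨L, hL⟩ := exists_finset_keep_eq w
  let L' := L.filter (· ∈ Z)
  have hL' : keep (L' : Set X) w ≠ 1 := by
    have : (L' : Set X) = Z ∩ L := by ext; simp [L', and_comm]
    rwa [this, ← keep_keep, hL]
  obtain ⟨Y, hY, hm⟩ := exists_minimal_le_of_wellFoundedLT
    (fun Z : Finset X => keep (Z : Set X) w ≠ 1) L' hL'
  rcases Y.eq_empty_or_nonempty with rfl | ⟨y, hy⟩
  · exfalso
    apply hm.prop
    have : keep ((∅ : Finset X) : Set X) = 1 := by ext x; simp [keep]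
    rw [this]; rfl
  · exact ⟨y, (Finset.mem_filter.mp (hY hy)).2, Y, hm, hy⟩

theorem finite_minSupp (w : FreeGroup X) : {x | MinSupp w x}.Finite := by
  classical
  obtain ⟨L, hL⟩ := exists_finset_keep_eq w
  refine L.finite_toSet.subset ?_
  rintro x ⟨Y, hm, hx⟩
  have h1 : keep ((Y ∩ L : Finset X) : Set X) w ≠ 1 := by
    rw [Finset.coe_inter, ← keep_keep, hL]
    exact hm.prop
  exact (Finset.mem_inter.mp (hm.le_of_le h1 Finset.inter_subset_left hx)).2

theorem MinSupp.map {w : FreeGroup X} {x : X} (hx : MinSupp w x) {α : FreeGroup X ≃* FreeGroup X}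
    {τ : Equiv.Perm X} (h : PermLike α τ) (hw : α w = w) : MinSupp w (τ x) := by
  classical
  obtain ⟨Y, hm, hx⟩ := hx
  refine ⟨Y.image τ, ⟨?_, ?_⟩, Finset.mem_image_of_mem _ hx⟩
  · have := h.keep_ne_one hm.prop
    rw [hw] at this
    simpa using this
  · intro Z hZ hle
    have h1 := h.symm.keep_ne_one hZ
    rw [show α.symm w = w by rw [MulEquiv.symm_apply_eq, hw]] at h1
    have h2 : Y ⊆ Z.image τ.symm := by
      apply hm.le_of_le (by simpa using h1)
      intro z hz
      obtain ⟨y, hy, rfl⟩ := Finset.mem_image.mp hz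
      obtain ⟨y', hy', rfl⟩ := Finset.mem_image.mp (hle hy)
      simpa using hy'
    intro y hy
    obtain ⟨y, hy', rfl⟩ := Finset.mem_image.mp hy
    obtain ⟨z, hz, hzy⟩ := Finset.mem_image.mp (h2 hy')
    rw [← hzy]
    simpa using hz

theorem MinSupp.periodic {w : FreeGroup X} {x : X} (hx : MinSupp w x)
    {α : FreeGroup X ≃* FreeGroup X} {τ : Equiv.Perm X} (h : PermLike α τ) (hw : α w = w) :
    ∃ M : ℕ, 0 < M ∧ (τ ^ M) x = x := by
  have : Finite {x | MinSupp w x} := finite_minSupp w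
  let f : {x | MinSupp w x} → {x | MinSupp w x} := fun x => ⟨τ x, x.2.map h hw⟩
  have hf : Function.Injective f := fun a b hab => by
    have := congrArg Subtype.val hab
    exact Subtype.ext (τ.injective this)
  obtain ⟨M, hM, hMx⟩ := hf.mem_periodicPts ⟨x, hx⟩
  refine ⟨M, hM, ?_⟩
  have key : ∀ k (y : {x | MinSupp w x}), ((f^[k] y : {x | MinSupp w x}) : X) = (τ ^ k) y := by
    intro k
    induction k with
    | zero => intro y; rfl
    | succ k ih =>
      intro y
      rw [Function.iterate_succ_apply, ih, pow_succ]; rfl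
  rw [← key M ⟨x, hx⟩, hMx]

end FreeGroup

end

/-! ### The kernel of killing a basis element -/

section

open FreeGroup (of keep)

section Kill

variable {X : Type*} (t : X)

namespace FreeGroup

/-- Inclusion of the free group on the remaining generators. -/
abbrev inclNe : FreeGroup {x : X // x ≠ t} →* FreeGroup X := FreeGroup.map Subtype.val

/-- The hom killing the generator `t`. -/
noncomputable def kill : FreeGroup X →* FreeGroup {x : X // x ≠ t} :=
  open Classical in lift (fun x => if h : x ≠ t then of ⟨x, h⟩ else 1)

theorem kill_self : kill t (of t) = 1 := by simp [kill]

theorem kill_inclNe (w : FreeGroup {x : X // x ≠ t}) : kill t (inclNe t w) = w := by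
  have : (kill t).comp (inclNe t) = MonoidHom.id _ := by
    ext x; simp [kill, x.2]
  exact DFunLike.congr_fun this w

theorem ker_kill : (kill t).ker = Subgroup.normalClosure {of t} := by
  have h1 : (kill t).ker = ((inclNe t).comp (kill t)).ker := by
    ext w
    simp only [MonoidHom.mem_ker, MonoidHom.comp_apply]
    refine ⟨fun h => by rw [h, _root_.map_one], fun h => ?_⟩
    have := congrArg (kill t) h
    rwa [kill_inclNe, _root_.map_one] at this
  rw [h1]
  apply ker_eq_of_retract
  · apply Subgroup.normalClosure_le_normal
    rintro _ rfl
    rw [SetLike.mem_coe, MonoidHom.mem_ker, MonoidHom.comp_apply, kill_self, _root_.map_one]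
  · intro x
    by_cases hx : x = t
    · subst hx
      rw [MonoidHom.comp_apply, kill_self, _root_.map_one, one_mul]
      exact inv_mem (Subgroup.subset_normalClosure rfl)
    · simp [kill, hx]

/-- The conjugates of `t` by the free group on the other generators. -/
noncomputable def conjGen : FreeGroup (FreeGroup {x : X // x ≠ t}) →* FreeGroup X :=
  lift (fun n => inclNe t n * of t * (inclNe t n)⁻¹)

@[simp] theorem conjGen_of (n : FreeGroup {x : X // x ≠ t}) :
    conjGen t (of n) = inclNe t n * of t * (inclNe t n)⁻¹ := by
  simp [conjGen]

/-- Left translation of generators. -/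
def transl {N : Type*} [Group N] : N →* MulAut (FreeGroup N) where
  toFun n := freeGroupCongr (Equiv.mulLeft n)
  map_one' := by ext x; simp
  map_mul' a b := by
    ext x
    simp only [MulAut.mul_apply, freeGroupCongr_apply, Equiv.coe_mulLeft]
    rw [map.comp]
    simp [mul_assoc, Function.comp_def]

theorem transl_of {N : Type*} [Group N] (n m : N) : transl n (of m) = of (n * m) := by
  simp [transl]

theorem norm_transl {N : Type*} [Group N] [DecidableEq N] (n : N) (w : FreeGroup N) :
    norm (transl n w) ≤ norm w := by
  have : transl n w = mk (w.toWord.map fun x => (n * x.1, x.2)) := by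
    conv_lhs => rw [← mk_toWord (x := w)]
    simp only [transl, MonoidHom.coe_mk, OneHom.coe_mk, freeGroupCongr_apply, map.mk]
    rfl
  rw [this]
  refine norm_mk_le.trans ?_
  simp [norm]

/-- Splitting of the free group over the quotient killing `t`. -/
noncomputable def split :
    FreeGroup X →* (FreeGroup (FreeGroup {x : X // x ≠ t})) ⋊[transl] FreeGroup {x : X // x ≠ t} :=
  open Classical in lift (fun x => if h : x ≠ t then SemidirectProduct.inr (of ⟨x, h⟩)
    else SemidirectProduct.inl (of 1))

theorem split_self : split t (of t) = SemidirectProduct.inl (of 1) := by simp [split]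

theorem split_ne {x : X} (h : x ≠ t) : split t (of x) = SemidirectProduct.inr (of ⟨x, h⟩) := by
  simp [split, h]

theorem split_inclNe (n : FreeGroup {x : X // x ≠ t}) :
    split t (inclNe t n) = SemidirectProduct.inr n := by
  have : (split t).comp (inclNe t) = SemidirectProduct.inr := by
    ext x : 1
    simp [split_ne t x.2]
  exact DFunLike.congr_fun this n

theorem split_conjGen (w) : split t (conjGen t w) = SemidirectProduct.inl w := by
  have : (split t).comp (conjGen t) = SemidirectProduct.inl := by
    ext n : 1
    simp only [MonoidHom.comp_apply, conjGen_of, _root_.map_mul, _root_.map_inv, split_inclNe,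
      split_self]
    rw [← _root_.map_inv, ← SemidirectProduct.inl_aut, transl_of, mul_one]
  exact DFunLike.congr_fun this w

theorem conjGen_injective : Function.Injective (conjGen t) := fun a b h => by
  have := congrArg (split t) h
  rw [split_conjGen, split_conjGen] at this
  exact SemidirectProduct.inl_injective this

theorem split_right (w : FreeGroup X) : (split t w).right = kill t w := by
  have : SemidirectProduct.rightHom.comp (split t) = kill t := by
    ext x : 1
    by_cases hx : x = t
    · subst hx; simp [split_self, kill_self]
    · simp [split_ne t hx, kill, hx]
  exact DFunLike.congr_fun this w

theorem conjGen_split (w : FreeGroup X) :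
    conjGen t (split t w).left * inclNe t (split t w).right = w := by
  let f := SemidirectProduct.lift (φ := transl) (conjGen t) (inclNe t) (by
    intro g
    ext n : 1
    simp [transl_of, mul_assoc])
  have : f.comp (split t) = MonoidHom.id _ := by
    ext x : 1
    by_cases hx : x = t
    · subst hx; simp [split_self, f]
    · simp [split_ne t hx, f]
  exact DFunLike.congr_fun this w

theorem range_conjGen : (conjGen t).range = (kill t).ker := by
  ext w
  constructor
  · rintro ⟨w, rfl⟩
    rw [MonoidHom.mem_ker, ← split_right, split_conjGen, SemidirectProduct.right_inl]
  · intro hw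
    refine ⟨(split t w).left, ?_⟩
    have := conjGen_split t w
    rwa [split_right, hw, _root_.map_one, mul_one] at this

theorem norm_split_mk [DecidableEq X] (L : List (X × Bool)) :
    norm (split t (mk L)).left ≤ L.countP (fun x => x.1 = t) := by
  induction L with
  | nil => simp [← one_eq_mk]
  | cons x L ih =>
    have h1 : mk (x :: L) = mk [x] * mk L := by simp
    rw [h1, _root_.map_mul, SemidirectProduct.mul_left, List.countP_cons]
    refine (norm_mul_le _ _).trans ?_
    rw [add_comm]
    refine add_le_add ((norm_transl _ _).trans ih) ?_
    obtain ⟨x, b⟩ := x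
    by_cases hx : x = t
    · subst hx
      have h2 : norm (of 1 : FreeGroup (FreeGroup {y : X // y ≠ x})) ≤ 1 := by simp
      cases b
      · rw [show mk [(x, false)] = (of x)⁻¹ from rfl, _root_.map_inv, split_self, ← _root_.map_inv]
        simp
      · rw [show mk [(x, true)] = (of x) from rfl, split_self]
        simp
    · cases b
      · rw [show mk [(x, false)] = (of x)⁻¹ from rfl, _root_.map_inv, split_ne t hx,
          ← _root_.map_inv]
        simp
      · rw [show mk [(x, true)] = (of x) from rfl, split_ne t hx]
        simp

theorem exists_zpow_of_forall [DecidableEq X] (L : List (X × Bool)) (h : ∀ x ∈ L, x.1 = t) :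
    ∃ k : ℤ, mk L = of t ^ k := by
  induction L with
  | nil => exact ⟨0, by simp [← one_eq_mk]⟩
  | cons x L ih =>
    obtain ⟨k, hk⟩ := ih (fun y hy => h y (by simp [hy]))
    have h1 : mk (x :: L) = mk [x] * mk L := by simp
    obtain ⟨x, b⟩ := x
    obtain rfl : x = t := h (x, b) (by simp)
    cases b
    · exact ⟨-1 + k, by rw [h1, hk, zpow_add]; rfl⟩
    · exact ⟨1 + k, by rw [h1, hk, zpow_add, zpow_one]; rfl⟩

/-- An element of the kernel of `kill t` is a power of `t` or gets shorter. -/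
theorem norm_split_lt [DecidableEq X] (w : FreeGroup X) :
    (∃ k : ℤ, w = of t ^ k) ∨ norm (split t w).left < norm w := by
  by_cases h : ∀ x ∈ w.toWord, x.1 = t
  · left
    obtain ⟨k, hk⟩ := exists_zpow_of_forall t w.toWord h
    exact ⟨k, by rw [← hk, mk_toWord]⟩
  · right
    have h1 := norm_split_mk t w.toWord
    rw [mk_toWord] at h1
    refine h1.trans_lt ?_
    refine lt_of_le_of_ne (List.countP_le_length) (fun h2 => h ?_)
    simpa using List.countP_eq_length.mp h2

end FreeGroup

end Kill

end

/-! ### Elements fixed by automorphisms permuting the generators up to conjugacy -/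

section

open FreeGroup (of keep kill inclNe conjGen)

section Kill

variable {X : Type*} {t : X}

/-- The induced automorphism of the quotient. -/
theorem exists_kill_aut {α : FreeGroup X ≃* FreeGroup X} (h : IsConj (of t) (α (of t))) :
    ∃ β : FreeGroup {x : X // x ≠ t} ≃* FreeGroup {x : X // x ≠ t},
      ∀ w, kill t (α w) = β (kill t w) := by
  have key : ∀ α : FreeGroup X ≃* FreeGroup X, IsConj (of t) (α (of t)) →
      ∀ w, kill t (α (inclNe t (kill t w))) = kill t (α w) := by
    intro α h w
    have h1 : (kill t).ker ≤ ((kill t).comp α.toMonoidHom).ker := by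
      rw [FreeGroup.ker_kill]
      apply Subgroup.normalClosure_le_normal
      rintro _ rfl
      have h3 := (kill t).map_isConj h
      rw [FreeGroup.kill_self] at h3
      exact isConj_one_right.mp h3
    have h2 : inclNe t (kill t w) * w⁻¹ ∈ (kill t).ker := by
      rw [MonoidHom.mem_ker, map_mul, map_inv, FreeGroup.kill_inclNe, mul_inv_cancel]
    have h3 := h1 h2
    rw [MonoidHom.mem_ker, MonoidHom.comp_apply, map_mul, map_inv] at h3
    simp only [MulEquiv.toMonoidHom_eq_coe, MonoidHom.coe_coe, map_mul, map_inv] at h3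
    exact mul_inv_eq_one.mp h3
  have h' : IsConj (of t) (α.symm (of t)) := by
    have := α.symm.toMonoidHom.map_isConj h
    simp only [MulEquiv.toMonoidHom_eq_coe, MonoidHom.coe_coe, MulEquiv.symm_apply_apply] at this
    exact IsConj.symm this
  refine ⟨MonoidHom.toMulEquiv (((kill t).comp α.toMonoidHom).comp (inclNe t))
    (((kill t).comp α.symm.toMonoidHom).comp (inclNe t)) ?_ ?_, fun w => ?_⟩
  · ext x : 1
    simp only [MulEquiv.toMonoidHom_eq_coe, MonoidHom.comp_apply, MonoidHom.coe_coe,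
        MonoidHom.id_apply]
    rw [key _ h', MulEquiv.symm_apply_apply, FreeGroup.kill_inclNe]
  · ext x : 1
    simp only [MulEquiv.toMonoidHom_eq_coe, MonoidHom.comp_apply, MonoidHom.coe_coe,
        MonoidHom.id_apply]
    rw [key _ h, MulEquiv.apply_symm_apply, FreeGroup.kill_inclNe]
  · exact (key _ h w).symm

/-- The induced automorphism of the kernel. -/
theorem exists_conjGen_aut {α : FreeGroup X ≃* FreeGroup X} (h : IsConj (of t) (α (of t))) :
    ∃ γ : FreeGroup (FreeGroup {x : X // x ≠ t}) ≃* FreeGroup (FreeGroup {x : X // x ≠ t}),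
      ∀ w, conjGen t (γ w) = α (conjGen t w) := by
  have hr : (conjGen t).range.map (α : FreeGroup X →* FreeGroup X) = (conjGen t).range := by
    obtain ⟨β, hβ⟩ := exists_kill_aut h
    rw [FreeGroup.range_conjGen]
    ext w
    rw [Subgroup.mem_map]
    constructor
    · rintro ⟨w, hw, rfl⟩
      rw [MonoidHom.mem_ker] at hw ⊢
      simp [hβ, hw]
    · intro hw
      refine ⟨α.symm w, ?_, by simp⟩
      rw [MonoidHom.mem_ker] at hw ⊢
      apply β.injective
      rw [← hβ, MulEquiv.apply_symm_apply, hw, map_one]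
  let e := MonoidHom.ofInjective (FreeGroup.conjGen_injective t)
  refine ⟨(e.trans (α.subgroupMap (conjGen t).range)).trans
    ((MulEquiv.subgroupCongr hr).trans e.symm), fun w => ?_⟩
  have he : ∀ y, conjGen t (e.symm y) = y := fun y => by
    conv_rhs => rw [← e.apply_symm_apply y]
    rfl
  exact he _

/-- Induced data on the kernel and the quotient, with a permutation of the new basis. -/
theorem exists_lift_data {α : FreeGroup X ≃* FreeGroup X} (h : IsConj (of t) (α (of t))) :
    ∃ (β : FreeGroup {x : X // x ≠ t} ≃* FreeGroup {x : X // x ≠ t})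
      (γ : FreeGroup (FreeGroup {x : X // x ≠ t}) ≃* FreeGroup (FreeGroup {x : X // x ≠ t}))
      (τ : Equiv.Perm (FreeGroup {x : X // x ≠ t})),
      (∀ w, kill t (α w) = β (kill t w)) ∧ (∀ w, conjGen t (γ w) = α (conjGen t w)) ∧
      PermLike γ τ ∧ ∀ n m, τ n * (τ m)⁻¹ = β (n * m⁻¹) := by
  obtain ⟨β, hβ⟩ := exists_kill_aut h
  obtain ⟨γ, hγ⟩ := exists_conjGen_aut h
  obtain ⟨κ, hκ⟩ := isConj_iff.mp h
  refine ⟨β, γ, β.toEquiv.trans (Equiv.mulRight (kill t κ)), hβ, hγ, ?_, ?_⟩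
  · intro n
    rw [isConj_iff]
    set v := α (inclNe t n) * κ with hv
    have hm : β.toEquiv.trans (Equiv.mulRight (kill t κ)) n = kill t v := by
      simp [hv, hβ, FreeGroup.kill_inclNe]
    rw [hm]
    have : v * (inclNe t (kill t v))⁻¹ ∈ (conjGen t).range := by
      rw [FreeGroup.range_conjGen, MonoidHom.mem_ker, map_mul, map_inv, FreeGroup.kill_inclNe,
        mul_inv_cancel]
    obtain ⟨k, hk⟩ := this
    refine ⟨k, FreeGroup.conjGen_injective t ?_⟩
    have h1 : α (inclNe t n) = v * κ⁻¹ := by simp [hv]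
    rw [hγ]
    simp only [map_mul, map_inv, hk, FreeGroup.conjGen_of]
    rw [← hκ, h1]
    group
  · intro n m
    simp [mul_assoc]

end Kill

/-- Multiplicative combination of finitely many periods. -/
theorem perm_pow_mul_eq {X : Type*} {τ : Equiv.Perm X} {x : X} {M : ℕ} (h : (τ ^ M) x = x) (N : ℕ) :
    (τ ^ (M * N)) x = x := by
  rw [pow_mul]
  induction N with
  | zero => simp
  | succ N ih => rw [pow_succ, Equiv.Perm.mul_apply, h, ih]

theorem perm_div_pow {Y : Type*} [Group Y] {β : MulAut Y} {τ : Equiv.Perm Y}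
    (h : ∀ n m, τ n * (τ m)⁻¹ = β (n * m⁻¹)) (N : ℕ) (n m : Y) :
    (τ ^ N) n * ((τ ^ N) m)⁻¹ = (β ^ N) (n * m⁻¹) := by
  induction N generalizing n m with
  | zero => simp
  | succ N ih => rw [pow_succ, pow_succ, Equiv.Perm.mul_apply, Equiv.Perm.mul_apply, ih, h]; rfl

/-- An element fixed by automorphisms with at most one common periodic generator is conjugate
to a power of a generator. -/
theorem exists_conj_zpow_of_fixed {J : Type*} (N : ℕ) : ∀ {X : Type*}
    [DecidableEq X] (w : FreeGroup X), w.norm ≤ N → ∀ (α : J → MulAut (FreeGroup X))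
    (τ : J → Equiv.Perm X), (∀ j, PermLike (α j) (τ j)) → (∀ j, α j w = w) →
    (∀ x y, (∀ j, ∃ M, 0 < M ∧ (τ j ^ M) x = x) → (∀ j, ∃ M, 0 < M ∧ (τ j ^ M) y = y) → x = y) →
    w ≠ 1 → ∃ (x : X) (g : FreeGroup X) (k : ℤ), w = g * of x ^ k * g⁻¹ := by
  classical
  induction N with
  | zero =>
    intro X _ w hw α τ _ _ _ h1
    exact absurd (FreeGroup.norm_eq_zero.mp (by omega)) h1
  | succ N ih =>
    intro X _ w hw α τ hα hfix hper h1
    have hex : ∀ Z : Set X, keep Z w ≠ 1 → ∃ x ∈ Z, FreeGroup.MinSupp w x :=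
      fun Z => FreeGroup.exists_minSupp
    have hsupp : ∀ x, FreeGroup.MinSupp w x → ∀ j, ∃ M, 0 < M ∧ (τ j ^ M) x = x :=
      fun x hx j => hx.periodic (hα j) (hfix j)
    have huniv : keep Set.univ w ≠ 1 := by
      rwa [show keep Set.univ = MonoidHom.id (FreeGroup X) by ext x; simp [keep]]
    obtain ⟨t, -, ht⟩ := hex _ huniv
    have htj : ∀ j, τ j t = t := fun j =>
      hper _ _ (hsupp _ (ht.map (hα j) (hfix j))) (hsupp _ ht)
    have hkill : kill t w = 1 := by
      by_contra hne
      have h2 : keep {t}ᶜ w ≠ 1 := by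
        have : keep {t}ᶜ = (inclNe t).comp (kill t) := by
          ext x
          by_cases hx : x = t
          · subst hx; simp [keep, kill]
          · simp [keep, kill, hx]
        intro h3
        rw [this, MonoidHom.comp_apply] at h3
        apply hne
        have := congrArg (kill t) h3
        rwa [FreeGroup.kill_inclNe, map_one] at this
      obtain ⟨x, hx, hx'⟩ := hex _ h2
      exact hx (hper _ _ (hsupp _ hx') (hsupp _ ht))
    rcases FreeGroup.norm_split_lt t w with ⟨k, hk⟩ | hlt
    · exact ⟨t, 1, k, by simpa using hk⟩
    have hc : ∀ j, IsConj (of t) (α j (of t)) := fun j => by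
      have := hα j t
      rwa [htj] at this
    choose β γ σ hβ hγ hσ hβσ using fun j => exists_lift_data (hc j)
    set w' := (FreeGroup.split t w).left with hw'
    have hww : conjGen t w' = w := by
      have := FreeGroup.conjGen_split t w
      rwa [FreeGroup.split_right, hkill, map_one, mul_one] at this
    have hper' : ∀ n n', (∀ j, ∃ M, 0 < M ∧ (σ j ^ M) n = n) →
        (∀ j, ∃ M, 0 < M ∧ (σ j ^ M) n' = n') → n = n' := by
      intro n n' hn hn'
      by_contra hne
      have hz : n' * n⁻¹ ≠ 1 := fun h => hne (mul_inv_eq_one.mp h).symm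
      have huniv' : keep Set.univ (n' * n⁻¹) ≠ 1 := by
        rwa [show keep Set.univ = MonoidHom.id _ by ext x; simp [keep]]
      obtain ⟨y, -, hy⟩ := FreeGroup.exists_minSupp huniv'
      refine y.2 (hper _ _ (fun j => ?_) (hsupp _ ht))
      obtain ⟨M, hM, hMn⟩ := hn j
      obtain ⟨M', hM', hMn'⟩ := hn' j
      have hNz : ((β j : MulAut _) ^ (M * M')) (n' * n⁻¹) = n' * n⁻¹ := by
        rw [← perm_div_pow (hβσ j), perm_pow_mul_eq hMn, mul_comm M, perm_pow_mul_eq hMn']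
      let τr : Equiv.Perm {x : X // x ≠ t} := (τ j).subtypePerm (fun x => by
        rw [not_iff_not]
        conv_lhs => rw [← htj j]
        exact (τ j).injective.eq_iff)
      have hτr : PermLike (β j) τr := by
        intro x
        have h3 := (kill t).map_isConj (hα j x)
        have h4 : ∀ x : {x : X // x ≠ t}, of (x : X) = inclNe t (of x) := fun x => by simp
        have h5 : τ j x = ((τr x : {x : X // x ≠ t}) : X) := rfl
        rwa [hβ, h5, h4, h4, FreeGroup.kill_inclNe, FreeGroup.kill_inclNe] at h3
      obtain ⟨Q, hQ, hQy⟩ := hy.periodic (hτr.pow (α := (β j : MulAut _)) (M * M')) hNz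
      refine ⟨M * M' * Q, by positivity, ?_⟩
      rw [← pow_mul] at hQy
      have := congrArg Subtype.val hQy
      rw [Equiv.Perm.subtypePerm_pow] at this
      exact this
    obtain ⟨n, g, k, hg⟩ := ih w' (by omega) γ σ hσ (fun j => by
        apply FreeGroup.conjGen_injective t
        rw [hγ, hww, hfix]) hper' (by
        intro h; apply h1; rw [← hww, h, map_one])
    refine ⟨t, conjGen t g * inclNe t n, k, ?_⟩
    rw [← hww, hg]
    simp only [map_mul, map_inv, map_zpow, FreeGroup.conjGen_of, conj_zpow]
    group

/-- Stage two: an element of the normal closure of `t` fixed by automorphisms preserving the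
conjugacy class of `t`, which act without periodic elements modulo `t`. -/
theorem exists_conj_zpow_of_mem_normalClosure {J : Type*} {X : Type*} {t : X}
    (α : J → MulAut (FreeGroup X)) (hα : ∀ j, IsConj (of t) (α j (of t)))
    (hper : ∀ z, (∀ j, ∃ M, 0 < M ∧ (α j ^ M) z * z⁻¹ ∈ Subgroup.normalClosure {of t}) →
      z ∈ Subgroup.normalClosure {of t}) {w : FreeGroup X}
    (hw : w ∈ Subgroup.normalClosure {of t}) (hfix : ∀ j, α j w = w) :
    ∃ (g : FreeGroup X) (k : ℤ), w = g * of t ^ k * g⁻¹ := by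
  classical
  choose β γ σ hβ hγ hσ hβσ using fun j => exists_lift_data (hα j)
  rw [← FreeGroup.ker_kill, ← FreeGroup.range_conjGen] at hw
  obtain ⟨w', rfl⟩ := hw
  by_cases h1 : w' = 1
  · exact ⟨1, 0, by simp [h1]⟩
  have hper' : ∀ n n', (∀ j, ∃ M, 0 < M ∧ (σ j ^ M) n = n) →
      (∀ j, ∃ M, 0 < M ∧ (σ j ^ M) n' = n') → n = n' := by
    intro n n' hn hn'
    have key : inclNe t (n' * n⁻¹) ∈ Subgroup.normalClosure {of t} := by
      apply hper
      intro j
      obtain ⟨M, hM, hMn⟩ := hn j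
      obtain ⟨M', hM', hMn'⟩ := hn' j
      refine ⟨M * M', by positivity, ?_⟩
      have hNz : ((β j : MulAut _) ^ (M * M')) (n' * n⁻¹) = n' * n⁻¹ := by
        rw [← perm_div_pow (hβσ j), perm_pow_mul_eq hMn, mul_comm M, perm_pow_mul_eq hMn']
      have hpow : ∀ (Q : ℕ) w, kill t ((α j ^ Q) w) = ((β j : MulAut _) ^ Q) (kill t w) := by
        intro Q
        induction Q with
        | zero => intro w; simp
        | succ Q ih => intro w; rw [pow_succ, pow_succ, MulAut.mul_apply, MulAut.mul_apply, ih, hβ]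
      rw [← FreeGroup.ker_kill, MonoidHom.mem_ker, map_mul, map_inv, hpow, FreeGroup.kill_inclNe,
          hNz,
        mul_inv_cancel]
    rw [← FreeGroup.ker_kill, MonoidHom.mem_ker, FreeGroup.kill_inclNe] at key
    exact (mul_inv_eq_one.mp key).symm
  obtain ⟨n, g, k, hg⟩ := exists_conj_zpow_of_fixed _ w' le_rfl γ σ hσ (fun j => by
        apply FreeGroup.conjGen_injective t
        rw [hγ, hfix]) hper' h1
  refine ⟨conjGen t g * inclNe t n, k, ?_⟩
  rw [hg]
  simp only [map_mul, map_inv, map_zpow, FreeGroup.conjGen_of, conj_zpow]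
  group

end

/-! ### Hurwitz moves on products of conjugates of generators -/

section

namespace FreeGroup

variable {X : Type*} [DecidableEq X]

theorem norm_mk_eq {L : List (X × Bool)} (h : IsReduced L) : norm (mk L) = L.length := by
  rw [norm, toWord_mk, h.reduce_eq]

theorem norm_lt_of_getLast {g : FreeGroup X} {a : X × Bool} (h : g.toWord.getLast? = some a) :
    ∃ g' : FreeGroup X, g = g' * mk [a] ∧ norm g' < norm g := by
  obtain ⟨w, hw⟩ := List.getLast?_eq_some_iff.mp h
  refine ⟨mk w, ?_, norm_mk_le.trans_lt ?_⟩
  · rw [mul_mk, ← hw, mk_toWord]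
  · rw [norm, hw]; simp

theorem norm_conj_lt {u v : FreeGroup X} {x : X} {b : Bool}
    (hu : ∀ a, u.toWord.getLast? = some a → a.1 ≠ x)
    (h : (u⁻¹ * v).toWord.head? = some (x, b)) :
    norm (u * mk [(x, !b)] * u⁻¹ * v) < norm v := by
  obtain ⟨w, hw⟩ := List.head?_eq_some_iff.mp h
  have h1 : u⁻¹ * v = mk [(x, b)] * mk w := by
    rw [mul_mk, List.singleton_append, ← hw, mk_toWord]
  have h2 : v = mk (u.toWord ++ (x, b) :: w) := by
    rw [← mul_mk, mk_toWord, ← hw, mk_toWord]; group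
  have h3 : IsReduced (u.toWord ++ (x, b) :: w) := by
    rw [IsReduced, List.isChain_append]
    refine ⟨isReduced_toWord, hw ▸ isReduced_toWord, ?_⟩
    intro a ha c hc hac
    simp at hc
    subst hc
    exact absurd hac (hu a ha)
  have h4 : norm v = norm u + 1 + w.length := by
    rw [h2, norm_mk_eq h3]; simp [norm]; omega
  have h5 : u * mk [(x, !b)] * u⁻¹ * v = u * mk w := by
    rw [mul_assoc, h1]
    have : mk [(x, !b)] * mk [(x, b)] = 1 := by
      cases b
      · exact mul_inv_cancel (of x)
      · exact inv_mul_cancel (of x)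
    rw [mul_assoc, ← mul_assoc (mk [(x, !b)]), this, one_mul]
  rw [h5, h4]
  have := norm_mul_le u (mk w)
  have := norm_mk_le (L₁ := w)
  omega

/-- The conjugate of a generator encoded by a pair. -/
def cj (p : FreeGroup X × X) : FreeGroup X := p.1 * of p.2 * p.1⁻¹

/-- The reduced word following the conjugator of the first factor. -/
def tailWord (p : FreeGroup X × X) : List (FreeGroup X × X) → List (X × Bool)
  | [] => (p.2, true) :: (p.1⁻¹).toWord
  | q :: r => (p.2, true) :: ((p.1⁻¹ * q.1).toWord ++ tailWord q r)

theorem tailWord_head (p : FreeGroup X × X) (r) : (tailWord p r).head? = some (p.2, true) := by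
  cases r <;> rfl

theorem mk_tailWord (p : FreeGroup X × X) (r) :
    p.1 * mk (tailWord p r) = ((p :: r).map cj).prod := by
  induction r generalizing p with
  | nil =>
    simp only [tailWord, List.map_cons, List.map_nil, List.prod_cons, List.prod_nil, cj]
    rw [← List.singleton_append, ← mul_mk, mk_toWord]
    simp [of, mul_assoc]
  | cons q r ih =>
    rw [List.map_cons, List.prod_cons, ← ih q]
    simp only [tailWord, cj]
    rw [← List.singleton_append, ← mul_mk, ← mul_mk, mk_toWord]
    simp [of, mul_assoc]

theorem length_tailWord (p : FreeGroup X × X) (r) : 1 + r.length ≤ (tailWord p r).length ∧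
    ((tailWord p r).length ≤ 1 + r.length → ∀ q ∈ r, q.1 = p.1) := by
  induction r generalizing p with
  | nil => simp [tailWord]
  | cons q r ih =>
    obtain ⟨h1, h2⟩ := ih q
    simp only [tailWord, List.length_cons, List.length_append]
    refine ⟨by omega, fun h => ?_⟩
    have h3 : (p.1⁻¹ * q.1).toWord.length = 0 := by omega
    have h4 : q.1 = p.1 := by
      have := norm_eq_zero.mp h3
      exact (inv_mul_eq_one.mp this).symm
    intro q' hq'
    rcases List.mem_cons.mp hq' with rfl | hq'
    · exact h4
    · rw [← h4]; exact h2 (by omega) _ (by assumption)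

/-- No Hurwitz move shortens an adjacent pair. -/
def Tight (p q : FreeGroup X × X) : Prop :=
  (p.1⁻¹ * q.1).toWord.head? ≠ some (p.2, false) ∧ (q.1⁻¹ * p.1).toWord.head? ≠ some (q.2, true)

theorem head_toWord_inv (g : FreeGroup X) :
    (g⁻¹).toWord.head? = g.toWord.getLast?.map (fun a => (a.1, !a.2)) := by
  rw [toWord_inv, invRev, List.head?_reverse, List.getLast?_map]

theorem isReduced_tailWord (p : FreeGroup X × X) (r)
    (h1 : ∀ q ∈ p :: r, ∀ a, q.1.toWord.getLast? = some a → a.1 ≠ q.2)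
    (h2 : List.IsChain Tight (p :: r)) : IsReduced (tailWord p r) := by
  induction r generalizing p with
  | nil =>
    simp only [tailWord, IsReduced]
    rw [List.isChain_cons]
    refine ⟨fun a ha hx => ?_, isReduced_toWord⟩
    rw [head_toWord_inv, Option.mem_def, Option.map_eq_some_iff] at ha
    obtain ⟨c, hc, rfl⟩ := ha
    exact absurd hx.symm (h1 p (by simp) c hc)
  | cons q r ih =>
    rw [List.isChain_cons_cons] at h2
    obtain ⟨⟨ha, hb⟩, h2⟩ := h2
    have ih := ih q (fun q' hq' => h1 q' (List.mem_cons_of_mem _ hq')) h2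
    simp only [tailWord, IsReduced]
    rw [List.isChain_cons, List.isChain_append]
    refine ⟨?_, isReduced_toWord, ih, ?_⟩
    · intro c hc hx
      rw [List.head?_append, tailWord_head, Option.mem_def] at hc
      obtain ⟨c1, c2⟩ := c
      rcases hw : (p.1⁻¹ * q.1).toWord.head? with _ | d
      · rw [hw] at hc; simp at hc; exact hc.2.symm
      · rw [hw] at hc
        simp at hc
        subst hc
        simp only at hx
        subst hx
        cases c2
        · exact absurd hw ha
        · rfl
    · intro c hc d hd hx
      rw [tailWord_head, Option.mem_def, Option.some_inj] at hd
      subst hd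
      simp only at hx ⊢
      by_contra hne
      apply hb
      have : q.1⁻¹ * p.1 = (p.1⁻¹ * q.1)⁻¹ := by group
      rw [this, head_toWord_inv, Option.mem_def.mp hc]
      obtain ⟨c1, c2⟩ := c
      simp at hx hne
      simp [hx, hne]

theorem closure_cj_le {X : Type*} {l l' : List (FreeGroup X × X)}
    (h : ∀ p ∈ l', cj p ∈ Subgroup.closure {b | ∃ q ∈ l, cj q = b}) :
    Subgroup.closure {b | ∃ q ∈ l', cj q = b} ≤ Subgroup.closure {b | ∃ q ∈ l, cj q = b} := by
  rw [Subgroup.closure_le]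
  rintro _ ⟨q, hq, rfl⟩
  exact h q hq

/-- Conjugates of generators whose product is short generate the corresponding generators. -/
theorem of_mem_closure_of_norm_prod_le (N : ℕ) : ∀ l : List (FreeGroup X × X),
    (l.map fun p => norm p.1).sum ≤ N → norm (l.map cj).prod ≤ l.length →
    ∀ p ∈ l, of p.2 ∈ Subgroup.closure {b | ∃ q ∈ l, cj q = b} := by
  induction N using Nat.strong_induction_on with
  | _ N ih =>
  intro l hN hl
  have step : ∀ l' : List (FreeGroup X × X),
      (l'.map fun p => norm p.1).sum < (l.map fun p => norm p.1).sum →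
      (l'.map cj).prod = (l.map cj).prod → l'.length = l.length →
      (∀ x, x ∈ l.map Prod.snd → x ∈ l'.map Prod.snd) →
      (∀ p ∈ l', cj p ∈ Subgroup.closure {b | ∃ q ∈ l, cj q = b}) →
      ∀ p ∈ l, of p.2 ∈ Subgroup.closure {b | ∃ q ∈ l, cj q = b} := by
    intro l' h1 h2 h3 h4 h5 p hp
    obtain ⟨p', hp', he⟩ := List.mem_map.mp (h4 p.2 (List.mem_map_of_mem hp))
    rw [← he]
    exact closure_cj_le h5 (ih _ (by omega) l' le_rfl (by rw [h2, h3]; exact hl) p' hp')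
  by_cases h1 : ∀ q ∈ l, ∀ a, q.1.toWord.getLast? = some a → a.1 ≠ q.2
  swap
  · push Not at h1
    obtain ⟨⟨g, x⟩, hq, ⟨y, b⟩, ha, hx⟩ := h1
    simp only at ha hx
    subst hx
    obtain ⟨g', hg, hlt⟩ := norm_lt_of_getLast ha
    obtain ⟨l1, l2, rfl⟩ := List.append_of_mem hq
    have hcj : cj (g', y) = cj (g, y) := by
      simp only [cj]
      rw [hg]
      cases b
      · rw [show mk [(y, false)] = (of y)⁻¹ from rfl]; group
      · rw [show mk [(y, true)] = of y from rfl]; group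
    refine step (l1 ++ (g', y) :: l2) ?_ ?_ ?_ ?_ ?_
    · simp only [List.map_append, List.map_cons, List.sum_append, List.sum_cons]
      omega
    · simp only [List.map_append, List.map_cons, hcj]
    · simp
    · intro x hx; simpa using hx
    · intro p hp
      rcases List.mem_append.mp hp with hp | hp
      · exact Subgroup.subset_closure ⟨p, by simp [hp], rfl⟩
      · rcases List.mem_cons.mp hp with rfl | hp
        · rw [hcj]; exact Subgroup.subset_closure ⟨_, hq, rfl⟩
        · exact Subgroup.subset_closure ⟨p, by simp [hp], rfl⟩
  by_cases h2 : List.IsChain Tight l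
  swap
  · rw [List.isChain_iff_forall_rel_of_append_cons_cons] at h2
    push Not at h2
    obtain ⟨⟨u, x⟩, ⟨v, y⟩, l1, l2, rfl, hT⟩ := h2
    have hu := h1 (u, x) (by simp)
    have hv := h1 (v, y) (by simp)
    have mem : ∀ p ∈ l1 ++ (u, x) :: (v, y) :: l2, cj p ∈ Subgroup.closure
        {b | ∃ q ∈ l1 ++ (u, x) :: (v, y) :: l2, cj q = b} :=
      fun p hp => Subgroup.subset_closure ⟨p, hp, rfl⟩
    have mu := mem (u, x) (by simp)
    have mv := mem (v, y) (by simp)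
    simp only [Tight, not_and_or, not_not] at hT
    rcases hT with hT | hT
    · have hlt := norm_conj_lt hu hT
      rw [Bool.not_false, show mk [(x, true)] = of x from rfl] at hlt
      replace hlt : norm (u * of x * u⁻¹ * v) < norm v := hlt
      have hcj : cj (u * of x * u⁻¹ * v, y) = cj (u, x) * cj (v, y) * (cj (u, x))⁻¹ := by
        simp only [cj]; group
      refine step (l1 ++ (u * of x * u⁻¹ * v, y) :: (u, x) :: l2) ?_ ?_ ?_ ?_ ?_
      · simp only [List.map_append, List.map_cons, List.sum_append, List.sum_cons]
        omega
      · simp only [List.map_append, List.map_cons, hcj, List.prod_append, List.prod_cons]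
        group
      · simp
      · intro x hx; simp at hx ⊢; tauto
      · intro p hp
        rcases List.mem_append.mp hp with hp | hp
        · exact mem p (by simp [hp])
        · rcases List.mem_cons.mp hp with rfl | hp
          · rw [hcj]; exact mul_mem (mul_mem mu mv) (inv_mem mu)
          · rcases List.mem_cons.mp hp with rfl | hp
            · exact mu
            · exact mem p (by simp [hp])
    · have hlt := norm_conj_lt hv hT
      rw [Bool.not_true, show mk [(y, false)] = (of y)⁻¹ from rfl] at hlt
      replace hlt : norm (v * (of y)⁻¹ * v⁻¹ * u) < norm u := hlt
      have hcj : cj (v * (of y)⁻¹ * v⁻¹ * u, x) = (cj (v, y))⁻¹ * cj (u, x) * cj (v, y) := by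
        simp only [cj]; group
      refine step (l1 ++ (v, y) :: (v * (of y)⁻¹ * v⁻¹ * u, x) :: l2) ?_ ?_ ?_ ?_ ?_
      · simp only [List.map_append, List.map_cons, List.sum_append, List.sum_cons]
        omega
      · simp only [List.map_append, List.map_cons, hcj, List.prod_append, List.prod_cons]
        group
      · simp
      · intro x hx; simp at hx ⊢; tauto
      · intro p hp
        rcases List.mem_append.mp hp with hp | hp
        · exact mem p (by simp [hp])
        · rcases List.mem_cons.mp hp with rfl | hp
          · exact mv
          · rcases List.mem_cons.mp hp with rfl | hp
            · rw [hcj]; exact mul_mem (mul_mem (inv_mem mv) mu) mv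
            · exact mem p (by simp [hp])
  rcases l with _ | ⟨p, r⟩
  · simp
  have hred := isReduced_tailWord p r h1 h2
  have hfull : IsReduced (p.1.toWord ++ tailWord p r) := by
    rw [IsReduced, List.isChain_append]
    refine ⟨isReduced_toWord, hred, ?_⟩
    intro a ha c hc hac
    rw [tailWord_head, Option.mem_def, Option.some_inj] at hc
    subst hc
    exact absurd hac (h1 p (by simp) a ha)
  rw [← mk_tailWord, ← mk_toWord (x := p.1), mul_mk, norm_mk_eq hfull, List.length_append,
    List.length_cons] at hl
  obtain ⟨hlen, hlen'⟩ := length_tailWord p r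
  have hp1 : p.1 = 1 := norm_eq_zero.mp (show norm p.1 = 0 by rw [norm]; omega)
  have hall : ∀ q ∈ p :: r, q.1 = 1 := by
    intro q hq
    rcases List.mem_cons.mp hq with rfl | hq
    · exact hp1
    · rw [hlen' (by omega) q hq, hp1]
  intro q hq
  exact Subgroup.subset_closure ⟨q, hq, by simp [cj, hall q hq]⟩

end FreeGroup

end

/-! ### Segments in sequences satisfying the braid relations -/

section

/-- The product `t i * t (i + 1) * ⋯ * t (i + l - 1)`. -/
def seg {G : Type*} [Group G] (t : ℕ → G) (i : ℕ) : ℕ → G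
  | 0 => 1
  | l + 1 => seg t i l * t (i + l)

/-- The first `N` terms of `t` satisfy the braid relations. -/
structure BraidSeq {G : Type*} [Group G] (N : ℕ) (t : ℕ → G) : Prop where
  braid : ∀ i, i + 1 < N → t i * t (i + 1) * t i = t (i + 1) * t i * t (i + 1)
  comm : ∀ i j, i + 2 ≤ j → j < N → Commute (t i) (t j)

section Seg

variable {G : Type*} [Group G] {t : ℕ → G}

theorem seg_succ' (i l : ℕ) : seg t i (l + 1) = t i * seg t (i + 1) l := by
  induction l with
  | zero => simp [seg]
  | succ l ih => rw [seg, ih, seg, mul_assoc, add_right_comm i 1 l, add_assoc i l 1]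

theorem seg_add (i l m : ℕ) : seg t i (l + m) = seg t i l * seg t (i + l) m := by
  induction m with
  | zero => simp [seg]
  | succ m ih => rw [← add_assoc, seg, ih, seg, mul_assoc, add_assoc]

theorem Commute.seg_right {x : G} {i l : ℕ} (h : ∀ m, i ≤ m → m < i + l → Commute x (t m)) :
    Commute x (seg t i l) := by
  induction l with
  | zero => exact Commute.one_right x
  | succ l ih =>
    exact (ih fun m h1 h2 => h m h1 (by omega)).mul_right (h _ (by omega) (by omega))

theorem map_seg {H : Type*} [Group H] (f : G →* H) (i l : ℕ) :
    f (seg t i l) = seg (fun i => f (t i)) i l := by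
  induction l with
  | zero => simp [seg]
  | succ l ih => simp [seg, ih]

theorem seg_shift_index (a i l : ℕ) : seg (fun j => t (j + a)) i l = seg t (i + a) l := by
  induction l with
  | zero => simp [seg]
  | succ l ih => simp only [seg]; rw [ih, add_right_comm]

theorem seg_congr {t' : ℕ → G} {i l : ℕ} (h : ∀ m, i ≤ m → m < i + l → t m = t' m) :
    seg t i l = seg t' i l := by
  induction l with
  | zero => simp [seg]
  | succ l ih =>
    simp only [seg]; rw [ih fun m h1 h2 => h m h1 (by omega), h _ (by omega) (by omega)]

theorem seg_mem {H : Subgroup G} {i l : ℕ} (h : ∀ m, i ≤ m → m < i + l → t m ∈ H) :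
    seg t i l ∈ H := by
  induction l with
  | zero => exact one_mem H
  | succ l ih => exact mul_mem (ih fun m h1 h2 => h m h1 (by omega)) (h _ (by omega) (by omega))

variable {N : ℕ}

theorem BraidSeq.map {H : Type*} [Group H] (h : BraidSeq N t) (f : G →* H) :
    BraidSeq N (fun i => f (t i)) :=
  ⟨fun i hi => by simpa using congrArg f (h.braid i hi),
    fun i j hij hj => (h.comm i j hij hj).map f⟩

theorem BraidSeq.shift (h : BraidSeq N t) {a M : ℕ} (ha : M + a ≤ N) :
    BraidSeq M (fun i => t (i + a)) :=
  ⟨fun i hi => by have := h.braid (i + a) (by omega); rwa [add_right_comm] at this,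
    fun i j hij hj => h.comm _ _ (by omega) (by omega)⟩

theorem BraidSeq.mono (h : BraidSeq N t) {M : ℕ} (ha : M ≤ N) : BraidSeq M t :=
  ⟨fun i hi => h.braid i (by omega), fun i j hij hj => h.comm _ _ (by omega) (by omega)⟩

theorem BraidSeq.seg_mul (h : BraidSeq N t) {i l m : ℕ} (hN : i + l ≤ N) (him : i ≤ m)
    (hm : m + 1 < i + l) : seg t i l * t m = t (m + 1) * seg t i l := by
  obtain ⟨a, rfl⟩ := Nat.exists_eq_add_of_le him
  obtain ⟨b, rfl⟩ : ∃ b, l = a + 2 + b := ⟨l - (a + 2), by omega⟩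
  have e2 : seg t (i + a) 2 = t (i + a) * t (i + a + 1) := by simp [seg]
  have h1 : Commute (t (i + a + 1)) (seg t i a) :=
    Commute.seg_right fun m h1 h2 => (h.comm _ _ (by omega) (by omega)).symm
  have h2 : Commute (t (i + a)) (seg t (i + (a + 2)) b) :=
    Commute.seg_right fun m h1 h2 => (h.comm _ _ (by omega) (by omega))
  rw [seg_add, seg_add, e2]
  calc _ = seg t i a * (t (i + a) * t (i + a + 1)) * (seg t (i + (a + 2)) b * t (i + a)) := by group
    _ = seg t i a * (t (i + a) * t (i + a + 1) * t (i + a)) * seg t (i + (a + 2)) b := by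
      rw [← h2.eq]; group
    _ = (seg t i a * t (i + a + 1)) * (t (i + a) * t (i + a + 1)) * seg t (i + (a + 2)) b := by
      rw [h.braid _ (by omega)]; group
    _ = _ := by rw [← h1.eq]; group

/-- Consecutive generators are conjugate by the long cycle. -/
theorem BraidSeq.conj_seg (h : BraidSeq N t) {m : ℕ} (hm : m + 1 < N) :
    seg t 0 N * t m * (seg t 0 N)⁻¹ = t (m + 1) := by
  rw [h.seg_mul (by omega) (by omega) (by omega)]; group

theorem card_mul_le_of_cosets [Finite G] {H K : Subgroup G} (hHK : H ≤ K) {m : ℕ} (c : Fin m → G)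
    (hc : ∀ i, c i ∈ K) (hne : ∀ i j, i < j → (c j)⁻¹ * c i ∉ H) :
    m * Nat.card H ≤ Nat.card K := by
  have hne' : ∀ i j, (c j)⁻¹ * c i ∈ H → i = j := by
    intro i j hij
    rcases lt_trichotomy i j with h | h | h
    · exact absurd hij (hne i j h)
    · exact h
    · refine absurd ?_ (hne j i h)
      have := inv_mem hij
      rwa [mul_inv_rev, inv_inv] at this
  let f : Fin m × H → K := fun p => ⟨c p.1 * p.2, mul_mem (hc _) (hHK p.2.2)⟩
  have hf : Function.Injective f := by
    rintro ⟨i, a⟩ ⟨j, b⟩ hab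
    have hab : c i * a = c j * b := congrArg Subtype.val hab
    obtain rfl : i = j := by
      apply hne'
      have : (c j)⁻¹ * c i = b * (a : G)⁻¹ := by
        rw [inv_mul_eq_iff_eq_mul, ← mul_assoc, ← hab]; group
      rw [this]
      exact mul_mem b.2 (inv_mem a.2)
    rw [Subtype.ext (mul_left_cancel hab)]
  have := Nat.card_le_card_of_injective f hf
  simpa [Nat.card_prod] using this

/-- In a finite quotient of a braid group a new generator multiplies the order by at least the
number of strands. -/
theorem BraidSeq.card_closure_succ [Finite G] {k : ℕ} (h : BraidSeq (k + 1) t)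
    (hk : t k ∉ Subgroup.closure (t '' Set.Iio k)) :
    (k + 2) * Nat.card (Subgroup.closure (t '' Set.Iio k)) ≤
      Nat.card (Subgroup.closure (t '' Set.Iio (k + 1))) := by
  have mem : ∀ m, m < k → t m ∈ Subgroup.closure (t '' Set.Iio k) := fun m hm =>
    Subgroup.subset_closure ⟨m, hm, rfl⟩
  have mem' : ∀ m, m < k + 1 → t m ∈ Subgroup.closure (t '' Set.Iio (k + 1)) := fun m hm =>
    Subgroup.subset_closure ⟨m, hm, rfl⟩
  refine card_mul_le_of_cosets (Subgroup.closure_mono (Set.image_mono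
    (Set.Iio_subset_Iio (by omega)))) (fun i => seg t i (k + 1 - i)) ?_ ?_
  · intro i
    exact seg_mem fun m h1 h2 => mem' m (by omega)
  · rintro ⟨i, hi⟩ ⟨j, hj⟩ hij hmem
    simp only [Fin.mk_lt_mk] at hij
    simp only at hmem
    obtain ⟨j, rfl⟩ : ∃ b, j = b + 1 := ⟨j - 1, by omega⟩
    obtain ⟨a, rfl⟩ : ∃ a, j = i + a := ⟨j - i, by omega⟩
    obtain ⟨b, rfl⟩ : ∃ b, k = i + a + b := ⟨k - (i + a), by omega⟩
    have e1 : i + a + b + 1 - i = a + (b + 1) := by omega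
    have e2 : i + a + b + 1 - (i + a + 1) = b := by omega
    rw [e1, e2, seg_add, seg_succ'] at hmem
    have hc : Commute (seg t i a) (seg t (i + a + 1) b) := by
      refine Commute.seg_right fun m h1 h2 => (Commute.seg_right fun m' h1' h2' => ?_).symm
      exact (h.comm _ _ (by omega) (by omega)).symm
    have h3 : (seg t (i + a + 1) b)⁻¹ * (t (i + a) * seg t (i + a + 1) b) ∈
        Subgroup.closure (t '' Set.Iio (i + a + b)) := by
      have h4 : (seg t i a)⁻¹ ∈ Subgroup.closure (t '' Set.Iio (i + a + b)) :=
        inv_mem (seg_mem fun m h1 h2 => mem m (by omega))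
      have h5 := mul_mem h4 hmem
      rw [← mul_assoc, ← mul_inv_rev, ← hc.eq, mul_inv_rev] at h5
      convert h5 using 1
      group
    set d := seg t (i + a) b with hd
    have hd' : d ∈ Subgroup.closure (t '' Set.Iio (i + a + b)) :=
      seg_mem fun m h1 h2 => mem m (by omega)
    have h6 : t (i + a) * seg t (i + a + 1) b = d * t (i + a + b) := by
      rw [← seg_succ', seg]
    have h7 : d * t (i + a + b) * d = seg t (i + a + 1) b * (d * t (i + a + b)) := by
      have key : ∀ l, l ≤ b → d * t (i + a + b) * seg t (i + a) l =
          seg t (i + a + 1) l * (d * t (i + a + b)) := by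
        intro l
        induction l with
        | zero => intro _; simp [seg]
        | succ l ih =>
          intro hl
          have h8 := h.seg_mul (i := i + a) (l := b + 1) (m := i + a + l) (by omega) (by omega)
            (by omega)
          rw [seg, ← hd] at h8
          rw [seg, seg, ← mul_assoc, ih (by omega), mul_assoc, h8, mul_assoc]
          congr 2
          rw [add_right_comm]
      exact key b le_rfl
    apply hk
    have h9 : (seg t (i + a + 1) b)⁻¹ * (t (i + a) * seg t (i + a + 1) b) =
        d * t (i + a + b) * d⁻¹ := by
      rw [h6, inv_mul_eq_iff_eq_mul, eq_comm, ← mul_assoc, mul_inv_eq_iff_eq_mul, h7]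
    rw [h9] at h3
    have := mul_mem (mul_mem (inv_mem hd') h3) hd'
    simpa [mul_assoc] using this

end Seg

end

/-! ### Actions of braid groups on finite sets -/

section

open Equiv

theorem card_le_of_stabilizer_fix {n : ℕ} (A : Subgroup (Perm (Fin n))) (x : Fin n)
    (S : Finset (Fin n)) (h : ∀ g ∈ A, g x = x → ∀ y ∈ S, g y = y) :
    Nat.card A ≤ n * (n - S.card).factorial := by
  classical
  have h1 : Nat.card A = Nat.card (MulAction.orbit A x) * Nat.card (MulAction.stabilizer A x) := by
    rw [← Nat.card_prod]
    exact Nat.card_congr (MulAction.orbitProdStabilizerEquivGroup A x).symm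
  rw [h1]
  apply Nat.mul_le_mul
  · have := Nat.card_le_card_of_injective (Subtype.val : MulAction.orbit A x → Fin n)
      Subtype.val_injective
    simpa using this
  · let f : MulAction.stabilizer A x → {f : Perm (Fin n) // ∀ a, ¬ (a ∉ S) → f a = a} :=
      fun g => ⟨g.1.1, fun a ha => h g.1.1 g.1.2 g.2 a (not_not.mp ha)⟩
    have hf : Function.Injective f := fun a b hab => by
      have h9 : (f a).1 = (f b).1 := by rw [hab]
      exact Subtype.ext (Subtype.ext h9)
    have := Nat.card_le_card_of_injective f hf
    rw [Nat.card_congr (Perm.subtypeEquivSubtypePerm (fun a => a ∉ S)).symm, Nat.card_perm] at this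
    refine this.trans (le_of_eq ?_)
    congr 1
    rw [Nat.card_eq_fintype_card, Fintype.card_subtype_compl]
    simp

theorem card_centralizer_le_of_ne_one {n : ℕ} {z : Perm (Fin n)} (hz : z ≠ 1) :
    Nat.card (Subgroup.centralizer {z}) ≤ n * (n - 2).factorial := by
  obtain ⟨x, hx⟩ : ∃ x, z x ≠ x := by
    by_contra h; push Not at h; exact hz (Perm.ext h)
  have := card_le_of_stabilizer_fix (Subgroup.centralizer {z}) x {x, z x} ?_
  · rwa [Finset.card_pair hx.symm] at this
  · intro g hg hgx y hy
    rw [Subgroup.mem_centralizer_singleton_iff] at hg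
    simp only [Finset.mem_insert, Finset.mem_singleton] at hy
    rcases hy with rfl | rfl
    · exact hgx
    · rw [← Perm.mul_apply, hg, Perm.mul_apply, hgx]

theorem card_centralizer_le_of_sq_ne_one {n : ℕ} {z : Perm (Fin n)} (hz : z ^ 2 ≠ 1) :
    Nat.card (Subgroup.centralizer {z}) ≤ n * (n - 3).factorial := by
  obtain ⟨x, hx⟩ : ∃ x, z (z x) ≠ x := by
    by_contra h; push Not at h; exact hz (Perm.ext fun x => by simp [pow_two, h])
  have h1 : z x ≠ x := fun h => hx (by rw [h, h])
  have := card_le_of_stabilizer_fix (Subgroup.centralizer {z}) x {x, z x, z (z x)} ?_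
  · rwa [Finset.card_eq_three.mpr ⟨x, z x, z (z x), h1.symm, hx.symm, ?_, rfl⟩] at this
    exact fun h => h1 (z.injective h).symm
  · intro g hg hgx y hy
    rw [Subgroup.mem_centralizer_singleton_iff] at hg
    have hc : ∀ y, g y = y → g (z y) = z y := fun y h => by
      rw [← Perm.mul_apply, hg, Perm.mul_apply, h]
    simp only [Finset.mem_insert, Finset.mem_singleton] at hy
    rcases hy with rfl | rfl | rfl
    · exact hgx
    · exact hc _ hgx
    · exact hc _ (hc _ hgx)

section

variable {G : Type*} [Group G] {t : ℕ → G} {N : ℕ}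

theorem BraidSeq.eq_of_commute (h : BraidSeq N t) {i : ℕ} (hi : i + 1 < N)
    (hc : Commute (t i) (t (i + 1))) : t i = t (i + 1) := by
  have := h.braid i hi
  rw [hc.eq, mul_assoc, mul_assoc] at this
  exact mul_left_cancel (mul_left_cancel this)

theorem BraidSeq.pow_conj_seg (h : BraidSeq N t) {m k : ℕ} (hm : m + k < N) :
    seg t 0 N ^ k * t m * (seg t 0 N ^ k)⁻¹ = t (m + k) := by
  induction k with
  | zero => simp
  | succ k ih =>
    rw [pow_succ', ← add_assoc, ← h.conj_seg (m := m + k) (by omega), ← ih (by omega)]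
    group

theorem BraidSeq.ne_succ (h : BraidSeq N t) (h01 : t 0 ≠ t 1) {i : ℕ} (hi : i + 1 < N) :
    t i ≠ t (i + 1) := by
  intro heq
  apply h01
  have h0 := h.pow_conj_seg (m := 0) (k := i) (by omega)
  have h1 := h.pow_conj_seg (m := 1) (k := i) (by omega)
  rw [zero_add] at h0
  rw [add_comm 1 i, ← heq, ← h0] at h1
  exact (mul_left_cancel (mul_right_cancel h1)).symm

theorem Subgroup.commute_of_mem_closure {S : Set G} {x y : G} (h : ∀ z ∈ S, Commute x z)
    (hy : y ∈ Subgroup.closure S) : Commute x y := by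
  have : Subgroup.closure S ≤ Subgroup.centralizer {x} := by
    rw [Subgroup.closure_le]
    intro z hz
    exact Subgroup.mem_centralizer_singleton_iff.mpr (h z hz).symm.eq
  exact (Subgroup.mem_centralizer_singleton_iff.mp (this hy)).symm

/-- Non-collapsing: each generator but the last one or two is new. -/
theorem BraidSeq.notMem_closure (h : BraidSeq N t) (h01 : t 0 ≠ t 1) {k : ℕ} (hk : k + 1 < N) :
    t k ∉ Subgroup.closure (t '' Set.Iio k) := by
  intro hmem
  refine h.ne_succ h01 hk (h.eq_of_commute hk
    (Subgroup.commute_of_mem_closure ?_ hmem).symm)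
  rintro _ ⟨m, hm, rfl⟩
  exact (h.comm _ _ (by simp at hm; omega) hk).symm

/-- Factorial growth of the subgroups generated by initial segments. -/
theorem BraidSeq.factorial_le_card [Finite G] (h : BraidSeq N t) {a c k₀ : ℕ}
    (hnc : ∀ k, k < N → t k ∉ Subgroup.closure (t '' Set.Iio k))
    (hbase : a * (k₀ + 1).factorial ≤ c * Nat.card (Subgroup.closure (t '' Set.Iio k₀))) {k : ℕ}
    (hk : k₀ ≤ k) (hkN : k ≤ N) :
    a * (k + 1).factorial ≤ c * Nat.card (Subgroup.closure (t '' Set.Iio k)) := by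
  induction k, hk using Nat.le_induction with
  | base => exact hbase
  | succ k hk ih =>
    have h1 := (h.mono hkN).card_closure_succ (hnc k (by omega))
    calc a * (k + 1 + 1).factorial = (k + 2) * (a * (k + 1).factorial) := by
          rw [Nat.factorial_succ]; ring
      _ ≤ (k + 2) * (c * Nat.card (Subgroup.closure (t '' Set.Iio k))) :=
          Nat.mul_le_mul_left _ (ih (by omega))
      _ = c * ((k + 2) * Nat.card (Subgroup.closure (t '' Set.Iio k))) := by ring
      _ ≤ _ := Nat.mul_le_mul_left _ h1

end

/-- A noncommutative homomorphism from the braid group to a symmetric group of the same degree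
sends the generators to involutions. -/
theorem BraidSeq.sq_eq_one {n : ℕ} (hn : 5 ≤ n) {s : ℕ → Perm (Fin n)} (h : BraidSeq (n - 1) s)
    (h01 : s 0 ≠ s 1) : s 0 ^ 2 = 1 := by
  by_contra hsq
  obtain ⟨n, rfl⟩ : ∃ m, n = m + 5 := ⟨n - 5, by omega⟩
  rw [show n + 5 - 1 = n + 4 by omega] at h
  have conj1 : ∀ i, i + 1 < n + 4 → s (i + 1) ^ 2 =
      seg s 0 (n + 4) * s i ^ 2 * (seg s 0 (n + 4))⁻¹ := fun i hi => by
    rw [← conj_pow, h.conj_seg hi]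
  by_cases hc : Commute (s 2) (s 3 ^ 2)
  · -- all squares agree
    have hc' : Commute (s 0) (s 1 ^ 2) := by
      have h2 := h.pow_conj_seg (m := 0) (k := 2) (by omega)
      have h3 := h.pow_conj_seg (m := 1) (k := 2) (by omega)
      simp only [Nat.zero_add] at h2
      rw [← h2, ← h3, conj_pow] at hc
      have := hc.map (MulAut.conj ((seg s 0 (n + 4)) ^ 2)⁻¹).toMonoidHom
      simp only [MulEquiv.toMonoidHom_eq_coe, MonoidHom.coe_coe, MulAut.conj_apply] at this
      have e : ∀ x y : Perm (Fin (n + 5)), x⁻¹ * (x * y * x⁻¹) * x⁻¹⁻¹ = y := fun x y => by group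
      rwa [e, e] at this
    have heq : s 0 ^ 2 = s 1 ^ 2 := by
      have hb : s 0 * s 1 * s 0 = s 1 * s 0 * s 1 := h.braid 0 (by omega)
      have h2 : s 1 * s 0 * (s 1 * s 1) = s 0 * s 0 * (s 1 * s 0) := by
        calc _ = (s 1 * s 0 * s 1) * s 1 := by group
          _ = (s 0 * s 1 * s 0) * s 1 := by rw [hb]
          _ = s 0 * (s 1 * s 0 * s 1) := by group
          _ = s 0 * (s 0 * s 1 * s 0) := by rw [hb]
          _ = _ := by group
      have h3 : s 0 * (s 1 * s 1) = s 1 * s 1 * s 0 := by simpa [pow_two] using hc'.eq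
      have h4 : s 1 * s 0 * (s 1 * s 1) = (s 1 * s 1) * (s 1 * s 0) := by
        rw [mul_assoc, h3]; group
      rw [h4] at h2
      rw [pow_two, pow_two]
      exact (mul_right_cancel h2).symm
    have hz : ∀ i, i < n + 4 → s i ^ 2 = s 0 ^ 2 := by
      intro i hi
      induction i with
      | zero => rfl
      | succ i ih =>
        rw [conj1 i hi, ih (by omega), ← conj1 0 (by omega), heq]
    have hle : Subgroup.closure (s '' Set.Iio (n + 3)) ≤ Subgroup.centralizer {s 0 ^ 2} := by
      rw [Subgroup.closure_le]
      rintro _ ⟨m, hm, rfl⟩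
      simp only [Set.mem_Iio] at hm
      rw [SetLike.mem_coe, Subgroup.mem_centralizer_singleton_iff, ← hz m (by omega)]
      group
    have hcard := Subgroup.card_le_of_le hle
    have hup := card_centralizer_le_of_ne_one hsq
    have hbase : 3 * (1 + 1).factorial ≤ 2 * Nat.card (Subgroup.closure (s '' Set.Iio 1)) := by
      have : s '' Set.Iio 1 = {s 0} := by ext; simp
      rw [this, ← Subgroup.zpowers_eq_closure, Nat.card_zpowers]
      have h0 := orderOf_pos (s 0)
      have h1 : orderOf (s 0) ≠ 1 := fun h => hsq (by rw [orderOf_eq_one_iff.mp h]; simp)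
      have h2 : orderOf (s 0) ≠ 2 := fun h => hsq (by rw [← h]; exact pow_orderOf_eq_one _)
      simp only [Nat.factorial]
      omega
    have hlow := (h.mono (by omega : n + 3 ≤ n + 4)).factorial_le_card (fun k hk =>
      h.notMem_closure h01 (by omega)) hbase (k := n + 3) (by omega) le_rfl
    have h5 : 3 * (n + 3 + 1).factorial ≤ 2 * ((n + 5) * (n + 3).factorial) :=
      hlow.trans (Nat.mul_le_mul_left _ (hcard.trans hup))
    rw [Nat.factorial_succ] at h5
    have := (n + 3).factorial_pos
    nlinarith
  · set t : ℕ → Perm (Fin (n + 5)) := fun i => s (i + 2) with ht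
    have hbt : BraidSeq (n + 2) t := h.shift (by omega)
    have hnc : ∀ k, k < n + 2 → t k ∉ Subgroup.closure (t '' Set.Iio k) := by
      intro k hk hmem
      apply h.notMem_closure h01 (k := k) (by omega)
      let f : Perm (Fin (n + 5)) →* Perm (Fin (n + 5)) :=
        (MulAut.conj ((seg s 0 (n + 4)) ^ 2)⁻¹).toMonoidHom
      have hf : ∀ m, m < n + 2 → f (t m) = s m := by
        intro m hm
        simp only [f, ht, MulEquiv.toMonoidHom_eq_coe, MonoidHom.coe_coe, MulAut.conj_apply]
        rw [← h.pow_conj_seg (m := m) (k := 2) (by omega)]; group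
      have := Subgroup.mem_map_of_mem f hmem
      rw [MonoidHom.map_closure, hf k hk] at this
      convert this using 2
      rw [Set.image_image]
      exact Set.image_congr fun m hm => (hf m (by simp at hm; omega)).symm
    have hle : Subgroup.closure (t '' Set.Iio (n + 2)) ≤ Subgroup.centralizer {s 0} := by
      rw [Subgroup.closure_le]
      rintro _ ⟨m, hm, rfl⟩
      simp only [Set.mem_Iio] at hm
      rw [SetLike.mem_coe, Subgroup.mem_centralizer_singleton_iff]
      exact (h.comm 0 (m + 2) (by omega) (by omega)).symm.eq
    have hcard := Subgroup.card_le_of_le hle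
    have hup := card_centralizer_le_of_sq_ne_one hsq
    have hbase : 2 * (2 + 1).factorial ≤ 1 * Nat.card (Subgroup.closure (t '' Set.Iio 2)) := by
      set a := t 0
      set b := t 1
      have h1set : t '' Set.Iio 1 = {a} := by ext; simp [a]
      have h2set : t '' Set.Iio 2 = {a, b} := by
        ext x
        simp only [Set.mem_image, Set.mem_Iio, Set.mem_insert_iff, Set.mem_singleton_iff]
        constructor
        · rintro ⟨m, hm, rfl⟩
          interval_cases m <;> simp [a, b]
        · rintro (rfl | rfl)
          · exact ⟨0, by omega, rfl⟩
          · exact ⟨1, by omega, rfl⟩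
      have hbn : b ∉ Subgroup.zpowers a := by
        have := hnc 1 (by omega)
        rwa [h1set, ← Subgroup.zpowers_eq_closure] at this
      have hb2 : b ^ 2 ∉ Subgroup.zpowers a := by
        rintro ⟨k, hk⟩
        apply hc
        change Commute a (b ^ 2)
        rw [← hk]
        exact (Commute.refl a).zpow_right k
      have hab : a * b * a = b * a * b := hbt.braid 0 (by omega)
      have ha : a ∈ Subgroup.zpowers a := Subgroup.mem_zpowers a
      have hK : Subgroup.zpowers a ≤ Subgroup.closure {a, b} := by
        rw [Subgroup.zpowers_le]; exact Subgroup.subset_closure (by simp)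
      have haK : a ∈ Subgroup.closure {a, b} := Subgroup.subset_closure (by simp)
      have hbK : b ∈ Subgroup.closure {a, b} := Subgroup.subset_closure (by simp)
      have hcon : b⁻¹ * a * b = a * b * a⁻¹ := by
        rw [eq_mul_inv_iff_mul_eq, mul_assoc, mul_assoc, inv_mul_eq_iff_eq_mul, ← mul_assoc, hab,
          mul_assoc]
      have hconj : ∀ x, a * x * a⁻¹ ∈ Subgroup.zpowers a → x ∈ Subgroup.zpowers a := by
        intro x hx
        have := mul_mem (mul_mem (inv_mem ha) hx) ha
        simpa [mul_assoc] using this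
      have key := card_mul_le_of_cosets hK (m := 4) ![1, b, a * b, a * a * b] (by
        intro i
        fin_cases i
        · exact one_mem _
        · exact hbK
        · exact mul_mem haK hbK
        · exact mul_mem (mul_mem haK haK) hbK) (by
        have f1 : b⁻¹ ∉ Subgroup.zpowers a := fun hx => hbn (by simpa using inv_mem hx)
        have f2 : (a * b)⁻¹ ∉ Subgroup.zpowers a := fun hx => hbn (by
          have := mul_mem (inv_mem ha) (inv_mem hx); simpa using this)
        have f3 : (a * a * b)⁻¹ ∉ Subgroup.zpowers a := fun hx => hbn (by
          have := mul_mem (inv_mem ha) (mul_mem (inv_mem ha) (inv_mem hx))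
          simpa [mul_assoc] using this)
        have f4 : (a * b)⁻¹ * b ∉ Subgroup.zpowers a := fun hx => hbn (by
          have h1 : ((a * b)⁻¹ * b)⁻¹ = b⁻¹ * a * b := by group
          have := inv_mem hx
          rw [h1, hcon] at this
          exact hconj _ this)
        have f5 : (a * a * b)⁻¹ * b ∉ Subgroup.zpowers a := fun hx => hb2 (by
          have h1 : ((a * a * b)⁻¹ * b)⁻¹ = (b⁻¹ * a * b) * (b⁻¹ * a * b) := by
            simp [mul_assoc]
          have := inv_mem hx
          rw [h1, hcon] at this
          apply hconj
          convert this using 1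
          rw [pow_two]
          group)
        have f6 : (a * a * b)⁻¹ * (a * b) ∉ Subgroup.zpowers a := fun hx => hbn (by
          have h1 : ((a * a * b)⁻¹ * (a * b))⁻¹ = b⁻¹ * a * b := by group
          have := inv_mem hx
          rw [h1, hcon] at this
          exact hconj _ this)
        intro i j hij
        fin_cases i <;> fin_cases j <;> simp at hij <;> simp <;>
          first
            | simpa using f1
            | simpa using f2
            | simpa using f3
            | simpa using f4
            | simpa using f5
            | simpa using f6)
      rw [h2set, one_mul]
      have hord : 3 ≤ Nat.card (Subgroup.zpowers a) := by
        rw [Nat.card_zpowers]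
        have e : a = seg s 0 (n + 4) ^ 2 * s 0 * (seg s 0 (n + 4) ^ 2)⁻¹ :=
          (h.pow_conj_seg (m := 0) (k := 2) (by omega)).symm
        have hsq' : a ^ 2 ≠ 1 := by
          rw [e, conj_pow]
          intro h9
          exact hsq (conj_eq_one_iff.mp h9)
        have h0 := orderOf_pos a
        have h1 : orderOf a ≠ 1 := fun h => hsq' (by rw [orderOf_eq_one_iff.mp h]; simp)
        have h2 : orderOf a ≠ 2 := fun h => hsq' (by rw [← h]; exact pow_orderOf_eq_one _)
        omega
      simp only [Nat.factorial]
      omega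
    have hlow := hbt.factorial_le_card hnc hbase (k := n + 2) (by omega) le_rfl
    have h5 : 2 * (n + 2 + 1).factorial ≤ 1 * ((n + 5) * (n + 2).factorial) :=
      hlow.trans (Nat.mul_le_mul_left _ (hcard.trans hup))
    rw [Nat.factorial_succ] at h5
    have := (n + 2).factorial_pos
    nlinarith

end

/-! ### The Artin action -/

section

open FreeGroup (of)

/-- The endomorphism of the free group underlying the Artin action of the `i`-th half twist. -/
def artinHom (i : ℕ) : FreeGroup ℕ →* FreeGroup ℕ :=
  FreeGroup.lift fun j => if j = i then of (i + 1) else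
    if j = i + 1 then (of (i + 1))⁻¹ * of i * of (i + 1) else of j

/-- The inverse of `artinHom i`. -/
def artinInvHom (i : ℕ) : FreeGroup ℕ →* FreeGroup ℕ :=
  FreeGroup.lift fun j => if j = i + 1 then of i else
    if j = i then of i * of (i + 1) * (of i)⁻¹ else of j

/-- The Artin action of the `i`-th half twist on the free group. -/
def artin (i : ℕ) : MulAut (FreeGroup ℕ) :=
  MonoidHom.toMulEquiv (artinHom i) (artinInvHom i)
    (by ext j; by_cases h : j = i <;> by_cases h' : j = i + 1 <;>
      simp [artinHom, artinInvHom, h, h', mul_assoc])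
    (by ext j; by_cases h : j = i <;> by_cases h' : j = i + 1 <;>
      simp [artinHom, artinInvHom, h, h', mul_assoc])

theorem artin_self (i : ℕ) : artin i (of i) = of (i + 1) := by
  change artinHom i (of i) = _
  simp [artinHom]

theorem artin_succ (i : ℕ) : artin i (of (i + 1)) = (of (i + 1))⁻¹ * of i * of (i + 1) := by
  change artinHom i (of (i + 1)) = _
  simp [artinHom]

theorem artin_of_ne {i j : ℕ} (h : j ≠ i) (h' : j ≠ i + 1) : artin i (of j) = of j := by
  change artinHom i (of j) = _
  simp [artinHom, h, h']

theorem FreeGroup.mulAut_ext {X : Type*} {α β : MulAut (FreeGroup X)}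
    (h : ∀ j, α (of j) = β (of j)) : α = β := by
  apply MulEquiv.ext
  intro x
  exact DFunLike.congr_fun (FreeGroup.ext_hom (f := α.toMonoidHom) (g := β.toMonoidHom) h) x

theorem artin_braidSeq (N : ℕ) : BraidSeq N artin where
  braid i _ := by
    apply FreeGroup.mulAut_ext
    intro j
    simp only [MulAut.mul_apply]
    by_cases h0 : j = i
    · subst h0
      simp [artin_self, artin_of_ne (show j ≠ j + 1 by omega) (show j ≠ j + 1 + 1 by omega)]
      rw [artin_of_ne (by omega) (by omega)]
    by_cases h1 : j = i + 1
    · subst h1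
      have e1 := artin_of_ne (show i + 1 + 1 ≠ i by omega) (show i + 1 + 1 ≠ i + 1 by omega)
      have e2 := artin_of_ne (show i ≠ i + 1 by omega) (show i ≠ i + 1 + 1 by omega)
      simp only [e1, e2, artin_succ, artin_self, map_mul, map_inv]
    by_cases h2 : j = i + 1 + 1
    · subst h2
      have e1 := artin_of_ne (show i + 1 + 1 ≠ i by omega) (show i + 1 + 1 ≠ i + 1 by omega)
      have e2 := artin_of_ne (show i ≠ i + 1 by omega) (show i ≠ i + 1 + 1 by omega)
      simp only [e1, e2, artin_succ, artin_self, map_mul, map_inv]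
      group
    simp only [artin_of_ne h0 h1, artin_of_ne h1 h2]
  comm i j hij _ := by
    apply FreeGroup.mulAut_ext
    intro k
    simp only [MulAut.mul_apply]
    have e1 := artin_of_ne (show i ≠ j by omega) (show i ≠ j + 1 by omega)
    have e2 := artin_of_ne (show i + 1 ≠ j by omega) (show i + 1 ≠ j + 1 by omega)
    have e3 := artin_of_ne (show j ≠ i by omega) (show j ≠ i + 1 by omega)
    have e4 := artin_of_ne (show j + 1 ≠ i by omega) (show j + 1 ≠ i + 1 by omega)
    by_cases h0 : k = i
    · subst h0; simp only [e1, e2, artin_self]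
    by_cases h1 : k = i + 1
    · subst h1; simp only [e1, e2, artin_succ, map_mul, map_inv]
    by_cases h2 : k = j
    · subst h2; simp only [e3, e4, artin_self]
    by_cases h3 : k = j + 1
    · subst h3; simp only [e3, e4, artin_succ, map_mul, map_inv]
    simp only [artin_of_ne h0 h1, artin_of_ne h2 h3]

/-- The action of words in the half twists on the free group. -/
def act : FreeGroup ℕ →* MulAut (FreeGroup ℕ) := FreeGroup.lift artin

/-- The permutation of the strands of a word in the half twists. -/
def wperm : FreeGroup ℕ →* Equiv.Perm ℕ := FreeGroup.lift fun i => Equiv.swap i (i + 1)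

@[simp] theorem act_of (i : ℕ) : act (of i) = artin i := by simp [act]

@[simp] theorem wperm_of (i : ℕ) : wperm (of i) = Equiv.swap i (i + 1) := by simp [wperm]

theorem permLike_artin (i : ℕ) : PermLike (artin i) (Equiv.swap i (i + 1)) := by
  intro j
  by_cases h0 : j = i
  · subst h0; rw [artin_self, Equiv.swap_apply_left]
  by_cases h1 : j = i + 1
  · subst h1
    rw [artin_succ, Equiv.swap_apply_right]
    exact isConj_iff.mpr ⟨(of (i + 1))⁻¹, by simp⟩
  rw [artin_of_ne h0 h1, Equiv.swap_apply_of_ne_of_ne h0 h1]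

theorem permLike_act (w : FreeGroup ℕ) : PermLike (act w) (wperm w) := by
  induction w using FreeGroup.induction_on with
  | C1 => simpa using PermLike.one
  | of i => simpa using permLike_artin i
  | inv_of i _ =>
    have := (permLike_artin i).symm
    simp only [map_inv, act_of, wperm_of]
    exact this
  | mul x y hx hy => simpa using hx.mul hy

/-- Words in the half twists of the first `n` strands. -/
def strands (n : ℕ) : Subgroup (FreeGroup ℕ) := Subgroup.closure (of '' {i | i + 1 < n})

theorem of_mem_strands {n i : ℕ} (h : i + 1 < n) : of i ∈ strands n :=
  Subgroup.subset_closure ⟨i, h, rfl⟩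

theorem strands_mono {m n : ℕ} (h : m ≤ n) : strands m ≤ strands n :=
  Subgroup.closure_mono (Set.image_mono fun i (hi : i + 1 < m) => by simp; omega)

theorem strands_induction {n : ℕ} {p : FreeGroup ℕ → Prop} (one : p 1)
    (mul : ∀ i w, i + 1 < n → w ∈ strands n → p w → p (of i * w))
    (inv_mul : ∀ i w, i + 1 < n → w ∈ strands n → p w → p ((of i)⁻¹ * w)) :
    ∀ w ∈ strands n, p w := by
  intro w hw
  induction hw using Subgroup.closure_induction_left with
  | one => exact one
  | mul_left x hx y hy ih => obtain ⟨i, hi, rfl⟩ := hx; exact mul i y hi hy ih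
  | inv_mul_cancel x hx y hy ih => obtain ⟨i, hi, rfl⟩ := hx; exact inv_mul i y hi hy ih

theorem wperm_apply_of_le {n j : ℕ} (hj : n ≤ j) : ∀ w ∈ strands n, wperm w j = j := by
  apply strands_induction
  · simp
  · intro i w hi _ hw
    rw [map_mul, Equiv.Perm.mul_apply, hw, wperm_of,
      Equiv.swap_apply_of_ne_of_ne (by omega) (by omega)]
  · intro i w hi _ hw
    rw [map_mul, Equiv.Perm.mul_apply, hw, map_inv, wperm_of, Equiv.swap_inv,
      Equiv.swap_apply_of_ne_of_ne (by omega) (by omega)]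

theorem wperm_lt {n j : ℕ} (hj : j < n) {w : FreeGroup ℕ} (hw : w ∈ strands n) :
    wperm w j < n := by
  by_contra h
  have := wperm_apply_of_le (not_lt.mp h) w hw
  rw [(wperm w).injective this] at h
  exact h hj

theorem act_of_le {n j : ℕ} (hj : n ≤ j) : ∀ w ∈ strands n, act w (of j) = of j := by
  apply strands_induction
  · simp
  · intro i w hi _ hw
    rw [map_mul, MulAut.mul_apply, hw, act_of, artin_of_ne (by omega) (by omega)]
  · intro i w hi _ hw
    rw [map_mul, MulAut.mul_apply, hw, map_inv, act_of, MulAut.inv_apply, MulEquiv.symm_apply_eq,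
      artin_of_ne (by omega) (by omega)]

theorem artin_seg {n i : ℕ} (hi : i + 1 < n) : artin i (seg of 0 n) = seg of 0 n := by
  obtain ⟨b, rfl⟩ : ∃ b, n = i + 2 + b := ⟨n - (i + 2), by omega⟩
  have h2 : seg (G := FreeGroup ℕ) of i 2 = of i * of (i + 1) := by simp [seg]
  have fix : ∀ a l, (∀ m, a ≤ m → m < a + l → m ≠ i ∧ m ≠ i + 1) →
      artin i (seg of a l) = seg of a l := fun a l h => by
    have := map_seg (t := of) (artin i).toMonoidHom a l
    refine this.trans (seg_congr fun m h1 h3 => ?_)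
    exact artin_of_ne (h m h1 h3).1 (h m h1 h3).2
  have f1 := fix 0 i fun m _ _ => by omega
  have f2 := fix (i + 2) b fun m _ _ => by omega
  rw [seg_add, seg_add, zero_add, zero_add, map_mul, map_mul, f1, f2, h2, map_mul, artin_self,
    artin_succ]
  group

theorem act_seg {n : ℕ} : ∀ w ∈ strands n, act w (seg of 0 n) = seg of 0 n := by
  apply strands_induction
  · simp
  · intro i w hi _ hw
    rw [map_mul, MulAut.mul_apply, hw, act_of, artin_seg hi]
  · intro i w hi _ hw
    rw [map_mul, MulAut.mul_apply, hw, map_inv, act_of, MulAut.inv_apply, MulEquiv.symm_apply_eq,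
      artin_seg hi]

/-- The relations of the fundamental group of the sphere punctured at `T`, among `n` points. -/
def puncRel (n : ℕ) (T : Finset ℕ) : Subgroup (FreeGroup ℕ) :=
  Subgroup.normalClosure (insert (seg of 0 n) (of '' {j | j ∉ T}))

instance (n : ℕ) (T : Finset ℕ) : (puncRel n T).Normal := Subgroup.normalClosure_normal

theorem seg_mem_puncRel (n : ℕ) (T : Finset ℕ) : seg of 0 n ∈ puncRel n T :=
  Subgroup.subset_normalClosure (Set.mem_insert _ _)

theorem of_mem_puncRel {n j : ℕ} {T : Finset ℕ} (h : j ∉ T) : of j ∈ puncRel n T :=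
  Subgroup.subset_normalClosure (Set.mem_insert_of_mem _ ⟨j, h, rfl⟩)

theorem puncRel_le {n : ℕ} {T : Finset ℕ} {K : Subgroup (FreeGroup ℕ)} [K.Normal]
    (h : seg of 0 n ∈ K) (h' : ∀ j ∉ T, of j ∈ K) : puncRel n T ≤ K := by
  apply Subgroup.normalClosure_le_normal
  rintro _ (rfl | ⟨j, hj, rfl⟩)
  exacts [h, h' j hj]

theorem puncRel_anti (n : ℕ) {S T : Finset ℕ} (h : S ⊆ T) : puncRel n T ≤ puncRel n S :=
  puncRel_le (seg_mem_puncRel _ _) fun _ hj => of_mem_puncRel fun h2 => hj (h h2)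

theorem puncRel_congr {m n : ℕ} {T : Finset ℕ} (hmn : m ≤ n) (hT : T ⊆ Finset.range m) :
    puncRel n T = puncRel m T := by
  have key : ∀ K : Subgroup (FreeGroup ℕ), (∀ j ∉ T, of j ∈ K) →
      (seg of 0 n ∈ K ↔ seg of 0 m ∈ K) := fun K hK => by
    obtain ⟨b, rfl⟩ := Nat.exists_eq_add_of_le hmn
    rw [seg_add]
    refine Subgroup.mul_mem_cancel_right _ (seg_mem fun j h1 _ => hK j fun h => ?_)
    have := Finset.mem_range.mp (hT h); omega
  apply le_antisymm
  · exact puncRel_le ((key _ fun j hj => of_mem_puncRel hj).mpr (seg_mem_puncRel _ _))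
      fun j hj => of_mem_puncRel hj
  · exact puncRel_le ((key _ fun j hj => of_mem_puncRel hj).mp (seg_mem_puncRel _ _))
      fun j hj => of_mem_puncRel hj

theorem act_mem_puncRel {n : ℕ} {w : FreeGroup ℕ} (hw : w ∈ strands n) {T : Finset ℕ}
    {y : FreeGroup ℕ} (hy : y ∈ puncRel n T) :
    act w y ∈ puncRel n (T.map (wperm w).toEmbedding) := by
  have : puncRel n T ≤ (puncRel n (T.map (wperm w).toEmbedding)).comap (act w).toMonoidHom := by
    apply puncRel_le
    · change act w _ ∈ puncRel n _
      rw [act_seg w hw]; exact seg_mem_puncRel _ _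
    · intro j hj
      obtain ⟨c, hc⟩ := isConj_iff.mp (permLike_act w j)
      change act w _ ∈ puncRel n _
      rw [← hc]
      refine Subgroup.Normal.conj_mem inferInstance _ (of_mem_puncRel ?_) _
      simpa using hj
  exact this hy

theorem act_mem_puncRel_iff {n : ℕ} {w : FreeGroup ℕ} (hw : w ∈ strands n) {T : Finset ℕ}
    {y : FreeGroup ℕ} :
    act w y ∈ puncRel n (T.map (wperm w).toEmbedding) ↔ y ∈ puncRel n T := by
  refine ⟨fun h => ?_, act_mem_puncRel hw⟩
  have := act_mem_puncRel (inv_mem hw) h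
  rw [Finset.map_map] at this
  have e : T.map ((wperm w).toEmbedding.trans (wperm w⁻¹).toEmbedding) = T := by
    convert Finset.map_refl using 2
    ext; simp
  rw [e] at this
  simpa using this

theorem act_mem_puncRel_of_pure {n : ℕ} {w : FreeGroup ℕ} (hw : w ∈ strands n) (h1 : wperm w = 1)
    {T : Finset ℕ} {y : FreeGroup ℕ} : act w y ∈ puncRel n T ↔ y ∈ puncRel n T := by
  have := act_mem_puncRel_iff hw (T := T) (y := y)
  have e : T.map (wperm w).toEmbedding = T := by
    rw [h1]; convert Finset.map_refl using 2; rfl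
  rwa [e] at this

end

/-! ### Point pushes in braid groups -/

section

open FreeGroup (of)

/-- The product `t (i + l - 1) * ⋯ * t (i + 1) * t i`. -/
def rseg {G : Type*} [Group G] (t : ℕ → G) (i : ℕ) : ℕ → G
  | 0 => 1
  | l + 1 => t (i + l) * rseg t i l

section

variable {G : Type*} [Group G] {t : ℕ → G}

theorem seg_inv (i l : ℕ) : seg (fun j => (t j)⁻¹) i l = (rseg t i l)⁻¹ := by
  induction l with
  | zero => simp [seg, rseg]
  | succ l ih => simp [seg, rseg, ih]

theorem rseg_succ' (i l : ℕ) : rseg t i (l + 1) = rseg t (i + 1) l * t i := by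
  rw [← inv_inj, ← seg_inv, seg_succ', seg_inv, mul_inv_rev]

theorem map_rseg {H : Type*} [Group H] (f : G →* H) (i l : ℕ) :
    f (rseg t i l) = rseg (fun i => f (t i)) i l := by
  induction l with
  | zero => simp [rseg]
  | succ l ih => simp [rseg, ih]

theorem rseg_mem {H : Subgroup G} {i l : ℕ} (h : ∀ m, i ≤ m → m < i + l → t m ∈ H) :
    rseg t i l ∈ H := by
  rw [← inv_mem_iff, ← seg_inv]
  exact seg_mem fun m h1 h2 => inv_mem (h m h1 h2)

theorem Commute.rseg_right {x : G} {i l : ℕ} (h : ∀ m, i ≤ m → m < i + l → Commute x (t m)) :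
    Commute x (rseg t i l) := by
  rw [← Commute.inv_right_iff, ← seg_inv]
  exact Commute.seg_right fun m h1 h2 => (h m h1 h2).inv_right

variable {N : ℕ}

theorem BraidSeq.inv (h : BraidSeq N t) : BraidSeq N fun i => (t i)⁻¹ :=
  ⟨fun i hi => by
    have := congrArg (·⁻¹) (h.braid i hi)
    simpa [mul_assoc] using this, fun i j hij hj => (h.comm i j hij hj).inv_inv⟩

theorem BraidSeq.rseg_mul (h : BraidSeq N t) {i l m : ℕ} (hN : i + l ≤ N) (him : i ≤ m)
    (hm : m + 1 < i + l) : rseg t i l * t (m + 1) = t m * rseg t i l := by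
  have := h.inv.seg_mul hN him hm
  rw [seg_inv, ← mul_inv_rev, ← mul_inv_rev, inv_inj] at this
  exact this.symm

/-- The element pushing strand `j` around the last of `m` strands. -/
def pushGen (t : ℕ → G) (m j : ℕ) : G :=
  if j + 2 ≤ m then (rseg t j (m - 2 - j))⁻¹ * t (m - 2) ^ 2 * rseg t j (m - 2 - j) else 1

theorem pushGen_of_lt {m j : ℕ} (h : m < j + 2) : pushGen t m j = 1 := by
  rw [pushGen, if_neg (by omega)]

theorem pushGen_last (j : ℕ) : pushGen t (j + 2) j = t j ^ 2 := by
  rw [pushGen, if_pos le_rfl]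
  simp [rseg]

theorem pushGen_succ {m j : ℕ} (h : j + 3 ≤ m) :
    pushGen t m j = (t j)⁻¹ * pushGen t m (j + 1) * t j := by
  obtain ⟨d, rfl⟩ := Nat.exists_eq_add_of_le h
  rw [pushGen, if_pos (by omega), pushGen, if_pos (by omega),
    show j + 3 + d - 2 - j = d + 1 by omega, show j + 3 + d - 2 - (j + 1) = d by omega, rseg_succ']
  group

theorem map_pushGen {H : Type*} [Group H] (f : G →* H) (m j : ℕ) :
    f (pushGen t m j) = pushGen (fun i => f (t i)) m j := by
  unfold pushGen
  split_ifs
  · simp [map_rseg]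
  · simp

/-- The point-pushing homomorphism on `m` strands. -/
def pushHom (t : ℕ → G) (m : ℕ) : FreeGroup ℕ →* G := FreeGroup.lift (pushGen t m)

@[simp] theorem pushHom_of (m j : ℕ) : pushHom t m (of j) = pushGen t m j := by simp [pushHom]

theorem map_pushHom {H : Type*} [Group H] (f : G →* H) (m : ℕ) (u : FreeGroup ℕ) :
    f (pushHom t m u) = pushHom (fun i => f (t i)) m u := by
  have : f.comp (pushHom t m) = pushHom (fun i => f (t i)) m := by
    ext j; simp [map_pushGen]
  exact DFunLike.congr_fun this u

theorem BraidSeq.pushGen_eq {j d : ℕ} (h : BraidSeq (j + d + 1) t) :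
    pushGen t (j + d + 2) j = rseg t (j + 1) d * t j ^ 2 * (rseg t (j + 1) d)⁻¹ := by
  induction d generalizing j with
  | zero => simp [rseg, pushGen_last]
  | succ d ih =>
    have h1 := ih (j := j + 1) (by rwa [show j + 1 + d + 1 = j + (d + 1) + 1 by omega])
    rw [show j + 1 + d + 2 = j + (d + 1) + 2 by omega] at h1
    rw [pushGen_succ (by omega), h1]
    have hc : Commute (t j) (rseg t (j + 1 + 1) d) :=
      Commute.rseg_right fun m h1 h2 => h.comm _ _ (by omega) (by omega)
    have hb := h.braid j (by omega)
    rw [rseg_succ' (j + 1) d]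
    have e : (t j)⁻¹ * t (j + 1) ^ 2 * t j = t (j + 1) * t j ^ 2 * (t (j + 1))⁻¹ := by
      have e1 : (t j)⁻¹ * t (j + 1) * t j = t (j + 1) * t j * (t (j + 1))⁻¹ := by
        rw [eq_mul_inv_iff_mul_eq, mul_assoc, mul_assoc, inv_mul_eq_iff_eq_mul, ← mul_assoc,
          ← mul_assoc, hb.symm]
      calc _ = ((t j)⁻¹ * t (j + 1) * t j) ^ 2 := by simp [pow_two, mul_assoc]
        _ = _ := by rw [e1]; simp [pow_two, mul_assoc]
    set E := rseg t (j + 1 + 1) d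
    calc (t j)⁻¹ * (E * t (j + 1) ^ 2 * E⁻¹) * t j
        = ((t j)⁻¹ * E) * t (j + 1) ^ 2 * (E⁻¹ * t j) := by group
      _ = (E * (t j)⁻¹) * t (j + 1) ^ 2 * (t j * E⁻¹) := by
          rw [hc.inv_left.eq, hc.inv_right.eq]
      _ = E * ((t j)⁻¹ * t (j + 1) ^ 2 * t j) * E⁻¹ := by group
      _ = _ := by rw [e]; group

theorem BraidSeq.seg_pushGen {j d : ℕ} (h : BraidSeq (j + d) t) :
    seg (pushGen t (j + d + 1)) j d = rseg t j d * seg t j d := by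
  induction d generalizing j with
  | zero => simp [seg, rseg]
  | succ d ih =>
    have h1 := ih (j := j + 1) (by rwa [show j + 1 + d = j + (d + 1) by omega])
    rw [show j + 1 + d + 1 = j + (d + 1) + 1 by omega] at h1
    have h2 := BraidSeq.pushGen_eq (j := j) (d := d) h
    rw [show j + d + 2 = j + (d + 1) + 1 by omega] at h2
    rw [seg_succ', h1, h2, rseg_succ', seg_succ']
    simp [pow_two, mul_assoc]

theorem BraidSeq.pushHom_seg {m : ℕ} (h : BraidSeq (m - 1) t) (hm : 1 ≤ m) :
    pushHom t m (seg of 0 m) = rseg t 0 (m - 1) * seg t 0 (m - 1) := by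
  obtain ⟨m, rfl⟩ : ∃ k, m = k + 1 := ⟨m - 1, by omega⟩
  rw [map_seg]
  simp only [pushHom_of, Nat.add_sub_cancel] at h ⊢
  have := BraidSeq.seg_pushGen (j := 0) (d := m) (by simpa using h)
  simp only [zero_add] at this
  rw [seg, zero_add, pushGen_of_lt (by omega), mul_one, ← this]

theorem BraidSeq.pushGen_commute {m i j : ℕ} (h : BraidSeq (m - 1) t) (hi : i + 3 ≤ m)
    (h0 : j ≠ i) (h1 : j ≠ i + 1) : Commute (t i) (pushGen t m j) := by
  rcases lt_or_ge m (j + 2) with hj | hj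
  · rw [pushGen_of_lt hj]; exact Commute.one_right _
  have up : ∀ d i j, j + d + 2 = m → i + 2 ≤ j → Commute (t i) (pushGen t m j) := by
    intro d
    induction d with
    | zero =>
      rintro i j rfl hij
      rw [add_zero, pushGen_last]
      exact (h.comm i j hij (by omega)).pow_right 2
    | succ d ih =>
      intro i j hj hij
      rw [pushGen_succ (by omega)]
      have hc := h.comm i j hij (by omega)
      exact (hc.inv_right.mul_right (ih i (j + 1) (by omega) (by omega))).mul_right hc
  rcases lt_or_gt_of_ne h0 with hlt | hgt
  · have down : ∀ d j, j + 1 + d = i → Commute (t i) (pushGen t m j) := by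
      intro d
      induction d with
      | zero =>
        rintro j rfl
        have hb := h.braid j (by omega)
        have hc : Commute (t j) (pushGen t m (j + 1 + 1)) := by
          rcases lt_or_ge m (j + 1 + 1 + 2) with h9 | h9
          · omega
          · exact up (m - (j + 1 + 1) - 2) _ _ (by omega) (by omega)
        rw [pushGen_succ (by omega), pushGen_succ (by omega)]
        set z := pushGen t m (j + 1 + 1)
        rw [Commute, SemiconjBy, add_zero]
        set a := t j
        set b := t (j + 1)
        have e : b * a⁻¹ * b⁻¹ = a⁻¹ * b⁻¹ * a := by
          rw [← inv_inj]; simp only [mul_inv_rev, inv_inv]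
          rw [← mul_assoc, ← mul_assoc, mul_inv_eq_iff_eq_mul, mul_assoc, mul_assoc,
            eq_inv_mul_iff_mul_eq, ← mul_assoc, ← mul_assoc, hb]
        have e' : b * a * b = a * b * a := hb.symm
        calc b * (a⁻¹ * (b⁻¹ * z * b) * a) = (b * a⁻¹ * b⁻¹) * z * b * a := by group
          _ = a⁻¹ * b⁻¹ * (a * z) * b * a := by rw [e]; group
          _ = a⁻¹ * b⁻¹ * z * (a * b * a) := by rw [hc.eq]; group
          _ = _ := by rw [← e']; group
      | succ d ih =>
        intro j hj
        rw [pushGen_succ (by omega)]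
        have hc := (h.comm j i (by omega) (by omega)).symm
        exact (hc.inv_right.mul_right (ih (j + 1) (by omega))).mul_right hc
    exact down (i - j - 1) j (by omega)
  · exact up (m - j - 2) i j (by omega) (by omega)

theorem BraidSeq.pushGen_conj {i d : ℕ} (h : BraidSeq (i + d + 2) t) :
    t i * pushGen t (i + d + 3) (i + 1) * (t i)⁻¹ = (pushGen t (i + d + 3) (i + 1))⁻¹ *
      pushGen t (i + d + 3) i * pushGen t (i + d + 3) (i + 1) := by
  induction d generalizing i with
  | zero =>
    have h0 := pushGen_succ (t := t) (m := i + 0 + 3) (j := i) (by omega)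
    have h1 := pushGen_last (t := t) (i + 1)
    rw [show i + 1 + 2 = i + 0 + 3 by omega] at h1
    rw [h0, h1]
    have hb := h.braid i (by omega)
    set a := t i
    set b := t (i + 1)
    have e1 : a * b * a⁻¹ = b⁻¹ * a * b := by
      rw [mul_inv_eq_iff_eq_mul, mul_assoc, mul_assoc, eq_inv_mul_iff_mul_eq, ← mul_assoc,
        ← mul_assoc, hb]
    have e2 : a⁻¹ * b * a = b * a * b⁻¹ := by
      rw [eq_mul_inv_iff_mul_eq, mul_assoc, mul_assoc, inv_mul_eq_iff_eq_mul, ← mul_assoc,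
        ← mul_assoc, hb]
    calc a * b ^ 2 * a⁻¹ = (a * b * a⁻¹) ^ 2 := by simp [pow_two, mul_assoc]
      _ = b⁻¹ * a ^ 2 * b := by rw [e1]; simp [pow_two, mul_assoc]
      _ = (b ^ 2)⁻¹ * (b * a * b⁻¹) ^ 2 * b ^ 2 := by simp [pow_two, mul_assoc]
      _ = _ := by rw [← e2]; simp [pow_two, mul_assoc]
  | succ d ih =>
    have hN : BraidSeq (i + d + 3) t := by rwa [show i + d + 3 = i + (d + 1) + 2 by omega]
    have ih := ih (i := i + 1) (by rwa [show i + 1 + d + 2 = i + (d + 1) + 2 by omega])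
    rw [show i + 1 + d + 3 = i + d + 4 by omega] at ih
    rw [show i + (d + 1) + 3 = i + d + 4 by omega]
    have hc := BraidSeq.pushGen_commute (t := t) (m := i + d + 4) (i := i) (j := i + 1 + 1)
      (by simpa using hN) (by omega) (by omega) (by omega)
    rw [pushGen_succ (t := t) (j := i + 1) (by omega)] at ih
    rw [pushGen_succ (t := t) (j := i) (by omega), pushGen_succ (t := t) (j := i + 1) (by omega)]
    have hb := hN.braid i (by omega)
    set z := pushGen t (i + d + 4) (i + 1 + 1)
    set a := t i
    set b := t (i + 1)
    have e2 : a * b * a * b⁻¹ * a⁻¹ = b := by rw [hb]; group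
    have f1 : a * b * a * b⁻¹ = b * a := by rw [hb]; group
    have g1 : a * b * (a * (b⁻¹ * z * b) * a⁻¹) * (a * b)⁻¹ = b * z * b⁻¹ := by
      calc _ = (a * b * a * b⁻¹) * z * (a * b * a * b⁻¹)⁻¹ := by group
        _ = b * (a * z) * a⁻¹ * b⁻¹ := by rw [f1]; group
        _ = _ := by rw [hc.eq]; group
    have g2 : a * b * ((b⁻¹ * z * b)⁻¹ * (a⁻¹ * (b⁻¹ * z * b) * a) * (b⁻¹ * z * b)) * (a * b)⁻¹
        = z⁻¹ * (b⁻¹ * z * b) * z := by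
      have k1 : a * b * (b⁻¹ * z * b) * (a * b)⁻¹ = z := by
        calc _ = (a * z) * a⁻¹ := by group
          _ = _ := by rw [hc.eq]; group
      have k2 : a * b * a * (a * b)⁻¹ = b := by rw [hb]; group
      calc _ = (a * b * (b⁻¹ * z * b) * (a * b)⁻¹)⁻¹ * ((a * b * a * (a * b)⁻¹)⁻¹ *
            (a * b * (b⁻¹ * z * b) * (a * b)⁻¹) * (a * b * a * (a * b)⁻¹)) *
            (a * b * (b⁻¹ * z * b) * (a * b)⁻¹) := by group
        _ = _ := by rw [k1, k2]
    have : a * b * (a * (b⁻¹ * z * b) * a⁻¹) * (a * b)⁻¹ =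
        a * b * ((b⁻¹ * z * b)⁻¹ * (a⁻¹ * (b⁻¹ * z * b) * a) * (b⁻¹ * z * b)) * (a * b)⁻¹ := by
      rw [g1, g2]; exact ih
    exact mul_left_cancel (mul_right_cancel this)

theorem BraidSeq.pushHom_artin {m i : ℕ} (h : BraidSeq (m - 1) t) (hi : i + 3 ≤ m)
    (u : FreeGroup ℕ) : pushHom t m (artin i u) = t i * pushHom t m u * (t i)⁻¹ := by
  have key : (pushHom t m).comp (artin i).toMonoidHom =
      (MulAut.conj (t i)).toMonoidHom.comp (pushHom t m) := by
    apply FreeGroup.ext_hom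
    intro j
    change pushHom t m (artin i (of j)) = t i * pushHom t m (of j) * (t i)⁻¹
    by_cases h0 : j = i
    · subst h0
      rw [artin_self, pushHom_of, pushHom_of, pushGen_succ hi]; group
    by_cases h1 : j = i + 1
    · subst h1
      obtain ⟨d, rfl⟩ : ∃ d, m = i + d + 3 := ⟨m - i - 3, by omega⟩
      rw [artin_succ]
      simp only [map_mul, map_inv, pushHom_of]
      exact (BraidSeq.pushGen_conj (by simpa using h)).symm
    rw [artin_of_ne h0 h1, pushHom_of, (h.pushGen_commute hi h0 h1).eq]; group
  exact DFunLike.congr_fun key u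

theorem BraidSeq.pushHom_act {m : ℕ} (h : BraidSeq (m - 1) t) {w : FreeGroup ℕ}
    (hw : w ∈ strands (m - 1)) (u : FreeGroup ℕ) :
    pushHom t m (act w u) = FreeGroup.lift t w * pushHom t m u * (FreeGroup.lift t w)⁻¹ := by
  revert w
  apply strands_induction
  · simp
  · intro i w hi _ ih
    rw [map_mul, MulAut.mul_apply, act_of, h.pushHom_artin (by omega), ih, map_mul,
      FreeGroup.lift_apply_of]
    group
  · intro i w hi _ ih
    have h1 := h.pushHom_artin (i := i) (by omega) ((artin i)⁻¹ (act w u))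
    rw [MulAut.inv_apply, MulEquiv.apply_symm_apply, ih] at h1
    rw [map_mul, MulAut.mul_apply, map_inv, act_of, map_mul, map_inv, FreeGroup.lift_apply_of,
      MulAut.inv_apply]
    rw [mul_inv_rev, inv_inv]
    calc _ = (t i)⁻¹ * (t i * pushHom t m ((MulEquiv.symm (artin i)) (act w u)) *
        (t i)⁻¹) * t i := by
          group
      _ = _ := by rw [← h1]; group

end

end

/-! ### Normal forms of braids and permutations -/

section

open FreeGroup (of)

theorem strands_induction_right {n : ℕ} {p : FreeGroup ℕ → Prop} (one : p 1)
    (mul : ∀ i w, i + 1 < n → w ∈ strands n → p w → p (w * of i))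
    (mul_inv : ∀ i w, i + 1 < n → w ∈ strands n → p w → p (w * (of i)⁻¹)) :
    ∀ w ∈ strands n, p w := by
  intro w hw
  induction hw using Subgroup.closure_induction_right with
  | one => exact one
  | mul_right x hx y hy ih => obtain ⟨i, hi, rfl⟩ := hy; exact mul i x hi hx ih
  | mul_inv_cancel x hx y hy ih => obtain ⟨i, hi, rfl⟩ := hy; exact mul_inv i x hi hx ih

section

variable {G : Type*} [Group G] {t : ℕ → G}

theorem BraidSeq.exists_lift_eq {m : ℕ} (h : BraidSeq (m - 1) t) : ∀ w ∈ strands m,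
    ∃ u, ∃ v ∈ strands (m - 1), ∃ j, j ≤ m - 1 ∧
      FreeGroup.lift t w = pushHom t m u * FreeGroup.lift t v * rseg t j (m - 1 - j) := by
  have absorb : ∀ (u v x : FreeGroup ℕ), v ∈ strands (m - 1) → pushHom t m u * FreeGroup.lift t v *
      pushHom t m x = pushHom t m (u * act v x) * FreeGroup.lift t v := fun u v x hv => by
    rw [map_mul, h.pushHom_act hv]; group
  have gen : ∀ j, j + 1 ≤ m - 1 → rseg t j (m - 1 - j) = rseg t (j + 1) (m - 1 - (j + 1)) * t j ∧
      rseg t j (m - 1 - j) * t j = pushHom t m (of j) * rseg t (j + 1) (m - 1 - (j + 1)) := by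
    intro j hj
    obtain ⟨d, rfl⟩ : ∃ d, m = j + d + 2 := ⟨m - j - 2, by omega⟩
    rw [show j + d + 2 - 1 - j = d + 1 by omega, show j + d + 2 - 1 - (j + 1) = d by omega,
      rseg_succ', pushHom_of, BraidSeq.pushGen_eq h]
    exact ⟨rfl, by rw [pow_two]; group⟩
  apply strands_induction_right
  · exact ⟨1, 1, one_mem _, m - 1, le_rfl, by simp [rseg]⟩
  · rintro i w hi - ⟨u, v, hv, j, hj, e⟩
    rw [map_mul, e, FreeGroup.lift_apply_of]
    rcases lt_trichotomy i j with hij | rfl | hij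
    · rcases Nat.lt_or_ge (i + 1) j with h2 | h2
      · refine ⟨u, v * of i, mul_mem hv (of_mem_strands (by omega)), j, hj, ?_⟩
        have hc : Commute (t i) (rseg t j (m - 1 - j)) :=
          Commute.rseg_right fun k h3 h4 => h.comm _ _ (by omega) (by omega)
        rw [map_mul, FreeGroup.lift_apply_of, mul_assoc, ← hc.eq]; group
      · obtain rfl : j = i + 1 := by omega
        refine ⟨u, v, hv, i, by omega, ?_⟩
        rw [(gen i (by omega)).1]; group
    · refine ⟨u * act v (of i), v, hv, i + 1, by omega, ?_⟩
      rw [← absorb _ _ _ hv, mul_assoc, (gen i (by omega)).2]; group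
    · obtain ⟨k, rfl⟩ : ∃ k, i = k + 1 := ⟨i - 1, by omega⟩
      refine ⟨u, v * of k, mul_mem hv (of_mem_strands (by omega)), j, hj, ?_⟩
      have := h.rseg_mul (i := j) (l := m - 1 - j) (m := k) (by omega) (by omega) (by omega)
      rw [map_mul, FreeGroup.lift_apply_of, mul_assoc, this]; group
  · rintro i w hi - ⟨u, v, hv, j, hj, e⟩
    rw [map_mul, e, map_inv, FreeGroup.lift_apply_of]
    rcases lt_trichotomy i j with hij | rfl | hij
    · rcases Nat.lt_or_ge (i + 1) j with h2 | h2
      · refine ⟨u, v * (of i)⁻¹, mul_mem hv (inv_mem (of_mem_strands (by omega))), j, hj, ?_⟩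
        have hc : Commute (t i) (rseg t j (m - 1 - j)) :=
          Commute.rseg_right fun k h3 h4 => h.comm _ _ (by omega) (by omega)
        rw [map_mul, map_inv, FreeGroup.lift_apply_of, mul_assoc, ← hc.inv_left.eq]; group
      · obtain rfl : j = i + 1 := by omega
        refine ⟨u * act v (of i)⁻¹, v, hv, i, by omega, ?_⟩
        rw [← absorb _ _ _ hv, map_inv]
        have h1 := (gen i (by omega)).1
        have h2 := (gen i (by omega)).2
        rw [h1, mul_assoc] at h2
        rw [h1]
        set c := rseg t (i + 1) (m - 1 - (i + 1))
        have h3 : c * (t i)⁻¹ = (pushHom t m (of i))⁻¹ * (c * t i) := by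
          rw [mul_inv_eq_iff_eq_mul, mul_assoc, mul_assoc, eq_inv_mul_iff_mul_eq, ← h2]
        rw [mul_assoc, h3]
        group
    · refine ⟨u, v, hv, i + 1, by omega, ?_⟩
      rw [(gen i (by omega)).1]; group
    · obtain ⟨k, rfl⟩ : ∃ k, i = k + 1 := ⟨i - 1, by omega⟩
      refine ⟨u, v * (of k)⁻¹, mul_mem hv (inv_mem (of_mem_strands (by omega))), j, hj, ?_⟩
      have := h.rseg_mul (i := j) (l := m - 1 - j) (m := k) (by omega) (by omega) (by omega)
      have h3 : rseg t j (m - 1 - j) * (t (k + 1))⁻¹ = (t k)⁻¹ * rseg t j (m - 1 - j) := by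
        rw [mul_inv_eq_iff_eq_mul, mul_assoc, this, inv_mul_cancel_left]
      rw [map_mul, map_inv, FreeGroup.lift_apply_of, mul_assoc, h3]; group

theorem braidSeq_swap (N : ℕ) : BraidSeq N fun i => Equiv.swap i (i + 1) where
  braid i _ := by
    ext k
    simp only [Equiv.Perm.mul_apply, Equiv.swap_apply_def]
    split_ifs <;> omega
  comm i j hij _ := by
    ext k
    simp only [Equiv.Perm.mul_apply, Equiv.swap_apply_def]
    split_ifs <;> omega

theorem BraidSeq.prod {H : Type*} [Group H] {N : ℕ} {s : ℕ → H} (h : BraidSeq N t)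
    (h' : BraidSeq N s) : BraidSeq N fun i => (t i, s i) :=
  ⟨fun i hi => Prod.ext (h.braid i hi) (h'.braid i hi),
    fun i j hij hj => Prod.ext (h.comm i j hij hj) (h'.comm i j hij hj)⟩

theorem pushHom_eq_one_of_sq {m : ℕ} (h : ∀ i, i + 1 < m → t i ^ 2 = 1) (u : FreeGroup ℕ) :
    pushHom t m u = 1 := by
  have : pushHom t m = 1 := by
    ext j
    rw [pushHom_of, pushGen]
    split_ifs with hj
    · rw [h _ (by omega)]; simp
    · simp
  simp [this]

theorem wperm_pushHom (m : ℕ) (u : FreeGroup ℕ) : wperm (pushHom of m u) = 1 := by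
  rw [map_pushHom]
  exact pushHom_eq_one_of_sq (fun i _ => by simp [pow_two]) u

theorem rseg_swap_apply (j l : ℕ) : rseg (fun i => Equiv.swap i (i + 1)) j l j = j + l := by
  induction l with
  | zero => simp [rseg]
  | succ l ih => rw [rseg, Equiv.Perm.mul_apply, ih, Equiv.swap_apply_left, add_assoc]

/-- A word fixing the last strand is a point push times a word in the remaining strands. -/
theorem BraidSeq.exists_lift_eq_of_fix {m : ℕ} (hm : 1 ≤ m) (h : BraidSeq (m - 1) t)
    {w : FreeGroup ℕ} (hw : w ∈ strands m) (hfix : wperm w (m - 1) = m - 1) :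
    ∃ u, ∃ v ∈ strands (m - 1),
      FreeGroup.lift t w = pushHom t m u * FreeGroup.lift t v ∧ wperm w = wperm v := by
  obtain ⟨u, v, hv, j, hj, e⟩ := (h.prod (braidSeq_swap _)).exists_lift_eq w hw
  have e1 := congrArg (MonoidHom.fst G (Equiv.Perm ℕ)) e
  have e2 := congrArg (MonoidHom.snd G (Equiv.Perm ℕ)) e
  have l1 : ∀ w, MonoidHom.fst G (Equiv.Perm ℕ)
      (FreeGroup.lift (fun i => (t i, Equiv.swap i (i + 1))) w) = FreeGroup.lift t w := fun w => by
    rw [← MonoidHom.comp_apply]; congr 1; ext; simp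
  have l2 : ∀ w, MonoidHom.snd G (Equiv.Perm ℕ)
      (FreeGroup.lift (fun i => (t i, Equiv.swap i (i + 1))) w) = wperm w := fun w => by
    rw [← MonoidHom.comp_apply]; congr 1; ext; simp
  rw [map_mul, map_mul, l1, l1, map_pushHom, map_rseg] at e1
  rw [map_mul, map_mul, l2, l2, map_pushHom, map_rseg] at e2
  simp only [MonoidHom.coe_fst, MonoidHom.coe_snd] at e1 e2
  rw [pushHom_eq_one_of_sq (fun i _ => by simp [pow_two]), one_mul] at e2
  have hj' : j = m - 1 := by
    have h3 := congrArg (fun f => f j) e2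
    simp only [Equiv.Perm.mul_apply, rseg_swap_apply] at h3
    rw [show j + (m - 1 - j) = m - 1 by omega, wperm_apply_of_le le_rfl v hv] at h3
    exact (wperm w).injective (h3.trans hfix.symm)
  subst hj'
  rw [Nat.sub_self, rseg, mul_one] at e1 e2
  exact ⟨u, v, hv, e1, e2⟩

/-- The Coxeter presentation of the symmetric group. -/
theorem BraidSeq.lift_eq_one_of_sq {m : ℕ} (h : BraidSeq (m - 1) t)
    (h2 : ∀ i, i + 1 < m → t i ^ 2 = 1) {w : FreeGroup ℕ} (hw : w ∈ strands m)
    (hp : wperm w = 1) : FreeGroup.lift t w = 1 := by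
  induction m generalizing w with
  | zero =>
    have : strands 0 = ⊥ := by simp [strands]
    rw [this, Subgroup.mem_bot] at hw
    simp [hw]
  | succ m ih =>
    obtain ⟨u, v, hv, e, hp'⟩ := h.exists_lift_eq_of_fix (by omega) hw (by simp [hp])
    rw [e, pushHom_eq_one_of_sq h2, one_mul]
    exact ih (h.mono (by omega)) (fun i hi => h2 i (by omega)) hv (hp' ▸ hp)

end

end

/-! ### The mapping class group and its permutation action -/

section

open FreeGroup (of)

theorem prod_ofFn_eq_seg {G : Type*} [Group G] (t : ℕ → G) (k : ℕ) :
    (List.ofFn fun i : Fin k => t i).prod = seg t 0 k ∧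
      (List.ofFn fun i : Fin k => t i).reverse.prod = rseg t 0 k := by
  induction k with
  | zero => simp [seg, rseg]
  | succ k ih =>
    rw [List.ofFn_succ', List.concat_eq_append, List.prod_append, List.reverse_append,
      List.prod_append]
    simp only [Fin.val_castSucc, Fin.val_last, ih.1, ih.2]
    simp [seg, rseg]

section

variable {G : Type*} [Group G] {t : ℕ → G} {n : ℕ}

theorem lift_mem_of_mem_normalClosure_sphereRels (h : BraidSeq (n - 1) t) {N : Subgroup G}
    (hN : ∀ i, i + 1 < n → t i ∈ Subgroup.normalizer (N : Set G))
    (h1 : seg t 0 (n - 1) * rseg t 0 (n - 1) ∈ N) (h2 : seg t 0 (n - 1) ^ n ∈ N)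
    {w : FreeGroup (Fin (n - 1))} (hw : w ∈ Subgroup.normalClosure (sphereRels n)) :
    FreeGroup.lift (fun i : Fin (n - 1) => t i) w ∈ N := by
  set f := FreeGroup.lift (fun i : Fin (n - 1) => t i)
  have hf : ∀ w, f w ∈ Subgroup.normalizer (N : Set G) := fun w => by
    induction w using FreeGroup.induction_on with
    | C1 => rw [map_one]; exact one_mem _
    | of i => simpa [f] using hN i (by omega)
    | inv_of i ih => rw [map_inv]; exact inv_mem ih
    | mul x y hx hy => rw [map_mul]; exact mul_mem hx hy
  have : (N.comap f).Normal := ⟨fun x hx g => by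
    have := (Subgroup.mem_normalizer_iff.mp (hf g) (f x)).mp hx
    simpa using this⟩
  have key : Subgroup.normalClosure (sphereRels n) ≤ N.comap f := by
    apply Subgroup.normalClosure_le_normal
    have hs : f (List.ofFn fun i : Fin (n - 1) => of i).prod = seg t 0 (n - 1) := by
      rw [map_list_prod, ← (prod_ofFn_eq_seg t _).1, List.map_ofFn]
      congr 2; ext; simp [f]
    have hr : f (List.ofFn fun i : Fin (n - 1) => of i).reverse.prod = rseg t 0 (n - 1) := by
      rw [map_list_prod, ← (prod_ofFn_eq_seg t _).2, List.map_reverse, List.map_ofFn]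
      congr 3; ext; simp [f]
    rintro r (⟨i, j, ⟨hij, rfl⟩ | ⟨hij, rfl⟩⟩ | rfl | rfl)
    · change f _ ∈ N
      have := h.braid i (by omega)
      rw [hij] at this
      simp [f, this]
    · change f _ ∈ N
      have := (h.comm i j hij (by omega)).eq
      simp [f, this]
    · change f _ ∈ N
      rw [map_mul, hs, hr]; exact h1
    · change f _ ∈ N
      rw [map_pow, hs]; exact h2
  exact key hw

/-- The standard generators of the mapping class group, extended by `1`. -/
def sgen (n i : ℕ) : SphereMCG n := if h : i < n - 1 then PresentedGroup.of ⟨i, h⟩ else 1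

/-- The mapping class represented by a word in the half twists. -/
def toMCG (n : ℕ) : FreeGroup ℕ →* SphereMCG n := FreeGroup.lift (sgen n)

@[simp] theorem toMCG_of (n i : ℕ) : toMCG n (of i) = sgen n i := by simp [toMCG]

theorem lift_sgen_eq_mk (n : ℕ) (w : FreeGroup (Fin (n - 1))) :
    FreeGroup.lift (fun i : Fin (n - 1) => sgen n i) w = PresentedGroup.mk (sphereRels n) w := by
  rw [← DFunLike.congr_fun (FreeGroup.lift.apply_symm_apply (PresentedGroup.mk (sphereRels n))) w]
  congr 2
  ext i
  simp [sgen, PresentedGroup.of]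

theorem sgen_relations (n : ℕ) : BraidSeq (n - 1) (sgen n) ∧
    seg (sgen n) 0 (n - 1) * rseg (sgen n) 0 (n - 1) = 1 ∧ seg (sgen n) 0 (n - 1) ^ n = 1 := by
  set f := FreeGroup.lift (fun i : Fin (n - 1) => sgen n i)
  have hf : ∀ r ∈ sphereRels n, f r = 1 := fun r hr => by
    rw [lift_sgen_eq_mk]; exact PresentedGroup.one_of_mem hr
  have hs : f (List.ofFn fun i : Fin (n - 1) => of i).prod = seg (sgen n) 0 (n - 1) := by
    rw [map_list_prod, ← (prod_ofFn_eq_seg (sgen n) _).1, List.map_ofFn]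
    congr 2; ext; simp [f]
  have hr : f (List.ofFn fun i : Fin (n - 1) => of i).reverse.prod = rseg (sgen n) 0 (n - 1) := by
    rw [map_list_prod, ← (prod_ofFn_eq_seg (sgen n) _).2, List.map_reverse, List.map_ofFn]
    congr 3; ext; simp [f]
  refine ⟨⟨fun i hi => ?_, fun i j hij hj => ?_⟩, ?_, ?_⟩
  · have := hf _ (Or.inl ⟨⟨i, by omega⟩, ⟨i + 1, hi⟩, Or.inl ⟨rfl, rfl⟩⟩)
    simp only [map_mul, map_inv, mul_inv_eq_one] at this
    simpa [f] using this
  · have := hf _ (Or.inl ⟨⟨i, by omega⟩, ⟨j, hj⟩, Or.inr ⟨hij, rfl⟩⟩)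
    simp only [map_mul, map_inv, mul_inv_eq_one] at this
    simpa [f, Commute, SemiconjBy] using this
  · have := hf _ (Or.inr (Or.inl rfl))
    rwa [map_mul, hs, hr] at this
  · have := hf _ (Or.inr (Or.inr rfl))
    rwa [map_pow, hs] at this

theorem sgen_braidSeq (n : ℕ) : BraidSeq (n - 1) (sgen n) := (sgen_relations n).1

theorem exists_lift_of_mem_strands : ∀ w ∈ strands n, ∃ w' : FreeGroup (Fin (n - 1)),
    w = FreeGroup.lift (fun i : Fin (n - 1) => of (i : ℕ)) w' := by
  apply strands_induction
  · exact ⟨1, by simp⟩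
  · rintro i w hi - ⟨w', rfl⟩
    exact ⟨of ⟨i, by omega⟩ * w', by simp⟩
  · rintro i w hi - ⟨w', rfl⟩
    exact ⟨(of ⟨i, by omega⟩)⁻¹ * w', by simp⟩

theorem lift_lift (t : ℕ → G) (w : FreeGroup (Fin (n - 1))) :
    FreeGroup.lift t (FreeGroup.lift (fun i : Fin (n - 1) => of (i : ℕ)) w) =
      FreeGroup.lift (fun i : Fin (n - 1) => t i) w := by
  rw [← MonoidHom.comp_apply]
  congr 1
  ext; simp

theorem exists_toMCG_eq (g : SphereMCG n) : ∃ w ∈ strands n, toMCG n w = g := by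
  obtain ⟨w, rfl⟩ := PresentedGroup.mk_surjective _ g
  refine ⟨FreeGroup.lift (fun i : Fin (n - 1) => of (i : ℕ)) w, ?_, ?_⟩
  · induction w using FreeGroup.induction_on with
    | C1 => rw [map_one]; exact one_mem _
    | of i => simpa using of_mem_strands (by omega)
    | inv_of i ih => rw [map_inv]; exact inv_mem ih
    | mul x y hx hy => rw [map_mul]; exact mul_mem hx hy
  · rw [toMCG, lift_lift, lift_sgen_eq_mk]

/-- A word trivial in the mapping class group is sent into any normalized subgroup containing the
images of the two sphere relators. -/
theorem BraidSeq.lift_mem_of_toMCG_eq_one (h : BraidSeq (n - 1) t) {N : Subgroup G}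
    (hN : ∀ i, i + 1 < n → t i ∈ Subgroup.normalizer (N : Set G))
    (h1 : seg t 0 (n - 1) * rseg t 0 (n - 1) ∈ N) (h2 : seg t 0 (n - 1) ^ n ∈ N)
    {w : FreeGroup ℕ} (hw : w ∈ strands n) (hw1 : toMCG n w = 1) : FreeGroup.lift t w ∈ N := by
  obtain ⟨w, rfl⟩ := exists_lift_of_mem_strands w hw
  rw [toMCG, lift_lift, lift_sgen_eq_mk] at hw1
  rw [lift_lift]
  exact lift_mem_of_mem_normalClosure_sphereRels h hN h1 h2 (PresentedGroup.mk_eq_one_iff.mp hw1)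

theorem seg_swap_apply (l j : ℕ) : seg (fun i => Equiv.swap i (i + 1)) 0 l j =
    if j < l then j + 1 else if j = l then 0 else j := by
  induction l generalizing j with
  | zero => by_cases h : j = 0 <;> simp [seg, h]
  | succ l ih =>
    rw [seg, Equiv.Perm.mul_apply, ih, zero_add, Equiv.swap_apply_def]
    split_ifs <;> omega

theorem seg_swap_pow_apply (l k j : ℕ) (hk : k ≤ l + 1) (hj : j ≤ l) :
    (seg (fun i => Equiv.swap i (i + 1)) 0 l ^ k) j =
      if j + k ≤ l then j + k else j + k - (l + 1) := by
  induction k with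
  | zero => simp [hj]
  | succ k ih =>
    rw [pow_succ', Equiv.Perm.mul_apply, ih (by omega), seg_swap_apply]
    split_ifs <;> omega

theorem seg_swap_pow (l : ℕ) : seg (fun i => Equiv.swap i (i + 1)) 0 l ^ (l + 1) = 1 := by
  ext j
  rcases Nat.lt_or_ge l j with h | h
  · have : ∀ k, (seg (fun i => Equiv.swap i (i + 1)) 0 l ^ k) j = j := fun k => by
      induction k with
      | zero => simp
      | succ k ih =>
        rw [pow_succ', Equiv.Perm.mul_apply, ih, seg_swap_apply]
        split_ifs <;> omega
    simp [this]
  · rw [seg_swap_pow_apply _ _ _ le_rfl h]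
    split_ifs
    · omega
    · simp

theorem seg_mul_rseg_of_sq (h : ∀ i, t i ^ 2 = 1) (i l : ℕ) : seg t i l * rseg t i l = 1 := by
  induction l with
  | zero => simp [seg, rseg]
  | succ l ih =>
    rw [seg, rseg, mul_assoc, ← mul_assoc (t (i + l)), ← pow_two, h, one_mul, ih]

/-- The permutation of the punctures induced by a mapping class. -/
def mperm (n : ℕ) : SphereMCG n →* Equiv.Perm ℕ :=
  PresentedGroup.toGroup (f := fun i : Fin (n - 1) => Equiv.swap (i : ℕ) (i + 1)) fun r hr => by
    have := lift_mem_of_mem_normalClosure_sphereRels (n := n) (N := ⊥) (braidSeq_swap _)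
      (fun i _ => Subgroup.mem_normalizer_iff.mpr fun x => by
        rw [Subgroup.mem_bot, Subgroup.mem_bot, conj_eq_one_iff])
      (by rw [seg_mul_rseg_of_sq (fun i => by simp [pow_two])]; exact one_mem _) ?_
      (Subgroup.subset_normalClosure hr)
    · simpa using this
    · rcases n with _ | n
      · simp
      · simp only [Nat.add_sub_cancel]
        rw [seg_swap_pow]; exact one_mem _

theorem mperm_sgen {i : ℕ} (hi : i + 1 < n) : mperm n (sgen n i) = Equiv.swap i (i + 1) := by
  rw [sgen, dif_pos (by omega)]
  exact PresentedGroup.toGroup.of _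

theorem mperm_toMCG : ∀ w ∈ strands n, mperm n (toMCG n w) = wperm w := by
  apply strands_induction
  · simp
  · intro i w hi _ ih
    rw [map_mul, map_mul, map_mul, ih, toMCG_of, mperm_sgen hi, wperm_of]
  · intro i w hi _ ih
    rw [map_mul, map_mul, map_mul, ih, map_inv, map_inv, map_inv, toMCG_of, mperm_sgen hi, wperm_of]

end

end

/-! ### Filling in punctures -/

section

open FreeGroup (of)

section

variable {G : Type*} [Group G]

/-- Automorphisms that become inner modulo a normal subgroup `R`. -/
def innerMod (R : Subgroup G) [R.Normal] : Subgroup (MulAut G) where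
  carrier := {α | ∃ c, ∀ y, QuotientGroup.mk' R (α y) = QuotientGroup.mk' R (c * y * c⁻¹)}
  one_mem' := ⟨1, fun y => by simp⟩
  mul_mem' := by
    rintro α β ⟨c, hc⟩ ⟨d, hd⟩
    refine ⟨c * d, fun y => ?_⟩
    rw [MulAut.mul_apply, hc, map_mul, map_mul, hd]
    simp only [map_mul, map_inv, mul_inv_rev, mul_assoc]
  inv_mem' := by
    rintro α ⟨c, hc⟩
    refine ⟨c⁻¹, fun y => ?_⟩
    have := hc (α⁻¹ y)
    rw [MulAut.apply_inv_self, map_mul, map_mul, map_inv, eq_mul_inv_iff_mul_eq] at this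
    simp only [map_mul, map_inv, inv_inv]
    rw [mul_assoc, this, inv_mul_cancel_left]

theorem innerMod_mono {R S : Subgroup G} [R.Normal] [S.Normal] (h : R ≤ S) :
    innerMod R ≤ innerMod S := by
  rintro α ⟨c, hc⟩
  refine ⟨c, fun y => ?_⟩
  have := hc y
  simp only [QuotientGroup.mk'_apply, QuotientGroup.eq] at this ⊢
  exact h this

theorem conj_mem_innerMod {R S : Subgroup G} [R.Normal] [S.Normal] {α β : MulAut G}
    (hβ : ∀ y ∈ R, β y ∈ S) (hα : α ∈ innerMod R) : β * α * β⁻¹ ∈ innerMod S := by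
  obtain ⟨c, hc⟩ := hα
  refine ⟨β c, fun y => ?_⟩
  have := hc (β⁻¹ y)
  simp only [QuotientGroup.mk'_apply, QuotientGroup.eq] at this ⊢
  have := hβ _ this
  simpa using this

theorem mk'_eq_iff {R : Subgroup G} [R.Normal] {a b : G} :
    QuotientGroup.mk' R a = QuotientGroup.mk' R b ↔ a * b⁻¹ ∈ R := by
  rw [← mul_inv_eq_one, ← map_inv, ← map_mul]
  exact QuotientGroup.eq_one_iff _

theorem mem_innerMod_of_gen {X : Type*} {R : Subgroup (FreeGroup X)} [R.Normal]
    {α : MulAut (FreeGroup X)} (c : FreeGroup X)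
    (h : ∀ j, QuotientGroup.mk' R (α (of j)) = QuotientGroup.mk' R (c * of j * c⁻¹)) :
    α ∈ innerMod R := by
  refine ⟨c, fun y => ?_⟩
  have : (QuotientGroup.mk' R).comp α.toMonoidHom =
      (QuotientGroup.mk' R).comp (MulAut.conj c).toMonoidHom := by
    ext j
    exact h j
  exact DFunLike.congr_fun this y

end

theorem lift_artin : FreeGroup.lift artin = act := rfl

/-- Pure words acting as inner automorphisms on the sphere group punctured at `T`. -/
def innerW (n : ℕ) (T : Finset ℕ) : Subgroup (FreeGroup ℕ) :=
  strands n ⊓ wperm.ker ⊓ (innerMod (puncRel n T)).comap act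

variable {n m : ℕ} {S T : Finset ℕ} {w v : FreeGroup ℕ}

theorem mem_innerW : w ∈ innerW n T ↔
    w ∈ strands n ∧ wperm w = 1 ∧ act w ∈ innerMod (puncRel n T) := by
  rw [innerW, Subgroup.mem_inf, Subgroup.mem_inf, and_assoc]
  rfl

theorem innerW_anti (h : S ⊆ T) : innerW n T ≤ innerW n S :=
  inf_le_inf le_rfl (Subgroup.comap_mono (innerMod_mono (puncRel_anti n h)))

theorem innerW_congr (hmn : m ≤ n) (hT : T ⊆ Finset.range m) (hw : w ∈ strands m) :
    w ∈ innerW n T ↔ w ∈ innerW m T := by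
  simp only [innerW, puncRel_congr hmn hT, Subgroup.mem_inf, hw, strands_mono hmn hw, true_and]

theorem conj_mem_innerW (hv : v ∈ strands n) (hw : w ∈ innerW n T) :
    v * w * v⁻¹ ∈ innerW n (T.map (wperm v).toEmbedding) := by
  obtain ⟨h1, h2, h3⟩ := mem_innerW.mp hw
  refine mem_innerW.mpr ⟨mul_mem (mul_mem hv h1) (inv_mem hv), ?_, ?_⟩
  · simp [h2]
  · rw [map_mul, map_mul, map_inv]
    exact conj_mem_innerMod (fun y hy => act_mem_puncRel hv hy) h3

theorem seg_artin_of (l : ℕ) : (∀ j < l, seg artin 0 l (of j) = of (j + 1)) ∧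
    seg artin 0 l (of l) = (seg of 0 (l + 1))⁻¹ * of 0 * seg of 0 (l + 1) := by
  induction l with
  | zero => simp [seg]
  | succ l ih =>
    have hfix : seg artin 0 l (of (l + 1)) = of (l + 1) := by
      have h1 := act_of_le (n := l + 1) le_rfl (seg of 0 l)
        (seg_mem fun m _ h => of_mem_strands (by omega))
      rw [map_seg] at h1
      simpa using h1
    constructor
    · intro j hj
      rw [seg, MulAut.mul_apply, zero_add]
      rcases Nat.lt_succ_iff_lt_or_eq.mp hj with h | rfl
      · rw [artin_of_ne (by omega) (by omega), ih.1 _ h]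
      · rw [artin_self, hfix]
    · rw [seg, MulAut.mul_apply, zero_add, artin_succ, map_mul, map_mul, map_inv, hfix, ih.2,
        seg.eq_2 of 0 (l + 1), zero_add]
      group

theorem rseg_artin_of (l : ℕ) : rseg artin 0 l (of 0) = of l ∧
    ∀ j < l, rseg artin 0 l (of (j + 1)) = (of l)⁻¹ * of j * of l := by
  induction l with
  | zero => simp [rseg]
  | succ l ih =>
    have hfix : rseg artin 0 l (of (l + 1)) = of (l + 1) := by
      have h1 := act_of_le (n := l + 1) le_rfl (rseg of 0 l)
        (rseg_mem fun m _ h => of_mem_strands (by omega))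
      rw [map_rseg] at h1
      simpa using h1
    constructor
    · rw [rseg, MulAut.mul_apply, ih.1, zero_add, artin_self]
    · intro j hj
      rw [rseg, MulAut.mul_apply, zero_add]
      rcases Nat.lt_succ_iff_lt_or_eq.mp hj with h | rfl
      · rw [ih.2 _ h, map_mul, map_mul, map_inv, artin_self, artin_of_ne (by omega) (by omega)]
      · rw [hfix, artin_succ]

theorem seg_artin_pow_of (l k j : ℕ) (hk : k ≤ l + 1) (hj : j ≤ l) :
    (seg artin 0 l ^ k) (of j) = if j + k ≤ l then of (j + k) else
      (seg of 0 (l + 1))⁻¹ * of (j + k - (l + 1)) * seg of 0 (l + 1) := by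
  have hX : seg artin 0 l (seg of 0 (l + 1)) = seg of 0 (l + 1) := by
    have h1 := act_seg (n := l + 1) (seg of 0 l) (seg_mem fun m _ h => of_mem_strands (by omega))
    rw [map_seg] at h1
    simpa using h1
  induction k with
  | zero => simp [hj]
  | succ k ih =>
    rw [pow_succ', MulAut.mul_apply, ih (by omega)]
    rcases lt_trichotomy (j + k) l with h | h | h
    · rw [if_pos (by omega), if_pos (by omega), (seg_artin_of l).1 _ h, add_assoc]
    · rw [if_pos (by omega), if_neg (by omega), h, (seg_artin_of l).2,
        show j + (k + 1) - (l + 1) = 0 by omega]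
    · rw [if_neg (by omega), if_neg (by omega), map_mul, map_mul, map_inv, hX,
        (seg_artin_of l).1 _ (by omega), show j + k - (l + 1) + 1 = j + (k + 1) - (l + 1) by omega]

theorem mk'_seg : QuotientGroup.mk' (puncRel n T) (seg of 0 n) = 1 :=
  (QuotientGroup.eq_one_iff _).mpr (seg_mem_puncRel n T)

theorem mk'_of {j : ℕ} (hj : j ∉ T) : QuotientGroup.mk' (puncRel n T) (of j) = 1 :=
  (QuotientGroup.eq_one_iff _).mpr (of_mem_puncRel hj)

theorem relators_mem_innerMod (l : ℕ) :
    seg artin 0 l * rseg artin 0 l ∈ innerMod (puncRel (l + 1) (Finset.range (l + 1))) ∧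
    seg artin 0 l ^ (l + 1) ∈ innerMod (puncRel (l + 1) (Finset.range (l + 1))) := by
  have hs : seg artin 0 l = act (seg of 0 l) := by rw [map_seg]; simp
  have hr : rseg artin 0 l = act (rseg of 0 l) := by rw [map_rseg]; simp
  have hsm : seg of 0 l ∈ strands (l + 1) := seg_mem fun m _ h => of_mem_strands (by omega)
  have hrm : rseg of 0 l ∈ strands (l + 1) := rseg_mem fun m _ h => of_mem_strands (by omega)
  constructor
  · refine mem_innerMod_of_gen (of 0)⁻¹ fun j => ?_
    rcases Nat.lt_or_ge j (l + 1) with hj | hj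
    · rw [MulAut.mul_apply]
      rcases j with _ | j
      · rw [(rseg_artin_of l).1, (seg_artin_of l).2]
        simp only [map_mul, map_inv, mk'_seg]; simp
      · rw [(rseg_artin_of l).2 j (by omega)]
        simp only [map_mul, map_inv, (seg_artin_of l).1 j (by omega), (seg_artin_of l).2, mk'_seg]
        simp
    · rw [hs, hr, ← map_mul, act_of_le hj _ (mul_mem hsm hrm)]
      simp only [map_mul, mk'_of (show j ∉ Finset.range (l + 1) by simpa using hj)]
      simp
  · refine mem_innerMod_of_gen 1 fun j => ?_
    rcases Nat.lt_or_ge j (l + 1) with hj | hj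
    · rw [seg_artin_pow_of l _ j le_rfl (by omega), if_neg (by omega)]
      simp only [map_mul, map_inv, mk'_seg]; simp
    · rw [hs, ← map_pow, act_of_le hj _ (pow_mem hsm _)]
      simp

theorem range_map_wperm (hw : w ∈ strands n) :
    (Finset.range n).map (wperm w).toEmbedding = Finset.range n := by
  apply Finset.eq_of_subset_of_card_le
  · intro x hx
    obtain ⟨j, hj, rfl⟩ := Finset.mem_map.mp hx
    exact Finset.mem_range.mpr (wperm_lt (Finset.mem_range.mp hj) hw)
  · simp

theorem mem_innerW_of_toMCG_eq_one (hw : w ∈ strands n) (h : toMCG n w = 1)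
    (hT : T ⊆ Finset.range n) : w ∈ innerW n T := by
  refine innerW_anti hT (mem_innerW.mpr ⟨hw, ?_, ?_⟩)
  · rw [← mperm_toMCG w hw, h, map_one]
  · rcases n with _ | n
    · have : strands 0 = ⊥ := by simp [strands]
      rw [this, Subgroup.mem_bot] at hw
      rw [hw]; exact one_mem _
    refine (artin_braidSeq _).lift_mem_of_toMCG_eq_one ?_ (relators_mem_innerMod n).1
      (relators_mem_innerMod n).2 hw h
    intro i hi
    have key : ∀ v ∈ strands (n + 1), ∀ α ∈ innerMod (puncRel (n + 1) (Finset.range (n + 1))),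
        act v * α * (act v)⁻¹ ∈ innerMod (puncRel (n + 1) (Finset.range (n + 1))) := by
      intro v hv α hα
      refine conj_mem_innerMod (fun y hy => ?_) hα
      have := act_mem_puncRel hv hy
      rwa [range_map_wperm hv] at this
    rw [Subgroup.mem_normalizer_iff]
    intro α
    refine ⟨fun hα => by simpa using key _ (of_mem_strands hi) α hα, fun hα => ?_⟩
    have := key _ (inv_mem (of_mem_strands hi)) _ hα
    simpa [mul_assoc] using this

/-- The pure mapping classes that become trivial after filling the punctures outside `T`. -/
def pureN (n : ℕ) (T : Finset ℕ) : Subgroup (SphereMCG n) := (innerW n T).map (toMCG n)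

theorem toMCG_mem_pureN_iff (hT : T ⊆ Finset.range n) (hw : w ∈ strands n) :
    toMCG n w ∈ pureN n T ↔ w ∈ innerW n T := by
  refine ⟨?_, fun h => ⟨w, h, rfl⟩⟩
  rintro ⟨v, hv, e⟩
  have h1 : w * v⁻¹ ∈ innerW n T :=
    mem_innerW_of_toMCG_eq_one (mul_mem hw (inv_mem (mem_innerW.mp hv).1)) (by simp [e]) hT
  simpa using mul_mem h1 hv

theorem pureN_anti (h : S ⊆ T) : pureN n T ≤ pureN n S := Subgroup.map_mono (innerW_anti h)

theorem pureN_le_ker : pureN n T ≤ (mperm n).ker := by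
  rintro _ ⟨w, hw, rfl⟩
  rw [MonoidHom.mem_ker, mperm_toMCG w (mem_innerW.mp hw).1]
  exact (mem_innerW.mp hw).2.1

theorem conj_mem_pureN (g : SphereMCG n) {x : SphereMCG n} (hx : x ∈ pureN n T) :
    g * x * g⁻¹ ∈ pureN n (T.map (mperm n g).toEmbedding) := by
  obtain ⟨w, hw, rfl⟩ := hx
  obtain ⟨v, hv, rfl⟩ := exists_toMCG_eq g
  rw [mperm_toMCG v hv]
  exact ⟨_, conj_mem_innerW hv hw, by simp⟩

theorem map_one_perm (T : Finset ℕ) : T.map (Equiv.toEmbedding (1 : Equiv.Perm ℕ)) = T := by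
  convert Finset.map_refl using 2; rfl

theorem conj_mem_pureN_of_pure {g : SphereMCG n} (hg : mperm n g = 1) {x : SphereMCG n}
    (hx : x ∈ pureN n T) : g * x * g⁻¹ ∈ pureN n T := by
  have := conj_mem_pureN g hx
  rwa [hg, map_one_perm] at this

end

/-! ### The outer action on the fundamental group of the sphere -/

section

open FreeGroup (of)

variable {n m : ℕ} {S T : Finset ℕ} {w v u : FreeGroup ℕ}

/-- The retraction of the free group onto the fundamental group of the sphere with `m` punctures,
written as the free group on the loops `1, …, m - 1`. -/
def fillHom (m : ℕ) : FreeGroup ℕ →* FreeGroup ℕ :=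
  FreeGroup.lift fun j => if j = 0 then (seg of 1 (m - 1))⁻¹ else if j < m then of j else 1

theorem fillHom_of {j : ℕ} (h0 : 1 ≤ j) (hj : j < m) : fillHom m (of j) = of j := by
  rw [fillHom, FreeGroup.lift_apply_of, if_neg (by omega), if_pos hj]

theorem ker_fillHom (hm : 1 ≤ m) : (fillHom m).ker = puncRel m (Finset.range m) := by
  have hX : seg (G := FreeGroup ℕ) of 0 m = of 0 * seg of 1 (m - 1) := by
    conv_lhs => rw [show m = m - 1 + 1 by omega]
    rw [seg_succ']
  have hz : fillHom m (of 0) = (seg of 1 (m - 1))⁻¹ := by simp [fillHom]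
  apply FreeGroup.ker_eq_of_retract
  · apply puncRel_le
    · rw [MonoidHom.mem_ker, hX, map_mul, map_seg, hz, inv_mul_eq_one]
      exact seg_congr fun j h1 h2 => (fillHom_of h1 (by omega)).symm
    · intro j hj
      rw [Finset.mem_range] at hj
      rw [MonoidHom.mem_ker, fillHom, FreeGroup.lift_apply_of, if_neg (by omega), if_neg hj]
  · intro j
    rcases Nat.eq_zero_or_pos j with rfl | h0
    · rw [hz, ← mul_inv_rev, ← hX]
      exact inv_mem (seg_mem_puncRel _ _)
    · rcases Nat.lt_or_ge j m with hj | hj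
      · rw [fillHom_of h0 hj, mul_inv_cancel]; exact one_mem _
      · rw [fillHom, FreeGroup.lift_apply_of, if_neg (by omega), if_neg (by omega), one_mul]
        exact inv_mem (of_mem_puncRel (by simpa using hj))

theorem mem_puncRel_iff (hm : 1 ≤ m) {y : FreeGroup ℕ} :
    y ∈ puncRel m (Finset.range m) ↔ fillHom m y = 1 := by
  rw [← ker_fillHom hm, MonoidHom.mem_ker]

theorem fillHom_eq_of_mk'_eq (hm : 1 ≤ m) {x y : FreeGroup ℕ}
    (h : QuotientGroup.mk' (puncRel m (Finset.range m)) x =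
      QuotientGroup.mk' (puncRel m (Finset.range m)) y) : fillHom m x = fillHom m y := by
  rw [mk'_eq_iff, mem_puncRel_iff hm] at h
  rwa [map_mul, map_inv, mul_inv_eq_one] at h

theorem mk'_eq_mono {G : Type*} [Group G] {R S : Subgroup G} [R.Normal] [S.Normal] (h : R ≤ S)
    {x y : G} (hxy : QuotientGroup.mk' R x = QuotientGroup.mk' R y) :
    QuotientGroup.mk' S x = QuotientGroup.mk' S y := by
  rw [mk'_eq_iff] at hxy ⊢
  exact h hxy

theorem mk'_conj_cancel {G : Type*} [Group G] {R : Subgroup G} [R.Normal] {c u y : G}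
    (h : QuotientGroup.mk' R (c * u * y * (c * u)⁻¹) = QuotientGroup.mk' R (c * y * c⁻¹)) :
    QuotientGroup.mk' R (u * y * u⁻¹) = QuotientGroup.mk' R y := by
  rw [show c * u * y * (c * u)⁻¹ = c * (u * y * u⁻¹) * c⁻¹ by group, map_mul, map_mul,
    map_mul _ (c * y), map_mul _ c] at h
  exact mul_left_cancel (mul_right_cancel h)

/-- An automorphism that is inner on the sphere punctured at `range m` and maps the last loop to
its conjugate by `c` becomes conjugation by `c` once the last puncture is filled. -/
theorem mk'_eq_conj_of_innerMod (hm : 2 ≤ m) {α : MulAut (FreeGroup ℕ)} {c : FreeGroup ℕ}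
    (h : α ∈ innerMod (puncRel m (Finset.range m)))
    (hc : α (of (m - 1)) = c * of (m - 1) * c⁻¹) (y : FreeGroup ℕ) :
    QuotientGroup.mk' (puncRel m (Finset.range (m - 1))) (α y) =
      QuotientGroup.mk' (puncRel m (Finset.range (m - 1))) (c * y * c⁻¹) := by
  obtain ⟨g, hg⟩ := h
  have h1 := fillHom_eq_of_mk'_eq (by omega) (hg (of (m - 1)))
  rw [hc] at h1
  simp only [map_mul, map_inv, fillHom_of (m := m) (j := m - 1) (by omega) (by omega)] at h1
  have hcomm : Commute ((fillHom m g)⁻¹ * fillHom m c) (of (m - 1)) := by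
    calc (fillHom m g)⁻¹ * fillHom m c * of (m - 1)
        = (fillHom m g)⁻¹ * (fillHom m c * of (m - 1) * (fillHom m c)⁻¹) * fillHom m c := by group
      _ = of (m - 1) * ((fillHom m g)⁻¹ * fillHom m c) := by rw [h1]; group
  obtain ⟨k, hk⟩ := FreeGroup.eq_zpow_of_commute_of hcomm
  have h2 : QuotientGroup.mk' (puncRel m (Finset.range m)) (g⁻¹ * c) =
      QuotientGroup.mk' (puncRel m (Finset.range m)) (of (m - 1) ^ k) := by
    rw [mk'_eq_iff, mem_puncRel_iff (by omega), map_mul, map_mul, map_inv, map_inv, map_zpow,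
      fillHom_of (by omega) (by omega), hk, mul_inv_cancel]
  have hle := puncRel_anti m (Finset.range_mono (Nat.sub_le m 1))
  have h3 := mk'_eq_mono hle h2
  rw [map_zpow, mk'_of (by simp), one_zpow, map_mul, map_inv, inv_mul_eq_one] at h3
  have h4 := mk'_eq_mono hle (hg y)
  rw [h4, map_mul, map_mul, map_inv, h3, map_mul, map_mul, map_inv]

theorem artin_sq_self (i : ℕ) : (artin i ^ 2) (of i) = (of (i + 1))⁻¹ * of i * of (i + 1) := by
  rw [pow_two, MulAut.mul_apply, artin_self, artin_succ]

theorem artin_sq_succ (i : ℕ) : (artin i ^ 2) (of (i + 1)) =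
    (of i * of (i + 1))⁻¹ * of (i + 1) * (of i * of (i + 1)) := by
  rw [pow_two, MulAut.mul_apply, artin_succ]
  simp only [map_mul, map_inv, artin_self, artin_succ]
  group

theorem mk'_artin_sq {i : ℕ} (h : i ∉ T ∨ i + 1 ∉ T) (y : FreeGroup ℕ) :
    QuotientGroup.mk' (puncRel n T) ((artin i ^ 2) y) = QuotientGroup.mk' (puncRel n T) y := by
  have : (QuotientGroup.mk' (puncRel n T)).comp (artin i ^ 2).toMonoidHom =
      QuotientGroup.mk' (puncRel n T) := by
    ext j
    change QuotientGroup.mk' (puncRel n T) ((artin i ^ 2) (of j)) = QuotientGroup.mk'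
        (puncRel n T) (of j)
    by_cases h0 : j = i
    · subst h0
      rw [artin_sq_self]
      rcases h with h | h <;> simp only [map_mul, map_inv, mk'_of h] <;> simp
    by_cases h1 : j = i + 1
    · subst h1
      rw [artin_sq_succ]
      rcases h with h | h <;> simp only [map_mul, map_inv, mk'_of h] <;> simp
    · rw [pow_two, MulAut.mul_apply, artin_of_ne h0 h1, artin_of_ne h0 h1]
  exact DFunLike.congr_fun this y

theorem of_sq_mem_innerW {i : ℕ} (hi : i + 1 < n) (h : i ∉ T ∨ i + 1 ∉ T) :
    of i ^ 2 ∈ innerW n T := by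
  refine mem_innerW.mpr ⟨pow_mem (of_mem_strands hi) 2, by simp [pow_two], 1, fun y => ?_⟩
  rw [map_pow, act_of, mk'_artin_sq h]
  simp

/-- `α` drags the last puncture along the loop `u`. -/
def IsPush (n : ℕ) (α : MulAut (FreeGroup ℕ)) (u : FreeGroup ℕ) : Prop :=
  ∃ c, α (of (n - 1)) = c * of (n - 1) * c⁻¹ ∧
    ∀ y, QuotientGroup.mk' (puncRel n (Finset.range (n - 1))) (α y) =
      QuotientGroup.mk' (puncRel n (Finset.range (n - 1))) (c * u * y * (c * u)⁻¹)

theorem IsPush.mul {α β : MulAut (FreeGroup ℕ)} (hα : IsPush n α u) (hβ : IsPush n β v)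
    (hR : ∀ y ∈ puncRel n (Finset.range (n - 1)), α y ∈ puncRel n (Finset.range (n - 1))) :
    IsPush n (α * β) (u * v) := by
  obtain ⟨c, hc, hc'⟩ := hα
  obtain ⟨d, hd, hd'⟩ := hβ
  refine ⟨α d * c, ?_, fun y => ?_⟩
  · rw [MulAut.mul_apply, hd, map_mul, map_mul, map_inv, hc]
    group
  · have h1 := hd' y
    rw [mk'_eq_iff] at h1
    have h2 := hR _ h1
    rw [map_mul, map_inv, ← mk'_eq_iff] at h2
    have h3 := hc' (v * y * v⁻¹)
    rw [MulAut.mul_apply, h2, show d * v * y * (d * v)⁻¹ = d * (v * y * v⁻¹) * d⁻¹ by group,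
      map_mul α, map_mul α d, map_inv α, map_mul (QuotientGroup.mk' _),
          map_mul (QuotientGroup.mk' _) (α d)]
    simp only [map_mul, map_inv] at h3 ⊢
    rw [h3]
    group

theorem IsPush.inv {α : MulAut (FreeGroup ℕ)} (hα : IsPush n α u)
    (hR : ∀ y ∈ puncRel n (Finset.range (n - 1)), α⁻¹ y ∈ puncRel n (Finset.range (n - 1))) :
    IsPush n α⁻¹ u⁻¹ := by
  obtain ⟨c, hc, hc'⟩ := hα
  refine ⟨(α⁻¹ c)⁻¹, ?_, fun y => ?_⟩
  · have := congrArg (α⁻¹ : MulAut _) hc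
    rw [MulAut.inv_apply_self, map_mul, map_mul, map_inv] at this
    conv_rhs => rw [this]
    group
  · have h1 := hc' (u⁻¹ * y * u)
    rw [mk'_eq_iff] at h1
    have h2 := hR _ h1
    rw [map_mul, map_inv, MulAut.inv_apply_self, ← mk'_eq_iff,
      show c * u * (u⁻¹ * y * u) * (c * u)⁻¹ = c * y * c⁻¹ by group, map_mul α⁻¹, map_mul α⁻¹,
      map_inv α⁻¹] at h2
    simp only [map_mul, map_inv] at h2 ⊢
    rw [show (QuotientGroup.mk' (puncRel n (Finset.range (n - 1)))) (α⁻¹ y) =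
      ((QuotientGroup.mk' (puncRel n (Finset.range (n - 1)))) (α⁻¹ c))⁻¹ * (
      (QuotientGroup.mk' (puncRel n (Finset.range (n - 1)))) (α⁻¹ c) *
      (QuotientGroup.mk' (puncRel n (Finset.range (n - 1)))) (α⁻¹ y) *
      ((QuotientGroup.mk' (puncRel n (Finset.range (n - 1)))) (α⁻¹ c))⁻¹) *
      (QuotientGroup.mk' (puncRel n (Finset.range (n - 1)))) (α⁻¹ c) by group, ← h2]
    group

theorem IsPush.conj {α τ : MulAut (FreeGroup ℕ)} (hα : IsPush n α u)
    (hτ : τ (of (n - 1)) = of (n - 1))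
    (hR : ∀ y ∈ puncRel n (Finset.range (n - 1)), τ y ∈ puncRel n (Finset.range (n - 1))) :
    IsPush n (τ * α * τ⁻¹) (τ u) := by
  obtain ⟨c, hc, hc'⟩ := hα
  refine ⟨τ c, ?_, fun y => ?_⟩
  · have : τ⁻¹ (of (n - 1)) = of (n - 1) := by
      conv_lhs => rw [← hτ]
      exact MulAut.inv_apply_self _ _ _
    rw [MulAut.mul_apply, MulAut.mul_apply, this, hc, map_mul, map_mul, map_inv, hτ]
  · have h1 := hc' (τ⁻¹ y)
    rw [mk'_eq_iff] at h1
    have h2 := hR _ h1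
    rw [map_mul, map_inv, ← mk'_eq_iff] at h2
    rw [MulAut.mul_apply, MulAut.mul_apply, h2]
    simp

theorem act_pushHom (n : ℕ) (u : FreeGroup ℕ) : act (pushHom of n u) = pushHom artin n u := by
  rw [map_pushHom]
  simp

theorem pushHom_mem_strands (n : ℕ) (u : FreeGroup ℕ) : pushHom of n u ∈ strands n := by
  induction u using FreeGroup.induction_on with
  | C1 => rw [map_one]; exact one_mem _
  | of j =>
    rw [pushHom_of, pushGen]
    split_ifs with h
    · have : rseg of j (n - 2 - j) ∈ strands n := rseg_mem fun i _ _ => of_mem_strands (by omega)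
      exact mul_mem (mul_mem (inv_mem this) (pow_mem (of_mem_strands (by omega)) 2)) this
    · exact one_mem _
  | inv_of j h => rw [map_inv]; exact inv_mem h
  | mul x y hx hy => rw [map_mul]; exact mul_mem hx hy

theorem act_mem_of_range {l : ℕ} (hl : l ≤ n) (hw : w ∈ strands l) {y : FreeGroup ℕ}
    (hy : y ∈ puncRel n (Finset.range l)) : act w y ∈ puncRel n (Finset.range l) := by
  have := act_mem_puncRel (strands_mono hl hw) hy
  rwa [range_map_wperm hw] at this

theorem isPush_pushHom (n : ℕ) (u : FreeGroup ℕ) : IsPush n (act (pushHom of n u)) u := by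
  have triv : ∀ j, n < j + 2 → IsPush n (act (pushHom of n (of j))) (of j) := fun j hj => by
    refine ⟨1, by simp [pushGen_of_lt hj], fun y => ?_⟩
    have hR : j ∉ Finset.range (n - 1) := by simp; omega
    simp only [map_mul, map_inv, mk'_of hR]
    simp [pushGen_of_lt hj]
  have gen : ∀ d j, j + d + 2 = n → IsPush n (act (pushHom of n (of j))) (of j) := by
    intro d
    induction d with
    | zero =>
      rintro j rfl
      have hR : j + 1 ∉ Finset.range (j + 0 + 2 - 1) := by simp
      refine ⟨(of j * of (j + 1))⁻¹, ?_, fun y => ?_⟩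
      · rw [pushHom_of, pushGen_last, map_pow, act_of]
        simpa using artin_sq_succ j
      · rw [pushHom_of, pushGen_last, map_pow, act_of, mk'_artin_sq (Or.inr hR)]
        simp only [map_mul, map_inv, mk'_of hR]
        simp
    | succ d ih =>
      intro j hj
      have h1 := ih (j + 1) (by omega)
      have hm : (of j)⁻¹ ∈ strands (n - 1) := inv_mem (of_mem_strands (by omega))
      have h2 := h1.conj (τ := act (of j)⁻¹) (act_of_le le_rfl _ hm)
        fun y hy => act_mem_of_range (by omega) hm hy
      have h3 : act (of j)⁻¹ (of (j + 1)) = of j := by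
        rw [map_inv, act_of, ← artin_self]; exact MulAut.inv_apply_self _ _ _
      rw [h3] at h2
      have h4 := (artin_braidSeq (n - 1)).pushHom_act hm (of (j + 1))
      rw [h3, ← act_pushHom, ← act_pushHom, lift_artin] at h4
      rwa [h4]
  have hR : ∀ u, ∀ y ∈ puncRel n (Finset.range (n - 1)),
      act (pushHom of n u) y ∈ puncRel n (Finset.range (n - 1)) := fun u y hy =>
    (act_mem_puncRel_of_pure (pushHom_mem_strands n u) (wperm_pushHom n u)).mpr hy
  have of_case : ∀ j, IsPush n (act (pushHom of n (of j))) (of j) := fun j => by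
    rcases Nat.lt_or_ge n (j + 2) with h | h
    · exact triv j h
    · exact gen (n - 2 - j) j (by omega)
  induction u using FreeGroup.induction_on with
  | C1 => exact ⟨1, by simp, by simp⟩
  | of j => exact of_case j
  | inv_of j h =>
    rw [map_inv, map_inv]
    refine h.inv fun y hy => ?_
    have := hR (of j)⁻¹ y hy
    rwa [map_inv, map_inv] at this
  | mul x y hx hy =>
    rw [map_mul, map_mul]
    exact hx.mul hy (hR x)

theorem fillHom_eq_one_of_central (hm : 3 ≤ m)
    (h : ∀ y, QuotientGroup.mk' (puncRel m (Finset.range m)) (u * y * u⁻¹) =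
      QuotientGroup.mk' (puncRel m (Finset.range m)) y) : fillHom m u = 1 := by
  have key : ∀ j, 1 ≤ j → j < m → Commute (fillHom m u) (of j) := fun j h1 h2 => by
    have := fillHom_eq_of_mk'_eq (by omega) (h (of j))
    rw [map_mul, map_mul, map_inv, fillHom_of h1 h2] at this
    exact mul_inv_eq_iff_eq_mul.mp this
  exact FreeGroup.eq_one_of_commute_of_two (x := 1) (y := 2) (by omega) (key 1 le_rfl (by omega))
    (key 2 (by omega) (by omega))

theorem mem_puncRel_of_pushHom_mem_innerW (hm : 4 ≤ m)
    (h : pushHom of m u ∈ innerW m (Finset.range m)) :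
    fillHom (m - 1) u = 1 := by
  obtain ⟨-, -, h3⟩ := mem_innerW.mp h
  obtain ⟨c, hc, hc'⟩ := isPush_pushHom m u
  refine fillHom_eq_one_of_central (by omega) fun y => ?_
  have h1 := (hc' y).symm.trans (mk'_eq_conj_of_innerMod (by omega) h3 hc y)
  exact mk'_conj_cancel (mk'_eq_mono
    (puncRel_congr (m := m - 1) (n := m) (by omega) subset_rfl).le h1)

theorem mem_puncRel_of_pushHom_mem_innerW' (hn : 5 ≤ n)
    (h : pushHom of n u ∈ innerW n (insert (n - 1) (Finset.range (n - 2)))) :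
    fillHom (n - 2) u = 1 := by
  obtain ⟨-, -, h3⟩ := mem_innerW.mp h
  obtain ⟨c, hc, hc'⟩ := isPush_pushHom n u
  set σ : FreeGroup ℕ := of (n - 2) with hσ
  have hm : σ⁻¹ ∈ strands n := inv_mem (of_mem_strands (by omega))
  have hσn : artin (n - 2) (of (n - 2)) = of (n - 1) := by
    rw [artin_self, show n - 2 + 1 = n - 1 by omega]
  have hσi : (artin (n - 2))⁻¹ (of (n - 1)) = of (n - 2) := by
    rw [← hσn]; exact MulAut.inv_apply_self _ _ _
  have hw : wperm σ⁻¹ = Equiv.swap (n - 2) (n - 1) := by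
    rw [map_inv, wperm_of, Equiv.swap_inv, show n - 2 + 1 = n - 1 by omega]
  have hT : (insert (n - 1) (Finset.range (n - 2))).map (wperm σ⁻¹).toEmbedding =
      Finset.range (n - 1) := by
    ext x
    rw [hw, Finset.mem_map_equiv]
    simp only [Equiv.symm_swap, Finset.mem_insert, Finset.mem_range, Equiv.swap_apply_def]
    split_ifs <;> omega
  have h4 : (artin (n - 2))⁻¹ * act (pushHom of n u) * artin (n - 2) ∈
      innerMod (puncRel (n - 1) (Finset.range (n - 1))) := by
    refine innerMod_mono (puncRel_congr (m := n - 1) (n := n) (by omega) subset_rfl).le ?_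
    have := conj_mem_innerMod (S := puncRel n (Finset.range (n - 1))) (fun y hy => by
      rw [← hT]; exact act_mem_puncRel hm hy) h3
    simpa [hσ] using this
  have h5 := mk'_eq_conj_of_innerMod (c := (artin (n - 2))⁻¹ c) (by omega) h4 (by
    rw [MulAut.mul_apply, MulAut.mul_apply, show n - 1 - 1 = n - 2 by omega, hσn, hc]
    rw [map_mul, map_mul, map_inv, hσi])
  have hT' : (Finset.range (n - 2)).map (wperm σ).toEmbedding = Finset.range (n - 2) := by
    ext x
    rw [wperm_of, Finset.mem_map_equiv]
    simp only [Equiv.symm_swap, Finset.mem_range, Equiv.swap_apply_def]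
    split_ifs <;> omega
  refine fillHom_eq_one_of_central (by omega) fun y => ?_
  have h6 := h5 ((artin (n - 2))⁻¹ y)
  rw [mk'_eq_iff, show n - 1 - 1 = n - 2 by omega,
    puncRel_congr (m := n - 2) (n := n - 1) (by omega) subset_rfl,
    ← puncRel_congr (m := n - 2) (n := n) (by omega) subset_rfl] at h6
  have h7 := act_mem_puncRel (w := σ) (of_mem_strands (by omega)) h6
  rw [hT', act_of, map_mul, map_inv, ← mk'_eq_iff] at h7
  simp only [MulAut.mul_apply, map_mul, map_inv, MulAut.apply_inv_self] at h7
  have h8 := mk'_eq_mono (S := puncRel n (Finset.range (n - 2)))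
    (puncRel_anti n (Finset.range_mono (show n - 2 ≤ n - 1 by omega))) (hc' y)
  rw [h7, ← map_inv, ← map_mul, ← map_mul] at h8
  exact mk'_conj_cancel (mk'_eq_mono
    (puncRel_congr (m := n - 2) (n := n) (by omega) subset_rfl).le h8.symm)

end

/-! ### Faithfulness of the outer action -/

section

open FreeGroup (of)

variable {n m : ℕ} {S T : Finset ℕ} {w v u : FreeGroup ℕ}

section
variable {G : Type*} [Group G] {t : ℕ → G}

theorem BraidSeq.seg_pow {l : ℕ} (h : BraidSeq (l + 1) t) : ∀ k i, k + i = l + 1 →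
    seg t 0 (l + 1) ^ k = seg t 0 l ^ k * rseg t i k := by
  intro k
  induction k with
  | zero => simp [rseg]
  | succ k ih =>
    intro i hi
    have key : ∀ d, i + d ≤ l → rseg t (i + 1) d * seg t 0 (l + 1) = seg t 0
        (l + 1) * rseg t i d := by
      intro d
      induction d with
      | zero => simp [rseg]
      | succ d ihd =>
        intro hd
        rw [rseg, rseg, mul_assoc, ihd (by omega), ← mul_assoc, ← mul_assoc,
          h.seg_mul (m := i + d) (by omega) (by omega) (by omega),
          show i + 1 + d = i + d + 1 by omega]
    rw [pow_succ, ih (i + 1) (by omega), mul_assoc, key k (by omega), pow_succ, mul_assoc,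
      seg, mul_assoc, zero_add, rseg, show i + k = l by omega]

theorem BraidSeq.seg_pow_eq_one {l : ℕ} (h : BraidSeq (l + 1) t)
    (h1 : seg t 0 (l + 1) * rseg t 0 (l + 1) = 1) (h2 : seg t 0 (l + 1) ^ (l + 2) = 1) :
    seg t 0 l ^ (l + 1) = 1 := by
  have h3 := h.seg_pow (l + 1) 0 (by omega)
  rw [pow_succ, h3, mul_assoc, mul_eq_one_comm.mp h1, mul_one] at h2
  exact h2

theorem rseg_mul_seg_of_relator {l : ℕ} (h1 : seg t 0 (l + 1) * rseg t 0 (l + 1) = 1) :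
    rseg t 0 l * seg t 0 l = (t l ^ 2)⁻¹ := by
  have h4 := mul_eq_one_comm.mp h1
  rw [seg, rseg, zero_add] at h4
  have h5 : t l * (rseg t 0 l * seg t 0 l * t l) = 1 := by rw [← h4]; group
  have h6 := mul_eq_one_comm.mp h5
  rw [eq_inv_iff_mul_eq_one, ← h6, pow_two, mul_assoc, mul_assoc, mul_assoc]

theorem sq_eq_one_of_relators {a b : G} (hb : a * b * a = b * a * b) (h1 : a * b * (b * a) = 1)
    (h2 : (a * b) ^ 3 = 1) : a ^ 2 = 1 ∧ b ^ 2 = 1 := by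
  have e1 : b ^ 2 = (a ^ 2)⁻¹ := by
    rw [eq_inv_iff_mul_eq_one]
    have h3 : a * (b ^ 2 * a ^ 2) = a := by
      calc a * (b ^ 2 * a ^ 2) = a * b * (b * a) * a := by simp only [pow_two, mul_assoc]
        _ = a := by rw [h1, one_mul]
    simpa using h3
  have hc : a ^ 2 * b = b * a ^ 2 := by
    have h3 : Commute (b ^ 2) b := (Commute.refl b).pow_left 2
    rw [e1] at h3
    exact (Commute.inv_left_iff.mp h3).eq
  have e2 : a ^ 2 = 1 := by
    calc a ^ 2 = a ^ 2 * (a * b * (b * a)) := by rw [h1, mul_one]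
      _ = a * (a ^ 2 * b) * b * a := by simp only [pow_two, mul_assoc]
      _ = a * b * a * (a * b * a) := by rw [hc]; simp only [pow_two, mul_assoc]
      _ = a * b * a * (b * a * b) := by rw [hb]
      _ = (a * b) ^ 3 := by simp only [pow_succ, pow_zero, one_mul, mul_assoc]
      _ = 1 := h2
  exact ⟨e2, by rw [e1, e2, inv_one]⟩

end

theorem toMCG_pushHom (n m : ℕ) (u : FreeGroup ℕ) :
    toMCG n (pushHom of m u) = pushHom (sgen n) m u := by
  rw [map_pushHom]; simp

theorem toMCG_pushHom_eq_one (hm : 2 ≤ m) (hu : fillHom (m - 1) u = 1) :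
    toMCG m (pushHom of m u) = 1 := by
  rw [toMCG_pushHom, ← MonoidHom.mem_ker]
  rw [← mem_puncRel_iff (by omega),
    ← puncRel_congr (m := m - 1) (n := m) (by omega) subset_rfl] at hu
  refine puncRel_le ?_ (fun j hj => ?_) hu
  · rw [MonoidHom.mem_ker, (sgen_braidSeq m).pushHom_seg (by omega)]
    exact mul_eq_one_comm.mp (sgen_relations m).2.1
  · rw [Finset.mem_range] at hj
    rw [MonoidHom.mem_ker, pushHom_of, pushGen_of_lt (by omega)]

theorem pushHom_mem_innerW (m : ℕ) (u : FreeGroup ℕ) :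
    pushHom of m u ∈ innerW m (Finset.range (m - 1)) := by
  obtain ⟨c, -, hc⟩ := isPush_pushHom m u
  exact mem_innerW.mpr ⟨pushHom_mem_strands m u, wperm_pushHom m u, c * u, hc⟩

/-- The image of the point pushing homomorphism. -/
def pushRange (m : ℕ) : Subgroup (SphereMCG m) := (pushHom (sgen m) m).range

theorem toMCG_mem_normalizer_pushRange (hw : w ∈ strands (m - 1)) :
    toMCG m w ∈ Subgroup.normalizer (pushRange m : Set (SphereMCG m)) := by
  have key : ∀ w ∈ strands (m - 1), ∀ g ∈ pushRange m,
      toMCG m w * g * (toMCG m w)⁻¹ ∈ pushRange m := by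
    rintro w hw _ ⟨u, rfl⟩
    exact ⟨_, (sgen_braidSeq m).pushHom_act hw u⟩
  rw [Subgroup.mem_normalizer_iff]
  refine fun g => ⟨key w hw g, fun h => ?_⟩
  have := key _ (inv_mem hw) _ h
  simpa [mul_assoc] using this

theorem toMCG_mem_pushRange_succ {l : ℕ} (hw : w ∈ strands (l + 1))
    (h : toMCG (l + 1) w = 1) : toMCG (l + 2) w ∈ pushRange (l + 2) := by
  have hb : BraidSeq (l + 1) (sgen (l + 2)) := sgen_braidSeq (l + 2)
  have h1 : seg (sgen (l + 2)) 0 (l + 1) * rseg (sgen (l + 2)) 0 (l + 1) = 1 :=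
    (sgen_relations (l + 2)).2.1
  have h2 : seg (sgen (l + 2)) 0 (l + 1) ^ (l + 2) = 1 := (sgen_relations (l + 2)).2.2
  have hseg : seg (sgen (l + 2)) 0 l = toMCG (l + 2) (seg of 0 l) := by rw [map_seg]; simp
  have hs : seg of 0 l ∈ strands (l + 1) := seg_mem fun j _ hj => of_mem_strands (by omega)
  have h3 : rseg (sgen (l + 2)) 0 l * seg (sgen (l + 2)) 0 l ∈ pushRange (l + 2) := by
    refine ⟨(of l)⁻¹, ?_⟩
    rw [rseg_mul_seg_of_relator h1, map_inv, pushHom_of, pushGen_last]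
  have hN : ∀ i, i + 1 < l + 1 →
      sgen (l + 2) i ∈ Subgroup.normalizer (pushRange (l + 2) : Set (SphereMCG (l + 2))) :=
    fun i hi => by
      rw [← toMCG_of]
      exact toMCG_mem_normalizer_pushRange (m := l + 2) (of_mem_strands hi)
  have h5 := (Subgroup.mem_normalizer_iff.mp (toMCG_mem_normalizer_pushRange
      (m := l + 2) hs) _).mp h3
  rw [← hseg, ← mul_assoc, mul_inv_cancel_right] at h5
  have h6 : seg (sgen (l + 2)) 0 l ^ (l + 1) ∈ pushRange (l + 2) := by
    rw [hb.seg_pow_eq_one h1 h2]; exact one_mem _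
  have hb' : BraidSeq (l + 1 - 1) (sgen (l + 2)) := hb.mono (Nat.le_succ l)
  exact hb'.lift_mem_of_toMCG_eq_one hN h5 h6 hw h

theorem toMCG_mem_pushRange (hm : 2 ≤ m) (hw : w ∈ strands (m - 1))
    (h : toMCG (m - 1) w = 1) : toMCG m w ∈ pushRange m := by
  obtain ⟨l, rfl⟩ : ∃ l, m = l + 2 := ⟨m - 2, by omega⟩
  exact toMCG_mem_pushRange_succ hw h

/-- If mapping classes of `m - 1` punctures are determined by their action, then a mapping class
of `m` punctures that becomes trivial after filling the last puncture is a point push. -/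
theorem exists_toMCG_eq_pushHom (hm : 2 ≤ m)
    (hF : ∀ w ∈ innerW (m - 1) (Finset.range (m - 1)), toMCG (m - 1) w = 1)
    (hw : w ∈ innerW m (Finset.range (m - 1))) : ∃ u, toMCG m w = toMCG m (pushHom of m u) := by
  obtain ⟨h1, h2, -⟩ := mem_innerW.mp hw
  have hT : Finset.range (m - 1) ⊆ Finset.range m := Finset.range_mono (by omega)
  obtain ⟨u, v, hv, e, hp⟩ := (sgen_braidSeq m).exists_lift_eq_of_fix (by omega) h1
      (by rw [h2]; rfl)
  change toMCG m w = _ * toMCG m v at e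
  rw [← toMCG_pushHom] at e
  have hv' : v ∈ innerW m (Finset.range (m - 1)) := by
    rw [← toMCG_mem_pureN_iff hT (strands_mono (by omega) hv), ← inv_mul_eq_iff_eq_mul.mpr e,
      ← map_inv, ← map_mul, toMCG_mem_pureN_iff hT (mul_mem (inv_mem (pushHom_mem_strands _ _)) h1)]
    exact mul_mem (inv_mem (pushHom_mem_innerW m u)) hw
  obtain ⟨u', hu'⟩ := toMCG_mem_pushRange hm hv
    (hF v ((innerW_congr (by omega) subset_rfl hv).mp hv'))
  refine ⟨u * u', ?_⟩
  rw [e, ← hu', map_mul, map_mul, toMCG_pushHom m m u']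

theorem sgen_three_sq : ∀ i, i + 1 < 3 → sgen 3 i ^ 2 = 1 := by
  obtain ⟨hb, h1, h2⟩ := sgen_relations 3
  have hb' := hb.braid 0 (by norm_num)
  simp only [seg, rseg, zero_add, one_mul, mul_one] at h1 h2 hb'
  obtain ⟨e1, e2⟩ := sq_eq_one_of_relators hb' h1 h2
  intro i hi
  have : i = 0 ∨ i = 1 := by omega
  rcases this with rfl | rfl
  · exact e1
  · exact e2

theorem toMCG_three_eq_one (hw : w ∈ strands 3) (hp : wperm w = 1) : toMCG 3 w = 1 :=
  (sgen_braidSeq 3).lift_eq_one_of_sq sgen_three_sq hw hp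

/-- Mapping classes are determined by their outer action on the fundamental group. -/
theorem toMCG_eq_one_of_mem_innerW (hm : 3 ≤ m) :
    ∀ w ∈ innerW m (Finset.range m), toMCG m w = 1 := by
  induction m, hm using Nat.le_induction with
  | base =>
    intro w hw
    obtain ⟨h1, h2, -⟩ := mem_innerW.mp hw
    exact toMCG_three_eq_one h1 h2
  | succ m hm ih =>
    intro w hw
    obtain ⟨u, hu⟩ := exists_toMCG_eq_pushHom (m := m + 1) (by omega) ih
      (innerW_anti (Finset.range_mono (Nat.le_succ m)) hw)
    rw [hu]
    apply toMCG_pushHom_eq_one (by omega)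
    apply mem_puncRel_of_pushHom_mem_innerW (by omega)
    rwa [← toMCG_mem_pureN_iff subset_rfl (pushHom_mem_strands _ _), ← hu,
      toMCG_mem_pureN_iff subset_rfl (mem_innerW.mp hw).1]

theorem pureN_range (hn : 3 ≤ n) : pureN n (Finset.range n) = ⊥ := by
  rw [eq_bot_iff]
  rintro _ ⟨w, hw, rfl⟩
  exact toMCG_eq_one_of_mem_innerW hn w hw

theorem toMCG_pushHom_mem_pureN (hmn : m ≤ n) (u : FreeGroup ℕ) :
    toMCG n (pushHom of m u) ∈ pureN n (Finset.range (m - 1)) :=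
  ⟨_, (innerW_congr hmn (Finset.range_mono (by omega)) (pushHom_mem_strands m u)).mpr
    (pushHom_mem_innerW m u), rfl⟩

/-- Modulo point pushes, a mapping class fixing the punctures `m, …, n - 1` is a word in the
first `m` strands. -/
theorem exists_mul_inv_mem_pureN (hm : m ≤ n) (g : SphereMCG n)
    (hg : ∀ j, m ≤ j → j < n → mperm n g j = j) :
    ∃ w ∈ strands m, wperm w = mperm n g ∧ g * (toMCG n w)⁻¹ ∈ pureN n (Finset.range m) := by
  obtain ⟨d, hd⟩ := Nat.exists_eq_add_of_le hm
  induction d generalizing m with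
  | zero =>
    obtain rfl : n = m := hd
    obtain ⟨w, hw, rfl⟩ := exists_toMCG_eq g
    exact ⟨w, hw, (mperm_toMCG w hw).symm, by rw [mul_inv_cancel]; exact one_mem _⟩
  | succ d ih =>
    obtain ⟨v, hv, hp, hmem⟩ := ih (m := m + 1) (by omega) (fun j h1 h2 => hg j (by omega) h2)
      (by omega)
    obtain ⟨u, v', hv', e, hp'⟩ := ((sgen_braidSeq n).mono (by omega)).exists_lift_eq_of_fix
      (m := m + 1) (by omega) hv (by rw [hp]; exact hg _ (by omega) (by omega))
    change toMCG n v = _ * toMCG n v' at e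
    rw [← toMCG_pushHom] at e
    refine ⟨v', hv', by rw [← hp', hp], ?_⟩
    have h1 := mul_mem (pureN_anti (Finset.range_mono (Nat.le_succ m)) hmem)
      (toMCG_pushHom_mem_pureN (m := m + 1) (by omega) u)
    rw [e] at h1
    simpa [mul_assoc] using h1

end

/-! ### Moving punctures and commuting pure classes -/

section

open FreeGroup (of)

variable {n m : ℕ} {S T : Finset ℕ} {w v u : FreeGroup ℕ}

/-- An injective assignment on an initial segment extends to a permutation. -/
theorem exists_perm_extending {k : ℕ} (f : ℕ → ℕ) (hf : Set.InjOn f (Set.Iio k))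
    {lo : ℕ} (hlt : ∀ i < k, f i < n) (hlo : ∀ i < lo, f i = i) (hk : k ≤ n) (hlok : lo ≤ k) :
    ∃ π : Equiv.Perm ℕ, (∀ j < k, π j = f j) ∧ ∀ j, n ≤ j → π j = j := by
  induction k, hlok using Nat.le_induction with
  | base => exact ⟨1, fun j hj => (hlo j hj).symm, fun _ _ => rfl⟩
  | succ k _ ih =>
    obtain ⟨π, h1, h2⟩ := ih (hf.mono fun i (hi : i < k) => by simp; omega)
      (fun i hi => hlt i (by omega)) (by omega)
    refine ⟨Equiv.swap (π k) (f k) * π, fun j hj => ?_, fun j hj => ?_⟩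
    · rw [Equiv.Perm.mul_apply]
      rcases Nat.lt_succ_iff_lt_or_eq.mp hj with h | rfl
      · rw [h1 j h, Equiv.swap_apply_of_ne_of_ne]
        · rw [← h1 j h]
          exact fun e => absurd (π.injective e) (by omega)
        · exact fun e => absurd (hf (show j < k + 1 by omega) (Nat.lt_succ_self k) e) (by omega)
      · exact Equiv.swap_apply_left _ _
    · rw [Equiv.Perm.mul_apply, h2 j hj, Equiv.swap_apply_of_ne_of_ne]
      · intro e
        rw [← h2 j hj] at e
        exact absurd (π.injective e) (by omega)
      · have := hlt k (by omega)
        omega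

/-- Words in the half twists `lo, …, n - 2`. -/
def strandsFrom (lo n : ℕ) : Subgroup (FreeGroup ℕ) :=
  Subgroup.closure (of '' {i | lo ≤ i ∧ i + 1 < n})

theorem strandsFrom_le (lo n : ℕ) : strandsFrom lo n ≤ strands n :=
  Subgroup.closure_mono (Set.image_mono fun _ h => h.2)

theorem strandsFrom_zero (n : ℕ) : strandsFrom 0 n = strands n := by simp [strandsFrom, strands]

theorem exists_wperm_eq {lo : ℕ} (hlo : lo ≤ n) (π : Equiv.Perm ℕ) (h0 : ∀ j < lo, π j = j)
    (hπ : ∀ j, n ≤ j → π j = j) : ∃ w ∈ strandsFrom lo n, wperm w = π := by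
  induction n, hlo using Nat.le_induction generalizing π with
  | base =>
    refine ⟨1, one_mem _, ?_⟩
    ext j
    rw [map_one, Equiv.Perm.one_apply]
    rcases Nat.lt_or_ge j lo with h | h
    · rw [h0 j h]
    · rw [hπ j h]
  | succ n hlo ih =>
    have hk1 : lo ≤ π n := by
      by_contra h
      have := h0 _ (not_le.mp h)
      have := π.injective this
      omega
    have hk2 : π n ≤ n := by
      by_contra h
      have := π.injective (hπ _ (show n + 1 ≤ π n by omega))
      omega
    set ω : FreeGroup ℕ := rseg of (π n) (n - π n)
    have hω : ω ∈ strandsFrom lo (n + 1) := rseg_mem fun i h1 h2 =>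
      Subgroup.subset_closure ⟨i, ⟨by omega, by omega⟩, rfl⟩
    have hωk : wperm ω (π n) = n := by
      have := rseg_swap_apply (π n) (n - π n)
      rw [show π n + (n - π n) = n by omega] at this
      simpa [ω, map_rseg] using this
    have hω0 : ∀ j < lo, wperm ω j = j := fun j hj => by
      have : ω ∈ (MulAction.stabilizer (Equiv.Perm ℕ) j).comap wperm := rseg_mem fun i h1 h2 => by
        change wperm (of i) j = j
        rw [wperm_of, Equiv.swap_apply_of_ne_of_ne (by omega) (by omega)]
      exact this
    obtain ⟨w, hw, hp⟩ := ih (wperm ω * π) (fun j hj => by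
        rw [Equiv.Perm.mul_apply, h0 j hj, hω0 j hj]) (fun j hj => by
        rw [Equiv.Perm.mul_apply]
        rcases Nat.eq_or_lt_of_le hj with rfl | h
        · exact hωk
        · rw [hπ j h, wperm_apply_of_le h ω (strandsFrom_le _ _ hω)])
    refine ⟨ω⁻¹ * w, mul_mem (inv_mem hω) (Subgroup.closure_mono (Set.image_mono ?_) hw), ?_⟩
    · exact fun i hi => ⟨hi.1, by have := hi.2; omega⟩
    · rw [map_mul, map_inv, hp, inv_mul_cancel_left]

theorem exists_wperm_extending {lo k : ℕ} (f : ℕ → ℕ) (hf : Set.InjOn f (Set.Iio k))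
    (hlt : ∀ i < k, f i < n) (hlo : ∀ i < lo, f i = i) (hk : k ≤ n) (hlok : lo ≤ k) :
    ∃ w ∈ strandsFrom lo n, ∀ j < k, wperm w j = f j := by
  obtain ⟨π, h1, h2⟩ := exists_perm_extending f hf hlt hlo hk hlok
  obtain ⟨w, hw, rfl⟩ := exists_wperm_eq (hlok.trans hk) π
    (fun j hj => by rw [h1 j (by omega), hlo j hj]) h2
  exact ⟨w, hw, h1⟩

theorem map_symm_map (π : Equiv.Perm ℕ) (T : Finset ℕ) :
    (T.map (Equiv.toEmbedding π⁻¹)).map π.toEmbedding = T := by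
  ext x
  rw [Finset.mem_map_equiv, Finset.mem_map_equiv]
  change π (π⁻¹ x) ∈ T ↔ _
  simp

/-- A mapping class moving a standard set of punctures to a given one. -/
theorem exists_mperm_map_range (hT : T ⊆ Finset.range n) {a : ℕ} (ha : a ∈ T) :
    ∃ g : SphereMCG n, (Finset.range T.card).map (mperm n g).toEmbedding = T ∧
      (Finset.range (T.card - 1)).map (mperm n g).toEmbedding = T.erase a := by
  have hc : (T.erase a).card = T.card - 1 := Finset.card_erase_of_mem ha
  have hpos : 0 < T.card := Finset.card_pos.mpr ⟨a, ha⟩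
  have hcn : T.card ≤ n := by simpa using Finset.card_le_card hT
  set e := (T.erase a).orderEmbOfFin hc
  set f : ℕ → ℕ := fun j => if h : j < T.card - 1 then e ⟨j, h⟩ else a
  have hf1 : ∀ j, j < T.card - 1 → f j ∈ T.erase a := fun j h => by
    simp only [f, dif_pos h]
    exact Finset.orderEmbOfFin_mem _ hc _
  have hf2 : ∀ j, ¬ j < T.card - 1 → f j = a := fun j h => by simp only [f, dif_neg h]
  have hfT : ∀ j, f j ∈ T := fun j => by
    by_cases h : j < T.card - 1
    · exact Finset.mem_of_mem_erase (hf1 j h)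
    · rw [hf2 j h]; exact ha
  have hinj : Set.InjOn f (Set.Iio T.card) := by
    intro i hi j hj hij
    rw [Set.mem_Iio] at hi hj
    by_cases h : i < T.card - 1 <;> by_cases h' : j < T.card - 1
    · simp only [f, dif_pos h, dif_pos h'] at hij
      simpa using hij
    · rw [hf2 j h'] at hij
      exact absurd hij (Finset.ne_of_mem_erase (hf1 i h))
    · rw [hf2 i h] at hij
      exact absurd hij.symm (Finset.ne_of_mem_erase (hf1 j h'))
    · omega
  obtain ⟨w, hw, hp⟩ := exists_wperm_extending (lo := 0) (n := n) f hinj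
    (fun i _ => Finset.mem_range.mp (hT (hfT i))) (by simp) hcn (Nat.zero_le _)
  have hg := mperm_toMCG w (strandsFrom_le _ _ hw)
  refine ⟨toMCG n w, ?_, ?_⟩
  · apply Finset.eq_of_subset_of_card_le
    · intro x hx
      obtain ⟨j, hj, rfl⟩ := Finset.mem_map.mp hx
      change mperm n (toMCG n w) j ∈ _
      rw [hg, hp j (Finset.mem_range.mp hj)]
      exact hfT j
    · simp
  · apply Finset.eq_of_subset_of_card_le
    · intro x hx
      obtain ⟨j, hj, rfl⟩ := Finset.mem_map.mp hx
      change mperm n (toMCG n w) j ∈ _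
      have := Finset.mem_range.mp hj
      rw [hg, hp j (by omega)]
      exact hf1 j this
    · simp [hc]

theorem inv_conj_mem_pureN (g : SphereMCG n) {x : SphereMCG n}
    (hx : x ∈ pureN n (T.map (mperm n g).toEmbedding)) : g⁻¹ * x * g ∈ pureN n T := by
  have := conj_mem_pureN g⁻¹ hx
  rw [map_inv, inv_inv] at this
  have e := map_symm_map (mperm n g)⁻¹ T
  rw [inv_inv] at e
  rwa [e] at this

theorem ker_le_pureN_of_card (hn : 3 ≤ n) (hT : T ⊆ Finset.range n) (hc : T.card ≤ 3) :
    (mperm n).ker ≤ pureN n T := by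
  have base : (mperm n).ker ≤ pureN n (Finset.range 3) := fun g hg => by
    rw [MonoidHom.mem_ker] at hg
    obtain ⟨w, hw, hp, h⟩ := exists_mul_inv_mem_pureN hn g (fun j _ _ => by rw [hg]; rfl)
    have h1 : toMCG n w ∈ pureN n (Finset.range 3) :=
      ⟨w, (innerW_congr hn subset_rfl hw).mpr (mem_innerW_of_toMCG_eq_one hw
        (toMCG_three_eq_one hw (hp.trans hg)) subset_rfl), rfl⟩
    simpa using mul_mem h h1
  obtain ⟨T', h1, h2, h3⟩ := Finset.exists_subsuperset_card_eq hT hc (by simpa using hn)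
  obtain ⟨a, ha⟩ := Finset.card_pos.mp (show 0 < T'.card by omega)
  obtain ⟨g, hg, -⟩ := exists_mperm_map_range h2 ha
  rw [h3] at hg
  refine le_trans (fun x hx => ?_) (pureN_anti h1)
  have h4 : g⁻¹ * x * g ∈ (mperm n).ker := by
    simpa using (mperm n).normal_ker.conj_mem x hx g⁻¹
  have h5 := conj_mem_pureN g (base h4)
  rw [hg] at h5
  simpa [mul_assoc] using h5

theorem conj_sgen_sq_mem_pureN (g : SphereMCG n) {i : ℕ} (hi : i + 1 < n)
    (h : mperm n g i ∉ T ∨ mperm n g (i + 1) ∉ T) : g * sgen n i ^ 2 * g⁻¹ ∈ pureN n T := by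
  have h1 : sgen n i ^ 2 ∈ pureN n (T.map (Equiv.toEmbedding (mperm n g)⁻¹)) := by
    refine ⟨of i ^ 2, of_sq_mem_innerW hi ?_, by simp⟩
    rw [Finset.mem_map_equiv, Finset.mem_map_equiv]
    exact h
  have := conj_mem_pureN g h1
  rwa [map_symm_map] at this

theorem exists_toMCG_pushHom (hm : 4 ≤ m) (hmn : m ≤ n) {g : SphereMCG n}
    (hg : g ∈ pureN n (Finset.range (m - 1))) :
    ∃ u, g * (toMCG n (pushHom of m u))⁻¹ ∈ pureN n (Finset.range m) := by
  have hp : mperm n g = 1 := pureN_le_ker hg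
  obtain ⟨w, hw, hwp, h⟩ := exists_mul_inv_mem_pureN hmn g (fun j _ _ => by rw [hp]; rfl)
  have hr : Finset.range (m - 1) ⊆ Finset.range m := Finset.range_mono (by omega)
  have hrn : Finset.range m ⊆ Finset.range n := Finset.range_mono hmn
  have h1 : toMCG n w ∈ pureN n (Finset.range (m - 1)) := by
    simpa using mul_mem (inv_mem (pureN_anti hr h)) hg
  rw [toMCG_mem_pureN_iff (hr.trans hrn) (strands_mono hmn hw), innerW_congr hmn hr hw] at h1
  obtain ⟨u, hu⟩ := exists_toMCG_eq_pushHom (by omega)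
    (toMCG_eq_one_of_mem_innerW (m := m - 1) (by omega)) h1
  have hps := pushHom_mem_strands m u
  have h2 : w * (pushHom of m u)⁻¹ ∈ innerW m (Finset.range m) :=
    mem_innerW_of_toMCG_eq_one (mul_mem hw (inv_mem hps)) (by simp [hu]) subset_rfl
  have h3 : toMCG n (w * (pushHom of m u)⁻¹) ∈ pureN n (Finset.range m) :=
    ⟨_, (innerW_congr hmn subset_rfl (mul_mem hw (inv_mem hps))).mpr h2, rfl⟩
  refine ⟨u, ?_⟩
  rw [map_mul, map_inv] at h3
  simpa [mul_assoc] using mul_mem h h3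

theorem toMCG_pushHom_mem_pureN_iff (hm : 4 ≤ m) (hmn : m ≤ n) (u : FreeGroup ℕ) :
    toMCG n (pushHom of m u) ∈ pureN n (Finset.range m) ↔ fillHom (m - 1) u = 1 := by
  have hps := pushHom_mem_strands m u
  rw [toMCG_mem_pureN_iff (Finset.range_mono hmn) (strands_mono hmn hps),
    innerW_congr hmn subset_rfl hps]
  exact ⟨mem_puncRel_of_pushHom_mem_innerW hm, fun h =>
    mem_innerW_of_toMCG_eq_one hps (toMCG_pushHom_eq_one (by omega) h) subset_rfl⟩

theorem exists_pureN_hom (hT : T ⊆ Finset.range n) {a : ℕ} (ha : a ∈ T) (hc : 4 ≤ T.card) :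
    ∃ Φ : pureN n (T.erase a) →* FreeGroup ℕ, ∀ g, Φ g = 1 ↔ (g : SphereMCG n) ∈ pureN n T := by
  obtain ⟨c, hc1, hc2⟩ := exists_mperm_map_range hT ha
  set m := T.card
  have hmn : m ≤ n := by simpa using Finset.card_le_card hT
  set φ : FreeGroup ℕ →* SphereMCG n :=
    (MulAut.conj c).toMonoidHom.comp ((toMCG n).comp (pushHom of m)) with hφ
  have hφ' : ∀ u, φ u = c * toMCG n (pushHom of m u) * c⁻¹ := fun u => rfl
  have hconj : ∀ x : SphereMCG n, x ∈ pureN n (Finset.range m) ↔ c * x * c⁻¹ ∈ pureN n T := by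
    intro x
    constructor
    · intro h
      have := conj_mem_pureN c h
      rwa [hc1] at this
    · intro h
      rw [← hc1] at h
      simpa [mul_assoc] using inv_conj_mem_pureN c h
  have h1 : ∀ g : pureN n (T.erase a), ∃ u, (g : SphereMCG n) * (φ u)⁻¹ ∈ pureN n T := by
    rintro ⟨g, hg⟩
    rw [← hc2] at hg
    obtain ⟨u, hu⟩ := exists_toMCG_pushHom hc hmn (inv_conj_mem_pureN c hg)
    refine ⟨u, ?_⟩
    rw [hconj] at hu
    rw [hφ']
    simpa [mul_assoc] using hu
  have h2 : ∀ u, φ u ∈ pureN n T ↔ fillHom (m - 1) u = 1 := fun u => by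
    rw [hφ', ← hconj, toMCG_pushHom_mem_pureN_iff hc hmn]
  have hφp : ∀ u, mperm n (φ u) = 1 := fun u => by
    rw [hφ', map_mul, map_mul, mperm_toMCG _ (strands_mono hmn (pushHom_mem_strands m u)),
      wperm_pushHom]
    simp
  choose U hU using h1
  have huniq : ∀ (g : SphereMCG n) (u v), g * (φ u)⁻¹ ∈ pureN n T → g * (φ v)⁻¹ ∈ pureN n T →
      fillHom (m - 1) u = fillHom (m - 1) v := fun g u v hu hv => by
    rw [← mul_inv_eq_one, ← map_inv, ← map_mul, ← h2, map_mul, map_inv]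
    have := mul_mem (inv_mem hu) hv
    simpa [mul_assoc] using this
  refine ⟨MonoidHom.mk' (fun g => fillHom (m - 1) (U g)) fun g h => ?_, fun g => ?_⟩
  · rw [← map_mul]
    refine huniq (g * h) _ _ (hU (g * h)) ?_
    have := mul_mem (hU g) (conj_mem_pureN_of_pure (hφp (U g)) (hU h))
    simpa [mul_assoc] using this
  · change fillHom (m - 1) (U g) = 1 ↔ _
    rw [← h2]
    constructor
    · intro h
      simpa using mul_mem (hU g) h
    · intro h
      simpa using mul_mem (inv_mem (hU g)) h

theorem mem_pureN_of_zpow_mem (hT : T ⊆ Finset.range n) (hn : 3 ≤ n) {g : SphereMCG n}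
    (hg : mperm n g = 1) {k : ℤ} (hk : k ≠ 0) (h : g ^ k ∈ pureN n T) : g ∈ pureN n T := by
  induction hc : T.card generalizing T with
  | zero => exact ker_le_pureN_of_card hn hT (by omega) hg
  | succ c ih =>
    rcases Nat.lt_or_ge T.card 4 with h4 | h4
    · exact ker_le_pureN_of_card hn hT (by omega) hg
    obtain ⟨a, ha⟩ := Finset.card_pos.mp (show 0 < T.card by omega)
    have h1 := ih ((Finset.erase_subset a T).trans hT) (pureN_anti (Finset.erase_subset a T) h)
      (by rw [Finset.card_erase_of_mem ha]; omega)
    obtain ⟨Φ, hΦ⟩ := exists_pureN_hom hT ha h4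
    have h2 : Φ (⟨g, h1⟩ ^ k) = 1 := (hΦ _).mpr (by simpa using h)
    rw [map_zpow] at h2
    exact (hΦ ⟨g, h1⟩).mp ((IsMulTorsionFree.zpow_eq_one_iff_left hk).mp h2)

theorem exists_zpow_mul_inv_mem_pureN (hT : T ⊆ Finset.range n) {a : ℕ} (ha : a ∈ T)
    (hc : 4 ≤ T.card) {g h : SphereMCG n} (hg : g ∈ pureN n (T.erase a))
    (hh : h ∈ pureN n (T.erase a)) (hg' : g ∉ pureN n T) (hh' : h ∉ pureN n T)
    (hcomm : g * h * g⁻¹ * h⁻¹ ∈ pureN n T) :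
    ∃ p q : ℤ, p ≠ 0 ∧ q ≠ 0 ∧ g ^ p * (h ^ q)⁻¹ ∈ pureN n T := by
  obtain ⟨Φ, hΦ⟩ := exists_pureN_hom hT ha hc
  have h1 : Φ (⟨g, hg⟩ * ⟨h, hh⟩ * ⟨g, hg⟩⁻¹ * ⟨h, hh⟩⁻¹) = 1 := (hΦ _).mpr (by simpa using hcomm)
  have h2 : Commute (Φ ⟨g, hg⟩) (Φ ⟨h, hh⟩) := by
    rw [map_mul, map_mul, map_mul, map_inv, map_inv, mul_inv_eq_one, mul_inv_eq_iff_eq_mul] at h1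
    exact h1
  obtain ⟨p, q, hp, hq, e⟩ := FreeGroup.exists_zpow_eq_zpow h2 (fun e => hg' ((hΦ _).mp e))
    (fun e => hh' ((hΦ _).mp e))
  refine ⟨p, q, hp, hq, ?_⟩
  have h3 : Φ (⟨g, hg⟩ ^ p * (⟨h, hh⟩ ^ q)⁻¹) = 1 := by
    rw [map_mul, map_inv, map_zpow, map_zpow, e, mul_inv_cancel]
  simpa using (hΦ _).mp h3

end

/-! ### Ping-pong in `SL(2, ℤ)` -/

section

open FreeGroup (of)
open scoped MatrixGroups

section Matrices

/-- The upper and lower unipotent generators of `SL(2, ℤ)`. -/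
def matT : SL(2, ℤ) := ⟨!![1, 1; 0, 1], by simp [Matrix.det_fin_two]⟩

/-- The lower unipotent generator. -/
def matL : SL(2, ℤ) := ⟨!![1, 0; -1, 1], by simp [Matrix.det_fin_two]⟩

theorem SL2.det_eq (A : SL(2, ℤ)) : A 0 0 * A 1 1 - A 0 1 * A 1 0 = 1 := by
  rw [← Matrix.det_fin_two]; exact A.2

theorem SL2.ext_iff (A B : SL(2, ℤ)) :
    A = B ↔ A 0 0 = B 0 0 ∧ A 0 1 = B 0 1 ∧ A 1 0 = B 1 0 ∧ A 1 1 = B 1 1 := by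
  constructor
  · rintro rfl; simp
  · rintro ⟨h1, h2, h3, h4⟩
    ext i j
    fin_cases i <;> fin_cases j <;> assumption

theorem SL2.mul_apply (A B : SL(2, ℤ)) (i j : Fin 2) :
    (A * B) i j = A i 0 * B 0 j + A i 1 * B 1 j := by
  change (A.1 * B.1) i j = _
  rw [Matrix.mul_apply, Fin.sum_univ_two]

theorem matT_braid : matT * matL * matT = matL * matT * matL := by decide

/-- The ping-pong generators. -/
def sanovGen (b : Bool) : SL(2, ℤ) := bif b then matT ^ 2 else matL ^ 2

theorem matT_sq_mul (A : SL(2, ℤ)) (j : Fin 2) :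
    (matT ^ 2 * A) 0 j = A 0 j + 2 * A 1 j ∧ (matT ^ 2 * A) 1 j = A 1 j := by
  have h : matT ^ 2 = ⟨!![1, 2; 0, 1], by simp [Matrix.det_fin_two]⟩ :=
    (SL2.ext_iff _ _).mpr (by decide)
  rw [SL2.mul_apply, SL2.mul_apply, h]
  constructor <;> simp

theorem matT_sq_inv_mul (A : SL(2, ℤ)) (j : Fin 2) :
    ((matT ^ 2)⁻¹ * A) 0 j = A 0 j - 2 * A 1 j ∧ ((matT ^ 2)⁻¹ * A) 1 j = A 1 j := by
  obtain ⟨h1, h2⟩ := matT_sq_mul ((matT ^ 2)⁻¹ * A) j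
  rw [mul_inv_cancel_left] at h1 h2
  constructor <;> linarith

theorem matL_sq_mul (A : SL(2, ℤ)) (j : Fin 2) :
    (matL ^ 2 * A) 0 j = A 0 j ∧ (matL ^ 2 * A) 1 j = A 1 j - 2 * A 0 j := by
  have h : matL ^ 2 = ⟨!![1, 0; -2, 1], by simp [Matrix.det_fin_two]⟩ :=
    (SL2.ext_iff _ _).mpr (by decide)
  rw [SL2.mul_apply, SL2.mul_apply, h]
  constructor
  · simp
  · simp; ring

theorem matL_sq_inv_mul (A : SL(2, ℤ)) (j : Fin 2) :
    ((matL ^ 2)⁻¹ * A) 0 j = A 0 j ∧ ((matL ^ 2)⁻¹ * A) 1 j = A 1 j + 2 * A 0 j := by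
  obtain ⟨h1, h2⟩ := matL_sq_mul ((matL ^ 2)⁻¹ * A) j
  rw [mul_inv_cancel_left] at h1 h2
  constructor <;> linarith

/-- The target of the positive powers of a ping-pong generator, in terms of the slope of the
first column. -/
def pingSet (b : Bool) : Set SL(2, ℤ) :=
  bif b then {A | A 1 0 ≠ 0 ∧ A 1 0 ^ 2 ≤ A 0 0 * A 1 0}
  else {A | A 0 0 ≠ 0 ∧ A 0 0 * A 1 0 ≤ -A 0 0 ^ 2}

/-- The target of the negative powers of a ping-pong generator. -/
def pongSet (b : Bool) : Set SL(2, ℤ) :=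
  bif b then {A | A 0 0 * A 1 0 < -A 1 0 ^ 2 ∨ A 1 0 = 0}
  else {A | A 0 0 ^ 2 < A 0 0 * A 1 0 ∨ A 0 0 = 0}

theorem lift_sanovGen_injective : Function.Injective (FreeGroup.lift sanovGen) := by
  refine FreeGroup.injective_lift_of_ping_pong sanovGen pingSet pongSet ?_ ?_ ?_ ?_ ?_ ?_
  · rintro (_ | _)
    · exact ⟨⟨!![1, 0; -1, 1], by simp⟩, by decide, by decide⟩
    · exact ⟨⟨!![1, 0; 1, 1], by simp⟩, by decide, by decide⟩
  · have key : Disjoint (pingSet true) (pingSet false) := by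
      rw [Set.disjoint_left]
      rintro A ⟨h1, h2⟩ ⟨h3, h4⟩
      have := sq_pos_of_ne_zero h1
      have := sq_pos_of_ne_zero h3
      linarith
    rintro (_ | _) (_ | _) h
    · exact absurd rfl h
    · exact key.symm
    · exact key
    · exact absurd rfl h
  · have key : Disjoint (pongSet true) (pongSet false) := by
      rw [Set.disjoint_left]
      rintro A h1 h2
      have := SL2.det_eq A
      rcases h1 with h1 | h1 <;> rcases h2 with h2 | h2
      · nlinarith
      · rw [h2] at h1; nlinarith
      · rw [h1] at h2; nlinarith
      · rw [h1, h2] at this; simp at this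
    rintro (_ | _) (_ | _) h
    · exact absurd rfl h
    · exact key.symm
    · exact key
    · exact absurd rfl h
  · rintro (_ | _) (_ | _) <;> rw [Set.disjoint_left] <;> rintro A ⟨h1, h2⟩ (h3 | h3)
    · nlinarith
    · exact h1 h3
    · nlinarith [sq_nonneg (A 0 0 + A 1 0)]
    · rw [h3] at h2; have := sq_pos_of_ne_zero h1; nlinarith
    · nlinarith [sq_nonneg (A 0 0 - A 1 0)]
    · rw [h3] at h2; have := sq_pos_of_ne_zero h1; nlinarith
    · nlinarith
    · exact h1 h3
  · rintro (_ | _) _ ⟨A, hA, rfl⟩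
    · obtain ⟨e1, e2⟩ := matL_sq_mul A 0
      change ¬ (_ ∨ _) at hA
      change (matL ^ 2 * A) 0 0 ≠ 0 ∧ (matL ^ 2 * A) 0 0 * (matL ^ 2 * A) 1 0 ≤
        -(matL ^ 2 * A) 0 0 ^ 2
      rw [e1, e2]
      push Not at hA
      exact ⟨hA.2, by nlinarith [hA.1]⟩
    · obtain ⟨e1, e2⟩ := matT_sq_mul A 0
      change ¬ (_ ∨ _) at hA
      change (matT ^ 2 * A) 1 0 ≠ 0 ∧ (matT ^ 2 * A) 1 0 ^ 2 ≤
        (matT ^ 2 * A) 0 0 * (matT ^ 2 * A) 1 0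
      rw [e1, e2]
      push Not at hA
      exact ⟨hA.2, by nlinarith [hA.1]⟩
  · rintro (_ | _) _ ⟨A, hA, rfl⟩
    · obtain ⟨e1, e2⟩ := matL_sq_inv_mul A 0
      change ¬ (_ ∧ _) at hA
      change ((matL ^ 2)⁻¹ * A) 0 0 ^ 2 < ((matL ^ 2)⁻¹ * A) 0 0 * ((matL ^ 2)⁻¹ * A) 1 0 ∨
        ((matL ^ 2)⁻¹ * A) 0 0 = 0
      rw [e1, e2]
      by_cases h : A 0 0 = 0
      · exact Or.inr h
      · have : ¬ A 0 0 * A 1 0 ≤ -A 0 0 ^ 2 := fun h' => hA ⟨h, h'⟩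
        exact Or.inl (by nlinarith)
    · obtain ⟨e1, e2⟩ := matT_sq_inv_mul A 0
      change ¬ (_ ∧ _) at hA
      change ((matT ^ 2)⁻¹ * A) 0 0 * ((matT ^ 2)⁻¹ * A) 1 0 < -((matT ^ 2)⁻¹ * A) 1 0 ^ 2 ∨
        ((matT ^ 2)⁻¹ * A) 1 0 = 0
      rw [e1, e2]
      by_cases h : A 1 0 = 0
      · exact Or.inr h
      · have : ¬ A 1 0 ^ 2 ≤ A 0 0 * A 1 0 := fun h' => hA ⟨h, h'⟩
        exact Or.inl (by nlinarith)

theorem eq_one_of_lift_sanovGen {x : FreeGroup Bool}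
    (h : FreeGroup.lift sanovGen x = 1 ∨ FreeGroup.lift sanovGen x = -1) : x = 1 := by
  have h2 : FreeGroup.lift sanovGen (x ^ 2) = 1 := by
    rw [map_pow]; rcases h with h | h <;> rw [h] <;> decide
  have h3 : x ^ 2 = 1 := lift_sanovGen_injective (h2.trans (map_one _).symm)
  exact (pow_eq_one_iff_left two_ne_zero).mp h3

end Matrices

end

/-! ### Four punctures and `SL(2, ℤ)` -/

section

open FreeGroup (of)
open scoped MatrixGroups

section MatrixWords

variable {n m : ℕ} {S T : Finset ℕ} {w v u : FreeGroup ℕ}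

/-- The images of the half twists of four points in `SL(2, ℤ)`. -/
def matGen : ℕ → SL(2, ℤ)
  | 0 => matT
  | 1 => matL
  | 2 => matT
  | _ => 1

theorem matGen_braidSeq : BraidSeq 3 matGen := by
  refine ⟨fun i hi => ?_, fun i j h1 h2 => ?_⟩
  · have : i < 2 := by omega
    interval_cases i
    · exact matT_braid
    · exact matT_braid.symm
  · obtain ⟨rfl, rfl⟩ : i = 0 ∧ j = 2 := by omega
    exact Commute.refl matT

/-- The matrix of a word in the half twists of four points. -/
def mat : FreeGroup ℕ →* SL(2, ℤ) := FreeGroup.lift matGen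

@[simp] theorem mat_of (i : ℕ) : mat (of i) = matGen i := by simp [mat]

/-- The subgroup `{1, -1}`. -/
def pmOne : Subgroup SL(2, ℤ) where
  carrier := {A | A = 1 ∨ A = -1}
  one_mem' := Or.inl rfl
  mul_mem' := by rintro _ _ (rfl | rfl) (rfl | rfl) <;> simp
  inv_mem' := by rintro _ (rfl | rfl) <;> simp

theorem mem_pmOne {A : SL(2, ℤ)} : A ∈ pmOne ↔ A = 1 ∨ A = -1 := Iff.rfl

instance : pmOne.Normal where
  conj_mem := by
    rintro _ (rfl | rfl) g
    · left; simp
    · right; simp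

theorem mat_mem_pmOne (hw : w ∈ strands 4) (h : toMCG 4 w = 1) : mat w ∈ pmOne :=
  BraidSeq.lift_mem_of_toMCG_eq_one (n := 4) matGen_braidSeq
    (fun i _ => by rw [Subgroup.normalizer_eq_top]; trivial)
    (by simp only [seg, rseg, mul_one, one_mul, mem_pmOne]; decide)
    (by simp only [seg, one_mul, mem_pmOne]; decide) hw h

/-- Reduction modulo two. -/
abbrev modTwo : SL(2, ℤ) →* SL(2, ZMod 2) :=
  Matrix.SpecialLinearGroup.map (Int.castRingHom (ZMod 2))

theorem modTwo_mat (hw : w ∈ strands 4) (h : wperm w = 1) : modTwo (mat w) = 1 := by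
  have e : mat w = FreeGroup.lift matGen w := rfl
  have : modTwo (mat w) = FreeGroup.lift (fun i => modTwo (matGen i)) w := by
    have : modTwo.comp mat = FreeGroup.lift (fun i => modTwo (matGen i)) := by ext1; simp
    exact DFunLike.congr_fun this w
  rw [this]
  refine (matGen_braidSeq.map modTwo).lift_eq_one_of_sq (m := 4) (fun i hi => ?_) hw h
  have : i < 3 := by omega
  interval_cases i <;> decide

/-- The filled point pushing group as a free group of rank two. -/
def fillTwo : FreeGroup ℕ →* FreeGroup Bool :=
  FreeGroup.lift fun
    | 0 => (of false * of true)⁻¹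
    | 1 => of false
    | 2 => of true
    | _ => 1

theorem fillHom_three_eq (u : FreeGroup ℕ) :
    fillHom 3 u = FreeGroup.lift (fun b => bif b then of 2 else of 1) (fillTwo u) := by
  have : fillHom 3 = (FreeGroup.lift (fun b => bif b then of 2 else of 1)).comp fillTwo := by
    ext1 j
    match j with
    | 0 => simp [fillHom, fillTwo, seg]
    | 1 => simp [fillHom, fillTwo]
    | 2 => simp [fillHom, fillTwo]
    | j + 3 => simp [fillHom, fillTwo]
  exact DFunLike.congr_fun this u

theorem mk_mat_pushHom (u : FreeGroup ℕ) :
    (QuotientGroup.mk' pmOne) (matT⁻¹ * mat (pushHom of 4 u) * matT) =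
      QuotientGroup.mk' pmOne (FreeGroup.lift sanovGen (fillTwo u)) := by
  have : ((QuotientGroup.mk' pmOne).comp ((MulAut.conj matT⁻¹).toMonoidHom.comp
      (mat.comp (pushHom of 4)))) =
      (QuotientGroup.mk' pmOne).comp ((FreeGroup.lift sanovGen).comp fillTwo) := by
    ext1 j
    simp only [MonoidHom.comp_apply, pushHom_of, MulEquiv.coe_toMonoidHom, MulAut.conj_apply,
      inv_inv]
    match j with
    | 0 =>
      rw [mk'_eq_iff, mem_pmOne]
      simp [pushGen, rseg, fillTwo]
      decide
    | 1 =>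
      rw [mk'_eq_iff, mem_pmOne]
      simp [pushGen, rseg, fillTwo]
      decide
    | 2 =>
      rw [mk'_eq_iff, mem_pmOne]
      simp [pushGen, rseg, fillTwo]
      decide
    | j + 3 => simp [pushGen, fillTwo]
  have := DFunLike.congr_fun this u
  simpa using this

theorem toMCG_four_eq_one (hw : w ∈ strands 4) (hp : wperm w = 1) (h : mat w ∈ pmOne) :
    toMCG 4 w = 1 := by
  have h3 : w ∈ innerW 4 (Finset.range 3) := by
    rw [← toMCG_mem_pureN_iff (by simp) hw]
    exact ker_le_pureN_of_card (by omega) (by simp) (by simp) (by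
      rw [MonoidHom.mem_ker, mperm_toMCG w hw, hp])
  obtain ⟨u, hu⟩ := exists_toMCG_eq_pushHom (m := 4) (by omega)
    (toMCG_eq_one_of_mem_innerW le_rfl) h3
  rw [hu]
  apply toMCG_pushHom_eq_one (by omega)
  have h4 : mat (pushHom of 4 u) ∈ pmOne := by
    have : mat (w⁻¹ * pushHom of 4 u) ∈ pmOne :=
      mat_mem_pmOne (mul_mem (inv_mem hw) (pushHom_mem_strands 4 u))
        (by rw [map_mul, map_inv, hu, inv_mul_cancel])
    have := mul_mem h this
    rwa [← map_mul, mul_inv_cancel_left] at this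
  have h5 := mk_mat_pushHom u
  have h6 : matT⁻¹ * mat (pushHom of 4 u) * matT ∈ pmOne := by
    simpa using (inferInstance : pmOne.Normal).conj_mem _ h4 matT⁻¹
  rw [mk'_eq_iff] at h5
  have h7 := mul_mem (inv_mem h5) h6
  rw [mul_inv_rev, inv_inv, inv_mul_cancel_right] at h7
  rw [show (4 - 1 : ℕ) = 3 from rfl, fillHom_three_eq, eq_one_of_lift_sanovGen h7, map_one]

end MatrixWords

end

/-! ### Commuting matrices in `SL(2, ℤ)` -/

section

open FreeGroup (of)
open scoped MatrixGroups

namespace SL2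

theorem mul_comm_iff (A B : SL(2, ℤ)) : A * B = B * A ↔
    A 0 1 * B 1 0 = B 0 1 * A 1 0 ∧ (A 0 0 - A 1 1) * B 0 1 = (B 0 0 - B 1 1) * A 0 1 ∧
      (A 0 0 - A 1 1) * B 1 0 = (B 0 0 - B 1 1) * A 1 0 := by
  rw [ext_iff]
  simp only [mul_apply]
  constructor
  · rintro ⟨h1, h2, h3, h4⟩
    refine ⟨?_, ?_, ?_⟩ <;> linarith
  · rintro ⟨h1, h2, h3⟩
    refine ⟨?_, ?_, ?_, ?_⟩ <;> linarith

theorem notMem_pmOne {C : SL(2, ℤ)} (hC : C ∉ pmOne) :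
    C 0 1 ≠ 0 ∨ C 1 0 ≠ 0 ∨ C 0 0 - C 1 1 ≠ 0 := by
  by_contra! h
  obtain ⟨h1, h2, h3⟩ := h
  have h4 := det_eq C
  have h5 : C 0 0 = C 1 1 := by linarith
  rw [h1, h5, zero_mul, sub_zero] at h4
  apply hC
  rw [mem_pmOne, ext_iff, ext_iff, h1, h2, h5]
  rcases mul_self_eq_one_iff.mp h4 with h | h <;> rw [h]
  · left; simp
  · right; simp

theorem mul_comm_of_commute {A B C : SL(2, ℤ)} (hC : C ∉ pmOne) (hA : A * C = C * A)
    (hB : B * C = C * B) : A * B = B * A := by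
  rw [mul_comm_iff] at hA hB ⊢
  obtain ⟨a1, a2, a3⟩ := hA
  obtain ⟨b1, b2, b3⟩ := hB
  rcases notMem_pmOne hC with h | h | h
  · have h1 : A 0 1 * B 1 0 = B 0 1 * A 1 0 := mul_left_cancel₀ h (by
      linear_combination B 0 1 * a1 - A 0 1 * b1)
    refine ⟨h1, mul_left_cancel₀ h ?_, mul_left_cancel₀ h ?_⟩
    · linear_combination B 0 1 * a2 - A 0 1 * b2
    · linear_combination B 1 0 * a2 - A 1 0 * b2 + (C 0 0 - C 1 1) * h1
  · have h1 : A 0 1 * B 1 0 = B 0 1 * A 1 0 := mul_left_cancel₀ h (by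
      linear_combination B 1 0 * a1 - A 1 0 * b1)
    refine ⟨h1, mul_left_cancel₀ h ?_, mul_left_cancel₀ h ?_⟩
    · linear_combination B 0 1 * a3 - A 0 1 * b3 - (C 0 0 - C 1 1) * h1
    · linear_combination B 1 0 * a3 - A 1 0 * b3
  · refine ⟨mul_left_cancel₀ h ?_, mul_left_cancel₀ h ?_, mul_left_cancel₀ h ?_⟩
    · linear_combination -B 1 0 * a2 - (A 0 0 - A 1 1) * b1 + B 0 1 * a3
    · linear_combination (B 0 0 - B 1 1) * a2 - (A 0 0 - A 1 1) * b2
    · linear_combination (B 0 0 - B 1 1) * a3 - (A 0 0 - A 1 1) * b3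

theorem dvd_of_modTwo_eq {A B : SL(2, ℤ)} (h : modTwo A = modTwo B) (i j : Fin 2) :
    (2 : ℤ) ∣ B i j - A i j := by
  have h1 := congrArg (fun M : SL(2, ZMod 2) => M i j) h
  have h2 : ((A i j : ℤ) : ZMod 2) = (B i j : ℤ) := by simpa using h1
  exact (ZMod.intCast_eq_intCast_iff_dvd_sub _ _ 2).mp h2

theorem mul_comm_of_modTwo {A C : SL(2, ℤ)} (hC : modTwo C = 1)
    (h : A * C * A⁻¹ * C⁻¹ ∈ pmOne) : A * C = C * A := by
  rcases h with h | h
  · rwa [mul_inv_eq_one, mul_inv_eq_iff_eq_mul] at h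
  · exfalso
    rw [mul_inv_eq_iff_eq_mul, mul_inv_eq_iff_eq_mul, ext_iff] at h
    simp only [mul_apply, Matrix.SpecialLinearGroup.coe_neg, Matrix.neg_apply,
      Matrix.SpecialLinearGroup.coe_one, Matrix.one_apply] at h
    simp at h
    obtain ⟨h1, h2, h3, h4⟩ := h
    have hA := det_eq A
    have hC' := det_eq C
    have ht : 2 * (C 0 0 + C 1 1) = 0 := by
      linear_combination A 1 1 * h1 - A 0 1 * h3 - A 1 0 * h2 + A 0 0 * h4 -
        2 * (C 0 0 + C 1 1) * hA
    rw [← map_one modTwo] at hC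
    obtain ⟨p, hp⟩ := dvd_of_modTwo_eq hC 0 0
    obtain ⟨q, hq⟩ := dvd_of_modTwo_eq hC 0 1
    obtain ⟨r, hr⟩ := dvd_of_modTwo_eq hC 1 0
    obtain ⟨s, hs⟩ := dvd_of_modTwo_eq hC 1 1
    simp at hp hq hr hs
    rw [show C 0 0 = 1 - 2 * p by linarith, show C 1 1 = 1 - 2 * s by linarith,
      show C 0 1 = -(2 * q) by linarith, show C 1 0 = -(2 * r) by linarith] at hC'
    have h5 : p + s = 2 * (p * s) - 2 * (q * r) := by linarith
    omega

theorem trace_eq_zero {A : SL(2, ℤ)} (hA : A * A ∈ pmOne) (hA' : A ∉ pmOne) :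
    A 1 1 = -A 0 0 := by
  have h : A 0 1 * (A 0 0 + A 1 1) = 0 ∧ A 1 0 * (A 0 0 + A 1 1) = 0 ∧
      (A 0 0 - A 1 1) * (A 0 0 + A 1 1) = 0 := by
    rcases hA with h | h <;> rw [ext_iff] at h <;> simp only [mul_apply] at h <;> simp at h <;>
      obtain ⟨h1, h2, h3, h4⟩ := h <;> refine ⟨?_, ?_, ?_⟩ <;> linarith
  obtain ⟨h1, h2, h3⟩ := h
  have key : A 0 0 + A 1 1 = 0 := by
    rcases notMem_pmOne hA' with h | h | h
    · exact (mul_eq_zero.mp h1).resolve_left h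
    · exact (mul_eq_zero.mp h2).resolve_left h
    · exact (mul_eq_zero.mp h3).resolve_left h
  linarith

theorem false_of_trace_mul {a b c d e f τ : ℤ} (h1 : -a ^ 2 - b * c = 1) (h2 : -d ^ 2 - e * f = 1)
    (hτ : 2 * a * d + b * f + c * e = τ) (h : τ ^ 2 = 1) : False := by
  have e1 : (b * f) * (c * e) = (1 + a ^ 2) * (1 + d ^ 2) := by
    linear_combination -(e * f) * h1 + (1 + a ^ 2) * h2
  have e2 : (b * f + c * e) ^ 2 = (τ - 2 * a * d) ^ 2 := by rw [← hτ]; ring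
  nlinarith [sq_nonneg (b * f - c * e), sq_nonneg (τ * a + d), sq_nonneg (τ * a - d),
    sq_nonneg (a + d), sq_nonneg (a - d), sq_nonneg a, sq_nonneg d]

/-- Two elements of order four never satisfy the braid relation up to sign. -/
theorem false_of_braid {A B : SL(2, ℤ)} (hA : A * A ∈ pmOne) (hB : B * B ∈ pmOne)
    (hA' : A ∉ pmOne) (hB' : B ∉ pmOne) (hAB : A * B⁻¹ ∉ pmOne)
    (h : A * B * A * (B * A * B)⁻¹ ∈ pmOne) : False := by
  have tA := trace_eq_zero hA hA'
  have tB := trace_eq_zero hB hB'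
  have dA := det_eq A
  have dB := det_eq B
  rw [tA] at dA
  rw [tB] at dB
  set τ := 2 * A 0 0 * B 0 0 + A 0 1 * B 1 0 + A 1 0 * B 0 1 with hτ
  have hn : τ ^ 2 ≠ 1 := fun h => false_of_trace_mul (by linarith) (by linarith) hτ.symm h
  have h1 : τ - 1 ≠ 0 := fun e => hn (by rw [show τ = 1 by linarith]; norm_num)
  have h2 : τ + 1 ≠ 0 := fun e => hn (by rw [show τ = -1 by linarith]; norm_num)
  rcases h with h | h <;> rw [mul_inv_eq_iff_eq_mul, ext_iff] at h <;>
    simp only [mul_apply] at h <;> simp [tA, tB] at h <;> obtain ⟨e1, e2, e3, e4⟩ := h <;>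
    apply hAB
  · left
    have k1 := mul_left_cancel₀ h1 (b := A 0 0) (c := B 0 0)
      (by linear_combination e1 - B 0 0 * dA + A 0 0 * dB + (A 0 0 - B 0 0) * hτ)
    rw [mul_inv_eq_one, ext_iff, tA, tB, k1]
    refine ⟨rfl, mul_left_cancel₀ h1 ?_, mul_left_cancel₀ h1 ?_, rfl⟩
    · linear_combination e2 - B 0 1 * dA + A 0 1 * dB + (A 0 1 - B 0 1) * hτ
    · linear_combination e3 - B 1 0 * dA + A 1 0 * dB + (A 1 0 - B 1 0) * hτ
  · right
    have k1 := mul_left_cancel₀ h2 (b := A 0 0) (c := -B 0 0)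
      (by linear_combination e1 - B 0 0 * dA - A 0 0 * dB + (A 0 0 + B 0 0) * hτ)
    have k2 := mul_left_cancel₀ h2 (b := A 0 1) (c := -B 0 1)
      (by linear_combination e2 - B 0 1 * dA - A 0 1 * dB + (A 0 1 + B 0 1) * hτ)
    have k3 := mul_left_cancel₀ h2 (b := A 1 0) (c := -B 1 0)
      (by linear_combination e3 - B 1 0 * dA - A 1 0 * dB + (A 1 0 + B 1 0) * hτ)
    rw [mul_inv_eq_iff_eq_mul, ext_iff]
    simp [tA, tB, k1, k2, k3]

end SL2

end

/-! ### Mapping classes filled in to four punctures -/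

section

open FreeGroup (of)
open scoped MatrixGroups

section Rep

variable {n : ℕ} {T : Finset ℕ} {w v u : FreeGroup ℕ} {g h p q s t : SphereMCG n} {A B C : SL(2, ℤ)}

/-- `A` represents the mapping class `g` after filling in all punctures but the first four. -/
def IsRep (g : SphereMCG n) (A : SL(2, ℤ)) : Prop :=
  ∃ w ∈ strands 4, g * (toMCG n w)⁻¹ ∈ pureN n (Finset.range 4) ∧ mat w = A

theorem conj_toMCG_mem_pureN {m : ℕ} (hmn : m ≤ n) (hw : w ∈ strands m)
    (hx : h ∈ pureN n (Finset.range m)) :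
    toMCG n w * h * (toMCG n w)⁻¹ ∈ pureN n (Finset.range m) := by
  have := conj_mem_pureN (toMCG n w) hx
  rw [mperm_toMCG w (strands_mono hmn hw)] at this
  convert this using 1
  rw [range_map_wperm hw]

theorem IsRep.mul (hn : 4 ≤ n) (hg : IsRep g A) (hh : IsRep h B) : IsRep (g * h) (A * B) := by
  obtain ⟨w, hw, h1, rfl⟩ := hg
  obtain ⟨v, hv, h2, rfl⟩ := hh
  refine ⟨w * v, mul_mem hw hv, ?_, map_mul _ _ _⟩
  have := mul_mem h1 (conj_toMCG_mem_pureN hn hw h2)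
  rw [map_mul]
  convert this using 1
  group

theorem IsRep.inv (hn : 4 ≤ n) (hg : IsRep g A) : IsRep g⁻¹ A⁻¹ := by
  obtain ⟨w, hw, h1, rfl⟩ := hg
  refine ⟨w⁻¹, inv_mem hw, ?_, map_inv _ _⟩
  have := conj_toMCG_mem_pureN hn (inv_mem hw) (inv_mem h1)
  rw [map_inv] at this ⊢
  convert this using 1
  group

theorem exists_isRep (hn : 4 ≤ n) (hg : ∀ j, 4 ≤ j → j < n → mperm n g j = j) :
    ∃ A, IsRep g A := by
  obtain ⟨w, hw, -, h⟩ := exists_mul_inv_mem_pureN hn g hg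
  exact ⟨mat w, w, hw, h, rfl⟩

theorem exists_isRep_of_pure (hn : 4 ≤ n) (hg : mperm n g = 1) : ∃ A, IsRep g A :=
  exists_isRep hn fun j _ _ => by rw [hg]; rfl

theorem range_four_subset (hn : 4 ≤ n) : Finset.range 4 ⊆ Finset.range n := Finset.range_mono hn

theorem toMCG_mem_pureN_four_iff (hn : 4 ≤ n) (hw : w ∈ strands 4) :
    toMCG n w ∈ pureN n (Finset.range 4) ↔ toMCG 4 w = 1 := by
  rw [toMCG_mem_pureN_iff (range_four_subset hn) (strands_mono hn hw),
    innerW_congr hn subset_rfl hw]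
  exact ⟨toMCG_eq_one_of_mem_innerW (by omega) w,
    fun h => mem_innerW_of_toMCG_eq_one hw h subset_rfl⟩

theorem IsRep.mem_pmOne_of_mem (hn : 4 ≤ n) (hg : IsRep g A) (h : g ∈ pureN n (Finset.range 4)) :
    A ∈ pmOne := by
  obtain ⟨w, hw, h1, rfl⟩ := hg
  apply mat_mem_pmOne hw
  rw [← toMCG_mem_pureN_four_iff hn hw]
  have := mul_mem (inv_mem h1) h
  simpa using this

theorem IsRep.mem_of_mem_pmOne (hn : 4 ≤ n) (hg : IsRep g A) (hp : mperm n g = 1)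
    (h : A ∈ pmOne) : g ∈ pureN n (Finset.range 4) := by
  obtain ⟨w, hw, h1, rfl⟩ := hg
  have h2 : mperm n (g * (toMCG n w)⁻¹) = 1 := pureN_le_ker h1
  rw [map_mul, hp, one_mul, map_inv, inv_eq_one, mperm_toMCG w (strands_mono hn hw)] at h2
  have h3 := (toMCG_mem_pureN_four_iff hn hw).mpr (toMCG_four_eq_one hw h2 h)
  simpa using mul_mem h1 h3

theorem IsRep.modTwo_eq (hn : 4 ≤ n) (hg : IsRep g A) (hv : v ∈ strands 4)
    (h : mperm n g = wperm v) : modTwo A = modTwo (mat v) := by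
  obtain ⟨w, hw, h1, rfl⟩ := hg
  have h2 : mperm n (g * (toMCG n w)⁻¹) = 1 := pureN_le_ker h1
  rw [map_mul, h, map_inv, mperm_toMCG w (strands_mono hn hw), ← map_inv, ← map_mul] at h2
  have h3 := modTwo_mat (mul_mem hv (inv_mem hw)) h2
  rw [map_mul, map_mul, map_inv, map_inv, mul_inv_eq_one] at h3
  exact h3.symm

theorem IsRep.commute (hn : 4 ≤ n) (hq : IsRep q C) (hq1 : mperm n q = 1) (hg : IsRep g A)
    (h : g * q * g⁻¹ * q⁻¹ ∈ pureN n (Finset.range 4)) : A * C = C * A := by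
  apply SL2.mul_comm_of_modTwo
  · rw [hq.modTwo_eq hn (v := 1) (one_mem _) (by rw [hq1, map_one]), map_one, map_one]
  · exact IsRep.mem_pmOne_of_mem hn (((hg.mul hn hq).mul hn (hg.inv hn)).mul hn (hq.inv hn)) h

/-- Commuting with a nontrivial pure class makes representatives commute. -/
theorem IsRep.commute_of_commute (hn : 4 ≤ n) (hq1 : mperm n q = 1)
    (hq : q ∉ pureN n (Finset.range 4)) (hg : IsRep g A) (hh : IsRep h B)
    (h1 : g * q * g⁻¹ * q⁻¹ ∈ pureN n (Finset.range 4))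
    (h2 : h * q * h⁻¹ * q⁻¹ ∈ pureN n (Finset.range 4)) : A * B = B * A := by
  obtain ⟨C, hC⟩ := exists_isRep_of_pure hn hq1
  exact SL2.mul_comm_of_commute (fun h => hq (hC.mem_of_mem_pmOne hn hq1 h))
    (hC.commute hn hq1 hg h1) (hC.commute hn hq1 hh h2)

theorem IsRep.modTwo_swap (hn : 4 ≤ n) (hs : IsRep s A) (i : ℕ) (hi : i + 1 < 4)
    (h : mperm n s = Equiv.swap i (i + 1)) : modTwo A = modTwo (matGen i) := by
  rw [hs.modTwo_eq hn (of_mem_strands hi) (by rw [h, wperm_of]), mat_of]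

theorem swap_fixes (i : ℕ) (hi : i + 1 < 4) (h : mperm n s = Equiv.swap i (i + 1)) :
    ∀ j, 4 ≤ j → j < n → mperm n s j = j := fun j hj _ => by
  rw [h, Equiv.swap_apply_of_ne_of_ne] <;> omega

theorem false_of_commute_four (hn : 4 ≤ n) (hp : mperm n p = 1) (hp' : p ∉ pureN n (Finset.range 4))
    (hs : mperm n s = Equiv.swap 0 1) (ht : mperm n t = Equiv.swap 1 2)
    (h1 : s * p * s⁻¹ * p⁻¹ ∈ pureN n (Finset.range 4))
    (h2 : t * p * t⁻¹ * p⁻¹ ∈ pureN n (Finset.range 4)) : False := by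
  obtain ⟨A, hA⟩ := exists_isRep hn (swap_fixes 0 (by omega) hs)
  obtain ⟨B, hB⟩ := exists_isRep hn (swap_fixes 1 (by omega) ht)
  have h3 := congrArg modTwo (hA.commute_of_commute hn hp hp' hB h1 h2)
  rw [map_mul, map_mul, hA.modTwo_swap hn 0 (by omega) hs,
    hB.modTwo_swap hn 1 (by omega) ht, ← map_mul, ← map_mul] at h3
  revert h3
  decide

theorem commutator_mem_four (hn : 4 ≤ n) (hp : mperm n p = 1) (hq : mperm n q = 1)
    (hq' : q ∉ pureN n (Finset.range 4)) (hs : ∀ j, 4 ≤ j → j < n → mperm n s j = j)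
    (h1 : p * q * p⁻¹ * q⁻¹ ∈ pureN n (Finset.range 4))
    (h2 : s * q * s⁻¹ * q⁻¹ ∈ pureN n (Finset.range 4)) :
    s * p * s⁻¹ * p⁻¹ ∈ pureN n (Finset.range 4) := by
  obtain ⟨A, hA⟩ := exists_isRep hn hs
  obtain ⟨B, hB⟩ := exists_isRep_of_pure hn hp
  have h3 := hA.commute_of_commute hn hq hq' hB h2 h1
  refine IsRep.mem_of_mem_pmOne hn (((hA.mul hn hB).mul hn (hA.inv hn)).mul hn (hB.inv hn)) ?_ ?_
  · simp [hp]
  · rw [h3, mul_inv_cancel_right, mul_inv_cancel]; exact one_mem _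

theorem sq_notMem_four (hn : 4 ≤ n) (hs : mperm n s = Equiv.swap 0 1)
    (ht : mperm n t = Equiv.swap 1 2) (hst : s * t * s = t * s * t) :
    s ^ 2 ∉ pureN n (Finset.range 4) := fun h => by
  obtain ⟨A, hA⟩ := exists_isRep hn (swap_fixes 0 (by omega) hs)
  obtain ⟨B, hB⟩ := exists_isRep hn (swap_fixes 1 (by omega) ht)
  have mA := hA.modTwo_swap hn 0 (by omega) hs
  have mB := hB.modTwo_swap hn 1 (by omega) ht
  have hpm : ∀ C ∈ pmOne, modTwo C = 1 := by rintro _ (rfl | rfl) <;> decide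
  have hA2 : A * A ∈ pmOne := (hA.mul hn hA).mem_pmOne_of_mem hn (by rwa [← pow_two])
  have hABA := IsRep.mem_pmOne_of_mem hn (((hA.mul hn hB).mul hn hA).mul hn
    (((hB.mul hn hA).mul hn hB).inv hn)) (by rw [hst, mul_inv_cancel]; exact one_mem _)
  refine SL2.false_of_braid hA2 ?_ (fun h => ?_) (fun h => ?_) (fun h => ?_) hABA
  · have e : t * t = (s * t) * s ^ 2 * (s * t)⁻¹ := by
      have : t = (s * t) * s * (s * t)⁻¹ := by rw [hst]; group
      calc t * t = ((s * t) * s * (s * t)⁻¹) ^ 2 := by rw [← this, pow_two]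
        _ = _ := conj_pow
    obtain ⟨C, hC⟩ := exists_isRep_of_pure hn (pureN_le_ker h : mperm n (s ^ 2) = 1)
    have h4 := IsRep.mul hn (hB.mul hn hB) (((hA.mul hn hB).mul hn (hC.mul hn
      ((hA.mul hn hB).inv hn))).inv hn)
    have h5 := h4.mem_pmOne_of_mem hn (by
      rw [e, ← mul_assoc, mul_inv_cancel]; exact one_mem _)
    have h6 : A * B * (C * (A * B)⁻¹) ∈ pmOne := by
      simpa [mul_assoc] using (inferInstance : pmOne.Normal).conj_mem C (hC.mem_pmOne_of_mem hn h)
        (A * B)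
    have h7 := mul_mem h5 h6
    rwa [inv_mul_cancel_right] at h7
  · have := hpm _ h
    rw [mA] at this; revert this; decide
  · have := hpm _ h
    rw [mB] at this; revert this; decide
  · have := hpm _ h
    rw [map_mul, map_inv, mA, mB] at this; revert this; decide

/-! The same statements for an arbitrary set of four punctures. -/

theorem exists_mperm_normalize {k l m : ℕ} (hT : T ⊆ Finset.range n) (hc : T.card = 4) (hk : k ∈ T)
    (hl : l ∈ T) (hm : m ∈ T) (hkl : k ≠ l) (hkm : k ≠ m) (hlm : l ≠ m) :
    ∃ g : SphereMCG n, mperm n g 0 = k ∧ mperm n g 1 = l ∧ mperm n g 2 = m ∧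
      (Finset.range 4).map (mperm n g).toEmbedding = T := by
  obtain ⟨r, hr⟩ : ∃ r, r ∈ ((T.erase k).erase l).erase m := by
    rw [← Finset.Nonempty, ← Finset.card_pos, Finset.card_erase_of_mem, Finset.card_erase_of_mem,
      Finset.card_erase_of_mem, hc] <;> simp [*, Ne.symm]
  simp only [Finset.mem_erase] at hr
  obtain ⟨hrm, hrl, hrk, hr⟩ := hr
  let f : ℕ → ℕ := fun i => if i = 0 then k else if i = 1 then l else if i = 2 then m else r
  have h4n : 4 ≤ n := by simpa [hc] using Finset.card_le_card hT
  have hfT : ∀ i, f i ∈ T := fun i => by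
    dsimp only [f]; split_ifs <;> assumption
  obtain ⟨w, hw, h⟩ := exists_wperm_extending (n := n) (lo := 0) (k := 4) f (by
    intro i hi j hj e
    have hi : i < 4 := hi
    have hj : j < 4 := hj
    interval_cases i <;> interval_cases j <;> simp [f] at e ⊢ <;> omega)
    (fun i _ => Finset.mem_range.mp (hT (hfT i))) (by simp) h4n (by omega)
  have hg : mperm n (toMCG n w) = wperm w := mperm_toMCG w (strandsFrom_le _ _ hw)
  refine ⟨toMCG n w, ?_, ?_, ?_, ?_⟩
  · rw [hg, h 0 (by omega)]; rfl
  · rw [hg, h 1 (by omega)]; rfl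
  · rw [hg, h 2 (by omega)]; rfl
  · apply Finset.eq_of_subset_of_card_le
    · intro x hx
      obtain ⟨j, hj, rfl⟩ := Finset.mem_map.mp hx
      change mperm n (toMCG n w) j ∈ _
      rw [hg, h j (Finset.mem_range.mp hj)]
      exact hfT j
    · simp [hc]

theorem mperm_conj_swap {i j k l : ℕ} (hi : mperm n g i = k) (hj : mperm n g j = l)
    (hs : mperm n s = Equiv.swap k l) : mperm n (g⁻¹ * s * g) = Equiv.swap i j := by
  rw [map_mul, map_mul, map_inv, hs, ← hi, ← hj, Equiv.swap_apply_apply]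
  group

theorem conj_inv_mem_iff {U V : Finset ℕ} (h : U.map (mperm n g).toEmbedding = V) :
    g⁻¹ * s * g ∈ pureN n U ↔ s ∈ pureN n V := by
  subst h
  refine ⟨fun h => ?_, fun h => inv_conj_mem_pureN g h⟩
  have := conj_mem_pureN g h
  convert this using 1
  group

theorem false_of_commute {k l m : ℕ} (hT : T ⊆ Finset.range n) (hc : T.card = 4) (hk : k ∈ T)
    (hl : l ∈ T) (hm : m ∈ T) (hkl : k ≠ l) (hkm : k ≠ m) (hlm : l ≠ m)
    (hp : mperm n p = 1) (hp' : p ∉ pureN n T)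
    (hs : mperm n s = Equiv.swap k l) (ht : mperm n t = Equiv.swap l m)
    (h1 : s * p * s⁻¹ * p⁻¹ ∈ pureN n T) (h2 : t * p * t⁻¹ * p⁻¹ ∈ pureN n T) : False := by
  have hn : 4 ≤ n := by simpa [hc] using Finset.card_le_card hT
  obtain ⟨g, g0, g1, g2, g3⟩ := exists_mperm_normalize hT hc hk hl hm hkl hkm hlm
  have hconj : ∀ a b : SphereMCG n, g⁻¹ * a * g * (g⁻¹ * b * g) * (g⁻¹ * a * g)⁻¹ *
      (g⁻¹ * b * g)⁻¹ = g⁻¹ * (a * b * a⁻¹ * b⁻¹) * g := fun a b => by group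
  refine false_of_commute_four (p := g⁻¹ * p * g) hn (by simp [hp])
    ((conj_inv_mem_iff g3).not.mpr hp') (mperm_conj_swap g0 g1 hs) (mperm_conj_swap g1 g2 ht) ?_ ?_
  · rwa [hconj, conj_inv_mem_iff g3]
  · rwa [hconj, conj_inv_mem_iff g3]

theorem sq_notMem {k l m : ℕ} (hT : T ⊆ Finset.range n) (hc : T.card = 4) (hk : k ∈ T)
    (hl : l ∈ T) (hm : m ∈ T) (hkl : k ≠ l) (hkm : k ≠ m) (hlm : l ≠ m)
    (hs : mperm n s = Equiv.swap k l) (ht : mperm n t = Equiv.swap l m)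
    (hst : s * t * s = t * s * t) : s ^ 2 ∉ pureN n T := by
  have hn : 4 ≤ n := by simpa [hc] using Finset.card_le_card hT
  obtain ⟨g, g0, g1, g2, g3⟩ := exists_mperm_normalize hT hc hk hl hm hkl hkm hlm
  have h := sq_notMem_four hn (mperm_conj_swap g0 g1 hs) (mperm_conj_swap g1 g2 ht) (by
    have hconj : ∀ a b : SphereMCG n, g⁻¹ * a * g * (g⁻¹ * b * g) * (g⁻¹ * a * g) =
      g⁻¹ * (a * b * a) * g := fun a b => by group
    rw [hconj, hconj, hst])
  rwa [show (g⁻¹ * s * g) ^ 2 = g⁻¹ * s ^ 2 * g by simp only [pow_two]; group,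
    conj_inv_mem_iff g3] at h

theorem commutator_mem {k l m : ℕ} (hT : T ⊆ Finset.range n) (hc : T.card = 4) (hk : k ∈ T)
    (hl : l ∈ T) (hm : m ∈ T) (hkl : k ≠ l) (hkm : k ≠ m) (hlm : l ≠ m)
    (hp : mperm n p = 1) (hq : mperm n q = 1) (hq' : q ∉ pureN n T)
    (hs : ∀ j, j ∉ T → mperm n s j = j)
    (h1 : p * q * p⁻¹ * q⁻¹ ∈ pureN n T) (h2 : s * q * s⁻¹ * q⁻¹ ∈ pureN n T) :
    s * p * s⁻¹ * p⁻¹ ∈ pureN n T := by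
  have hn : 4 ≤ n := by simpa [hc] using Finset.card_le_card hT
  obtain ⟨g, -, -, -, g3⟩ := exists_mperm_normalize hT hc hk hl hm hkl hkm hlm
  have hconj : ∀ a b : SphereMCG n, g⁻¹ * a * g * (g⁻¹ * b * g) * (g⁻¹ * a * g)⁻¹ *
      (g⁻¹ * b * g)⁻¹ = g⁻¹ * (a * b * a⁻¹ * b⁻¹) * g := fun a b => by group
  have := commutator_mem_four (p := g⁻¹ * p * g) (q := g⁻¹ * q * g) (s := g⁻¹ * s * g) hn
    (by simp [hp]) (by simp [hq]) ((conj_inv_mem_iff g3).not.mpr hq') (fun j hj _ => by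
      have : mperm n g j ∉ T := fun h => by
        rw [← g3] at h
        have := (Finset.mem_map' _).mp (h : (mperm n g).toEmbedding j ∈ _)
        simp at this; omega
      rw [map_mul, map_mul, Equiv.Perm.mul_apply, Equiv.Perm.mul_apply, hs _ this, map_inv]
      exact (mperm n g).symm_apply_apply j)
    (by rwa [hconj, conj_inv_mem_iff g3]) (by rwa [hconj, conj_inv_mem_iff g3])
  rwa [hconj, conj_inv_mem_iff g3] at this

/-- A pure class commuting with powers of two adjacent half twists is trivial on four punctures. -/
theorem mem_pureN_of_commute_pow {k l m : ℕ} (hT : T ⊆ Finset.range n) (hc : T.card = 4)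
    (hk : k ∈ T)
    (hl : l ∈ T) (hm : m ∈ T) (hkl : k ≠ l) (hkm : k ≠ m) (hlm : l ≠ m)
    (hp : mperm n p = 1)
    (hs : mperm n s = Equiv.swap k l) (ht : mperm n t = Equiv.swap l m)
    (hst : s * t * s = t * s * t) {a b : ℕ} (ha : a ≠ 0) (hb : b ≠ 0)
    (h1 : p * (s ^ 2) ^ a * p⁻¹ * ((s ^ 2) ^ a)⁻¹ ∈ pureN n T)
    (h2 : p * (t ^ 2) ^ b * p⁻¹ * ((t ^ 2) ^ b)⁻¹ ∈ pureN n T) : p ∈ pureN n T := by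
  by_contra hp'
  have hn : 4 ≤ n := by simpa [hc] using Finset.card_le_card hT
  have key : ∀ {s : SphereMCG n} {i j : ℕ} {a : ℕ}, a ≠ 0 → i ∈ T → j ∈ T →
      mperm n s = Equiv.swap i j → s ^ 2 ∉ pureN n T →
      p * (s ^ 2) ^ a * p⁻¹ * ((s ^ 2) ^ a)⁻¹ ∈ pureN n T → s * p * s⁻¹ * p⁻¹ ∈ pureN n T := by
    intro s i j a ha hi hj hs hs2 h
    have hs1 : mperm n (s ^ 2) = 1 := by rw [map_pow, hs, pow_two, Equiv.swap_mul_self]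
    refine commutator_mem hT hc hk hl hm hkl hkm hlm (q := (s ^ 2) ^ a) hp
      (by rw [map_pow, hs1, one_pow]) (fun h => hs2 ?_) (fun x hx => ?_) h ?_
    · exact mem_pureN_of_zpow_mem hT (by omega) hs1 (k := a) (by exact_mod_cast ha)
        (by rwa [zpow_natCast])
    · rw [hs, Equiv.swap_apply_of_ne_of_ne]
      · rintro rfl; exact hx hi
      · rintro rfl; exact hx hj
    · have : Commute s ((s ^ 2) ^ a) := ((Commute.refl s).pow_right 2).pow_right a
      rw [this.eq, mul_inv_cancel_right, mul_inv_cancel]; exact one_mem _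
  refine false_of_commute hT hc hk hl hm hkl hkm hlm hp hp' hs ht
    (key ha hk hl hs (sq_notMem hT hc hk hl hm hkl hkm hlm hs ht hst) h1)
    (key hb hl hm ht (sq_notMem hT hc hm hl hk hlm.symm hkm.symm hkl.symm
      (by rw [ht, Equiv.swap_comm]) (by rw [hs, Equiv.swap_comm]) hst.symm) h2)

end Rep

end

/-! ### Winding numbers and involutions of the six-punctured sphere -/

section

open FreeGroup (of)

/-- The affine map on functions of pairs of punctures that records a half twist: it permutes the
pairs and adds one at the pair being twisted. -/
def windGen (i : ℕ) : Equiv.Perm (Sym2 ℕ → ZMod 4) where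
  toFun v e := (if e = s(i, i + 1) then 1 else 0) + v (e.map (Equiv.swap i (i + 1)))
  invFun v e := v (e.map (Equiv.swap i (i + 1))) - if e = s(i, i + 1) then 1 else 0
  left_inv v := by
    ext e
    induction e with | _ a b =>
    simp [Equiv.swap_apply_def]
    grind
  right_inv v := by
    ext e
    induction e with | _ a b =>
    simp [Equiv.swap_apply_def]
    grind

theorem windGen_apply (i : ℕ) (v : Sym2 ℕ → ZMod 4) (e : Sym2 ℕ) :
    windGen i v e = (if e = s(i, i + 1) then 1 else 0) + v (e.map (Equiv.swap i (i + 1))) := rfl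

theorem map_swap_map_swap (i j : ℕ) : Function.Involutive (Sym2.map (Equiv.swap i j)) := fun e => by
  induction e with | _ a b => simp

theorem ite_map_swap_eq (i j a b : ℕ) (e : Sym2 ℕ) :
    (if e.map (Equiv.swap i j) = s(a, b) then (1 : ZMod 4) else 0) =
      if e = s(Equiv.swap i j a, Equiv.swap i j b) then 1 else 0 := by
  congr 1
  rw [(map_swap_map_swap i j).eq_iff, Sym2.map_mk]

theorem windGen_braidSeq (N : ℕ) : BraidSeq N windGen := by
  refine ⟨fun i _ => ?_, fun i j hij _ => ?_⟩
  · ext v e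
    simp only [Equiv.Perm.mul_apply, windGen_apply, ite_map_swap_eq]
    have h1 : Equiv.swap i (i + 1) (i + 2) = i + 2 :=
      Equiv.swap_apply_of_ne_of_ne (by omega) (by omega)
    have h2 : Equiv.swap (i + 1) (i + 2) i = i :=
      Equiv.swap_apply_of_ne_of_ne (by omega) (by omega)
    have h3 := (braidSeq_swap (i + 2)).braid i (by omega)
    have h4 : ∀ x, Equiv.swap i (i + 1) (Equiv.swap (i + 1) (i + 2) (Equiv.swap i (i + 1) x)) =
      Equiv.swap (i + 1) (i + 2) (Equiv.swap i (i + 1) (Equiv.swap (i + 1) (i + 2) x)) :=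
      fun x => congrArg (· x) h3
    simp [Sym2.map_map, h1, h2, h4]
    ring
  · ext v e
    simp only [Equiv.Perm.mul_apply, windGen_apply, ite_map_swap_eq]
    have h1 : Equiv.swap i (i + 1) j = j := Equiv.swap_apply_of_ne_of_ne (by omega) (by omega)
    have h2 : Equiv.swap i (i + 1) (j + 1) = j + 1 :=
      Equiv.swap_apply_of_ne_of_ne (by omega) (by omega)
    have h3 : Equiv.swap j (j + 1) i = i := Equiv.swap_apply_of_ne_of_ne (by omega) (by omega)
    have h4 : Equiv.swap j (j + 1) (i + 1) = i + 1 :=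
      Equiv.swap_apply_of_ne_of_ne (by omega) (by omega)
    have h5 := (braidSeq_swap (j + 1)).comm i j hij (by omega)
    have h6 : ∀ x, Equiv.swap i (i + 1) (Equiv.swap j (j + 1) x) =
      Equiv.swap j (j + 1) (Equiv.swap i (i + 1) x) := fun x => congrArg (· x) h5.eq
    simp [Sym2.map_map, h1, h2, h3, h4, h6]
    ring

/-- The action of words in half twists on functions of pairs of punctures. -/
def wind : FreeGroup ℕ →* Equiv.Perm (Sym2 ℕ → ZMod 4) := FreeGroup.lift windGen

theorem wind_apply (w : FreeGroup ℕ) : ∀ v e,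
    wind w v e = wind w 0 e + v (e.map (wperm w).symm) := by
  induction w using FreeGroup.induction_on with
  | C1 =>
    intro v e
    have : Sym2.map (wperm 1).symm e = e := by
      rw [map_one]; induction e with | _ a b => rfl
    rw [this]; simp
  | of i => intro v e; simp [wind, windGen_apply, wperm_of]
  | inv_of i _ =>
    intro v e
    have h1 : ∀ v e, (windGen i)⁻¹ v e = v (e.map (Equiv.swap i (i + 1))) -
      if e = s(i, i + 1) then 1 else 0 := fun _ _ => rfl
    have h2 : (Equiv.swap i (i + 1))⁻¹.symm = Equiv.swap i (i + 1) := rfl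
    simp only [wind, map_inv, FreeGroup.lift_apply_of, wperm_of, h1, h2]
    simp
    ring
  | mul x y hx hy =>
    intro v e
    simp only [map_mul, Equiv.Perm.mul_apply]
    rw [hx, hx (wind y 0), hy, Sym2.map_map]
    rw [add_assoc]
    rfl

/-- The values that the winding numbers of trivial mapping classes of the six-punctured sphere
can take. -/
def IsSphereWind (x : Sym2 ℕ → ZMod 4) : Prop :=
  ∃ (c : ℕ → ZMod 4) (d : ZMod 4), ∀ a b, a ≠ b → a < 6 → b < 6 → x s(a, b) = 2 * (c a + c b + d)

def sphereWind : Subgroup (Equiv.Perm (Sym2 ℕ → ZMod 4)) where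
  carrier := {f | ∃ x, IsSphereWind x ∧ ∀ v, f v = x + v}
  one_mem' := ⟨0, ⟨0, 0, by simp⟩, by simp⟩
  mul_mem' := by
    rintro f g ⟨x, ⟨c, d, hx⟩, hf⟩ ⟨y, ⟨c', d', hy⟩, hg⟩
    refine ⟨x + y, ⟨c + c', d + d', fun a b h ha hb => ?_⟩, fun v => ?_⟩
    · simp only [Pi.add_apply, hx a b h ha hb, hy a b h ha hb]; ring
    · rw [Equiv.Perm.mul_apply, hg, hf, add_assoc]
  inv_mem' := by
    rintro f ⟨x, ⟨c, d, hx⟩, hf⟩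
    refine ⟨-x, ⟨-c, -d, fun a b h ha hb => ?_⟩, fun v => ?_⟩
    · simp only [Pi.neg_apply, hx a b h ha hb]; ring
    · rw [Equiv.Perm.inv_eq_iff_eq, hf]; simp

theorem windGen_mem_normalizer {i : ℕ} (hi : i + 1 < 6) :
    windGen i ∈ Subgroup.normalizer (sphereWind : Set (Equiv.Perm (Sym2 ℕ → ZMod 4))) := by
  have key : ∀ f ∈ sphereWind, windGen i * f * (windGen i)⁻¹ ∈ sphereWind ∧
      (windGen i)⁻¹ * f * windGen i ∈ sphereWind := by
    rintro f ⟨x, ⟨c, d, hx⟩, hf⟩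
    have hlt : ∀ a, a < 6 → Equiv.swap i (i + 1) a < 6 := fun a ha => by
      rw [Equiv.swap_apply_def]; split_ifs <;> omega
    have hy : IsSphereWind fun e => x (e.map (Equiv.swap i (i + 1))) :=
      ⟨c ∘ Equiv.swap i (i + 1), d, fun a b h ha hb => by
        simpa using hx _ _ (by simpa using h) (hlt a ha) (hlt b hb)⟩
    refine ⟨⟨_, hy, fun v => ?_⟩, ⟨_, hy, fun v => ?_⟩⟩
    · obtain ⟨v, rfl⟩ := (windGen i).surjective v
      ext e
      simp only [Equiv.Perm.mul_apply, Equiv.Perm.inv_def, Equiv.symm_apply_apply, hf,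
        windGen_apply, Pi.add_apply]
      ring
    · rw [Equiv.Perm.mul_apply, Equiv.Perm.mul_apply, hf, Equiv.Perm.inv_eq_iff_eq]
      ext e
      simp only [windGen_apply, Pi.add_apply]
      rw [map_swap_map_swap]
      ring
  rw [Subgroup.mem_normalizer_iff]
  refine fun f => ⟨fun h => (key f h).1, fun h => ?_⟩
  have := (key _ h).2
  simpa [mul_assoc] using this

theorem windGen_relators : IsSphereWind ((seg windGen 0 5 * rseg windGen 0 5) 0) ∧
    IsSphereWind ((seg windGen 0 5 ^ 6) 0) := by
  refine ⟨⟨fun a => if a = 0 then 1 else 0, 0, ?_⟩, ⟨0, 1, ?_⟩⟩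
  · have : ∀ a < 6, ∀ b < 6, a ≠ b → (seg windGen 0 5 * rseg windGen 0 5) 0 s(a, b) =
      2 * ((if a = 0 then 1 else 0) + (if b = 0 then 1 else 0) + 0) := by decide +kernel
    exact fun a b h ha hb => this a ha b hb h
  · have : ∀ a < 6, ∀ b < 6, a ≠ b → (seg windGen 0 5 ^ 6) 0 s(a, b) = 2 * (0 + 0 + 1) := by
      decide +kernel
    exact fun a b h ha hb => this a ha b hb h

theorem mem_sphereWind {w : FreeGroup ℕ} (hw : wperm w = 1) (h : IsSphereWind (wind w 0)) :
    wind w ∈ sphereWind := by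
  refine ⟨_, h, fun v => ?_⟩
  ext e
  rw [wind_apply, hw, Pi.add_apply]
  congr 2
  induction e with | _ a b => rfl

theorem cast_wind (w : FreeGroup ℕ) : ∀ a b, a ≠ b →
    ZMod.castHom (show 2 ∣ 4 by norm_num) (ZMod 2) (wind w 0 s(a, b)) =
      (if a < b then 1 else 0) + if (wperm w).symm a < (wperm w).symm b then 1 else 0 := by
  have h2 : ∀ x : ZMod 2, x + x = 0 := by decide
  induction w using FreeGroup.induction_on with
  | C1 =>
    intro a b _
    have : (1 : Equiv.Perm ℕ).symm = 1 := rfl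
    simp [this, h2]
  | of i =>
    intro a b h
    simp only [wind, FreeGroup.lift_apply_of, windGen_apply, wperm_of, Equiv.symm_swap,
      Equiv.swap_apply_def, Sym2.eq_iff]
    split_ifs <;> first | omega | simp [h2]
  | inv_of i ih =>
    intro a b h
    have h1 : wind (of i) (wind (of i)⁻¹ 0) s(a, b) = 0 := by simp
    rw [wind_apply, Sym2.map_mk, wperm_of, Equiv.symm_swap] at h1
    have h3 := ih (Equiv.swap i (i + 1) a) (Equiv.swap i (i + 1) b) (by simpa using h)
    have h4 : wind (of i)⁻¹ 0 s(a, b) = - wind (of i) 0 s(Equiv.swap i (i + 1) a,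
        Equiv.swap i (i + 1) b) := by
      have h1 : wind (of i) (wind (of i)⁻¹ 0) s(Equiv.swap i (i + 1) a,
          Equiv.swap i (i + 1) b) = 0 := by
        simp
      rw [wind_apply, Sym2.map_mk, wperm_of, Equiv.symm_swap] at h1
      simp only [Equiv.swap_apply_self] at h1
      linear_combination h1
    have h5 : (Equiv.swap i (i + 1))⁻¹.symm = Equiv.swap i (i + 1) := rfl
    rw [h4, map_neg, h3]
    simp only [map_inv, wperm_of, h5, Equiv.symm_swap, Equiv.swap_apply_self]
    split_ifs <;> decide
  | mul x y hx hy =>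
    intro a b h
    have h1 : ∀ c, (wperm (x * y)).symm c = (wperm y).symm ((wperm x).symm c) := fun c => by
      rw [map_mul]; rfl
    rw [map_mul, Equiv.Perm.mul_apply, wind_apply, map_add, hx a b h, Sym2.map_mk,
      hy _ _ (by simpa using h), h1, h1]
    linear_combination h2 (if (wperm x).symm a < (wperm x).symm b then 1 else 0)

/-- No involution of the six-punctured sphere acts on the punctures as a transposition. -/
theorem mperm_ne_swap_of_sq_eq_one {g : SphereMCG 6} (hg : g ^ 2 = 1) {k l : ℕ} (hk : k < 6)
    (hl : l < 6) (hkl : k ≠ l) : mperm 6 g ≠ Equiv.swap k l := by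
  intro hp
  obtain ⟨b, hb, hbf⟩ := exists_wperm_extending (n := 6) (lo := 0) (k := 2)
    (fun i => if i = 0 then k else l)
    (by intro x hx y hy; simp at hx hy ⊢; split_ifs <;> intro <;> omega)
    (by intro i _; split_ifs <;> omega) (by simp) (by norm_num) (by norm_num)
  rw [strandsFrom_zero] at hb
  have h0 : mperm 6 (toMCG 6 b) 0 = k := by simpa [mperm_toMCG b hb] using hbf 0 (by norm_num)
  have h1 : mperm 6 (toMCG 6 b) 1 = l := by simpa [mperm_toMCG b hb] using hbf 1 (by norm_num)
  have hp' := mperm_conj_swap h0 h1 hp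
  obtain ⟨w, hw, hwg⟩ := exists_toMCG_eq ((toMCG 6 b)⁻¹ * g * toMCG 6 b)
  rw [← hwg, mperm_toMCG w hw] at hp'
  have hw2 : toMCG 6 (w ^ 2) = 1 := by
    rw [map_pow, hwg, pow_two]
    simp only [pow_two] at hg
    rw [show (toMCG 6 b)⁻¹ * g * toMCG 6 b * ((toMCG 6 b)⁻¹ * g * toMCG 6 b) =
      (toMCG 6 b)⁻¹ * (g * g) * toMCG 6 b by group, hg]
    group
  have hmem : wind (w ^ 2) ∈ sphereWind :=
    (windGen_braidSeq 5).lift_mem_of_toMCG_eq_one (n := 6)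
      (fun i hi => windGen_mem_normalizer hi)
      (by
        have := mem_sphereWind (w := seg of 0 5 * rseg of 0 5) (by
          rw [map_mul, map_seg, map_rseg]
          simp only [wperm_of]
          exact seg_mul_rseg_of_sq (fun i => by simp [pow_two]) _ _)
        simp only [wind, map_mul, map_seg, map_rseg, FreeGroup.lift_apply_of] at this
        exact this windGen_relators.1)
      (by
        have := mem_sphereWind (w := seg of 0 5 ^ 6) (by
          rw [map_pow, map_seg]
          simp only [wperm_of]
          exact seg_swap_pow 5)
        simp only [wind, map_pow, map_seg, FreeGroup.lift_apply_of] at this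
        exact this windGen_relators.2)
      (pow_mem hw 2) hw2
  obtain ⟨x, ⟨c, d, hx⟩, hx'⟩ := hmem
  have key : ∀ p q, p ≠ q → p < 6 → q < 6 → wind w 0 s(p, q) +
      wind w 0 s(Equiv.swap 0 1 p, Equiv.swap 0 1 q) = 2 * (c p + c q + d) := by
    intro p q h hp hq
    rw [← hx p q h hp hq, ← add_zero x, ← hx' 0, pow_two, map_mul, Equiv.Perm.mul_apply,
      wind_apply w (wind w 0), Sym2.map_mk, hp', Equiv.symm_swap]
  have hodd : ∀ y : ZMod 4, ZMod.castHom (show 2 ∣ 4 by norm_num) (ZMod 2) y = 1 → 2 * y = 2 := by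
    decide
  have heven : ∀ y : ZMod 4, ZMod.castHom (show 2 ∣ 4 by norm_num) (ZMod 2) y = 0 → 2 * y = 0 := by
    decide
  have hc := cast_wind w
  rw [hp', Equiv.symm_swap] at hc
  have e01 := hodd _ (by rw [hc 0 1 (by decide)]; decide)
  have e02 := heven _ (by rw [hc 0 2 (by decide)]; decide)
  have e12 := heven _ (by rw [hc 1 2 (by decide)]; decide)
  have e23 := heven _ (by rw [hc 2 3 (by decide)]; decide)
  have e24 := heven _ (by rw [hc 2 4 (by decide)]; decide)
  have e34 := heven _ (by rw [hc 3 4 (by decide)]; decide)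
  have k01 := key 0 1 (by decide) (by decide) (by decide)
  have k02 := key 0 2 (by decide) (by decide) (by decide)
  have k12 := key 1 2 (by decide) (by decide) (by decide)
  have k23 := key 2 3 (by decide) (by decide) (by decide)
  have k24 := key 2 4 (by decide) (by decide) (by decide)
  have k34 := key 3 4 (by decide) (by decide) (by decide)
  simp only [show Equiv.swap 0 1 0 = 1 from rfl, show Equiv.swap 0 1 1 = 0 from rfl,
    show Equiv.swap 0 1 2 = 2 from rfl, show Equiv.swap 0 1 3 = 3 from rfl,
    show Equiv.swap 0 1 4 = 4 from rfl, Sym2.eq_swap (a := 1) (b := 0)] at k01 k02 k12 k23 k24 k34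
  have h4 : (4 : ZMod 4) = 0 := rfl
  have : (2 : ZMod 4) = 0 := by
    linear_combination -e01 - e02 - e12 - e23 - e24 - e34 + k01 + k02 + k12 + k23 + k24 + k34 +
      (c 0 + c 1 + 2 * c 2 + c 3 + c 4 + 3 * d) * h4
  exact absurd this (by decide)

end

/-! ### Involutions with small centralizers -/

section

open Equiv Nat

theorem eq_one_or_of_factorial_eq {n k : ℕ} (hn : 5 ≤ n) (hk : k ≠ 0) (hkn : 2 * k ≤ n)
    (h : (n - 2 * k)! * 2 ^ k * k ! = (n - 2)! * 2) : k = 1 ∨ n = 6 ∧ k = 3 := by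
  obtain ⟨r, rfl⟩ := Nat.exists_eq_add_of_le hkn
  rcases k with _ | _ | _ | _ | k
  · omega
  · left; rfl
  · exfalso
    simp only [show 2 * (0 + 1 + 1) + r - 2 * (0 + 1 + 1) = r by omega,
      show 2 * (0 + 1 + 1) + r - 2 = r + 2 by omega, Nat.factorial_succ] at h
    have := Nat.factorial_pos r
    norm_num at h
    have h4 : r ! * ((r + 2) * (r + 1)) = r ! * 4 := by nlinarith
    have h5 := Nat.eq_of_mul_eq_mul_left this h4
    nlinarith
  · right
    simp only [show 2 * (0 + 1 + 1 + 1) + r - 2 * (0 + 1 + 1 + 1) = r by omega,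
      show 2 * (0 + 1 + 1 + 1) + r - 2 = r + 4 by omega, Nat.factorial_succ] at h
    have := Nat.factorial_pos r
    norm_num at h
    have h4 : r ! * ((r + 4) * ((r + 3) * ((r + 2) * (r + 1)))) = r ! * 24 := by nlinarith
    have h5 := Nat.eq_of_mul_eq_mul_left this h4
    rcases Nat.eq_zero_or_pos r with rfl | hr
    · simp
    · exfalso
      have : 5 * (4 * (3 * 2)) ≤ (r + 4) * ((r + 3) * ((r + 2) * (r + 1))) := by gcongr <;> omega
      omega
  · exfalso
    have h1 : ∀ k, 2 ^ (k + 4) * (k + 4)! < (2 * (k + 4) - 2)! * 2 := by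
      intro k
      induction k with
      | zero => decide
      | succ k ih =>
        rw [show 2 * (k + 1 + 4) - 2 = 2 * (k + 4) - 2 + 1 + 1 by omega,
          Nat.factorial_succ (2 * (k + 4) - 2 + 1), Nat.factorial_succ (2 * (k + 4) - 2),
          show k + 1 + 4 = k + 4 + 1 by omega, Nat.factorial_succ (k + 4), pow_succ]
        calc _ = (2 * (k + 4 + 1)) * (2 ^ (k + 4) * (k + 4)!) := by ring
          _ < (2 * (k + 4 + 1)) * ((2 * (k + 4) - 2)! * 2) := by gcongr
          _ ≤ ((2 * (k + 4) - 2 + 1 + 1) * (2 * (k + 4) - 2 + 1)) * ((2 * (k + 4) - 2)! * 2) := by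
            refine Nat.mul_le_mul_right _ ?_
            have : 2 * (k + 4) - 2 = 2 * k + 6 := by omega
            rw [this]; nlinarith
          _ = _ := by ring
    have h2 := h1 k
    have h3 : r ! * (2 * (k + 4) - 2)! ≤ (2 * (k + 4) + r - 2)! := by
      have := Nat.factorial_mul_factorial_dvd_factorial_add r (2 * (k + 4) - 2)
      have := Nat.le_of_dvd (Nat.factorial_pos _) this
      convert this using 2; omega
    have h4 := Nat.factorial_pos r
    simp only [show k + 1 + 1 + 1 + 1 = k + 4 by omega] at h
    rw [Nat.add_sub_cancel_left] at h
    have : r ! * (2 ^ (k + 4) * (k + 4)!) < r ! * ((2 * (k + 4) - 2)! * 2) := by gcongr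
    nlinarith

theorem card_centralizer_replicate_two {n k : ℕ} (hk : k ≠ 0) {σ : Perm (Fin n)}
    (h : σ.cycleType = Multiset.replicate k 2) :
    2 * k ≤ n ∧ Nat.card (Subgroup.centralizer {σ}) = (n - 2 * k)! * 2 ^ k * k ! := by
  have h1 := σ.sum_cycleType_le
  have h2 := Equiv.Perm.nat_card_centralizer σ
  rw [h] at h1 h2
  simp only [Multiset.sum_replicate, smul_eq_mul, Fintype.card_fin, Multiset.prod_replicate,
    Multiset.toFinset_replicate, hk, if_false, Finset.prod_singleton,
        Multiset.count_replicate_self] at h1 h2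
  rw [mul_comm 2 k]
  exact ⟨h1, h2⟩

theorem card_centralizer_map {G : Type*} [Group G] (f : G ≃* G) (x : G) :
    Nat.card (Subgroup.centralizer {f x}) = Nat.card (Subgroup.centralizer {x}) := by
  refine (Nat.card_congr (f.toEquiv.subtypeEquiv fun y => ?_)).symm
  simp only [Subgroup.mem_centralizer_singleton_iff]
  change _ ↔ f y * f x = f x * f y
  rw [← map_mul, ← map_mul, f.injective.eq_iff]

theorem exists_cycleType_eq {n : ℕ} {σ : Perm (Fin n)} (h : σ ^ 2 = 1) (h1 : σ ≠ 1) :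
    ∃ k, k ≠ 0 ∧ σ.cycleType = Multiset.replicate k 2 := by
  have h2 : orderOf σ = 2 := orderOf_eq_prime h h1
  obtain ⟨k, hk⟩ := Equiv.Perm.cycleType_prime_order (by rw [h2]; exact Nat.prime_two)
  exact ⟨k + 1, by omega, by rw [hk, h2]⟩

theorem card_centralizer_eq_imp {n : ℕ} (hn : 5 ≤ n) {σ : Perm (Fin n)} (h : σ ^ 2 = 1) (h1 : σ ≠ 1)
    (hc : Nat.card (Subgroup.centralizer {σ}) = (n - 2)! * 2) :
    σ.IsSwap ∨ n = 6 ∧ σ.cycleType = Multiset.replicate 3 2 := by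
  obtain ⟨k, hk, hσ⟩ := exists_cycleType_eq h h1
  obtain ⟨h2, h3⟩ := card_centralizer_replicate_two hk hσ
  rcases eq_one_or_of_factorial_eq hn hk h2 (h3 ▸ hc) with rfl | ⟨h4, rfl⟩
  · left; rw [Equiv.Perm.isSwap_iff_cycleType]; exact hσ
  · exact Or.inr ⟨h4, hσ⟩

theorem isSwap_map_or {n : ℕ} (hn : 5 ≤ n) (f : Perm (Fin n) ≃* Perm (Fin n)) {σ c : Perm (Fin n)}
    (hσ : σ.IsSwap) (hc : n = 6 → c.cycleType = Multiset.replicate 3 2) :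
    (f σ).IsSwap ∨ n = 6 ∧ (f c).IsSwap := by
  have hσ' := Equiv.Perm.isSwap_iff_cycleType.mp hσ
  have h2 : σ ^ 2 = 1 := by obtain ⟨x, y, _, rfl⟩ := hσ; simp [pow_two]
  have h1 : σ ≠ 1 := by rintro rfl; simp at hσ'
  have hcard : Nat.card (Subgroup.centralizer {σ}) = (n - 2)! * 2 := by
    simpa using (card_centralizer_replicate_two one_ne_zero hσ').2
  rcases card_centralizer_eq_imp hn (by rw [← map_pow, h2, map_one]) (by simpa using h1)
    ((card_centralizer_map f σ).trans hcard) with h | ⟨h6, h⟩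
  · exact Or.inl h
  right
  refine ⟨h6, ?_⟩
  subst h6
  have hc := hc rfl
  have hc2 : c ^ 2 = 1 := by
    have : orderOf c = 2 := by rw [← Equiv.Perm.lcm_cycleType, hc]; rfl
    rw [← this, pow_orderOf_eq_one]
  have hc1 : c ≠ 1 := by rintro rfl; simp at hc
  rcases card_centralizer_eq_imp (σ := f c) hn (by rw [← map_pow, hc2,
      map_one]) (by simpa using hc1)
    ((card_centralizer_map f c).trans
      ((card_centralizer_replicate_two (by norm_num) hc).2.trans (by decide))) with h' | ⟨_, h'⟩
  · exact h'
  · exfalso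
    have hconj := Equiv.Perm.isConj_iff_cycleType_eq.mpr (h.trans h'.symm)
    have hconj' := f.symm.toMonoidHom.map_isConj hconj
    simp only [MulEquiv.coe_toMonoidHom, MulEquiv.symm_apply_apply] at hconj'
    have := Equiv.Perm.isConj_iff_cycleType_eq.mp hconj'
    rw [hσ', hc] at this
    exact absurd (congrArg Multiset.card this) (by simp)

end

/-! ### Braid relations between transpositions -/

section

open Equiv

section Chain

variable {G : Type*} [Group G] {t : ℕ → G} {N : ℕ}

theorem BraidSeq.ne_of_lt (h : BraidSeq N t) (h01 : t 0 ≠ t 1) (hN : 4 ≤ N) {i j : ℕ} (hij : i < j)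
    (hj : j < N) : t i ≠ t j := by
  intro he
  obtain rfl | hij' := Nat.eq_or_lt_of_le (Nat.succ_le_of_lt hij)
  · exact h.ne_succ h01 hj he
  obtain _ | i := i
  · obtain rfl | hj' : j = 2 ∨ 3 ≤ j := by omega
    · exact h.ne_succ h01 (i := 2) (by omega) (h.eq_of_commute (by omega)
        (he ▸ h.comm 0 3 (by omega) (by omega)))
    · obtain ⟨j, rfl⟩ : ∃ k, j = k + 1 := ⟨j - 1, by omega⟩
      exact h.ne_succ h01 hj (h.eq_of_commute hj (he ▸ h.comm 0 j (by omega) (by omega)).symm)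
  · exact h.ne_succ h01 (i := i) (by omega) (h.eq_of_commute (by omega)
      (he ▸ h.comm i j (by omega) (by omega)))

theorem commute_swap_iff {a b c d : ℕ} (hab : a ≠ b) (hcd : c ≠ d) :
    Commute (swap a b) (swap c d) ↔ (a ≠ c ∧ a ≠ d ∧ b ≠ c ∧ b ≠ d) ∨ swap a b = swap c d := by
  constructor
  · intro h
    by_contra! hne
    obtain ⟨h1, h2⟩ := hne
    have key : ∀ x, swap a b (swap c d x) = swap c d (swap a b x) := fun x => congrArg (· x) h.eq
    have ka := key a
    have kb := key b
    have kc := key c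
    have kd := key d
    simp only [swap_apply_left, swap_apply_right] at ka kb kc kd
    have h3 : ¬ (a = c ∧ b = d) := by rintro ⟨rfl, rfl⟩; exact h2 rfl
    have h4 : ¬ (a = d ∧ b = c) := by rintro ⟨rfl, rfl⟩; exact h2 (swap_comm _ _)
    simp only [swap_apply_def] at ka kb kc kd
    grind
  · rintro (⟨h1, h2, h3, h4⟩ | h)
    · exact (Perm.Disjoint.commute fun x => by
        by_cases hx : x = a ∨ x = b
        · right; rcases hx with rfl | rfl <;> exact swap_apply_of_ne_of_ne ‹_› ‹_›
        · left; push Not at hx; exact swap_apply_of_ne_of_ne hx.1 hx.2)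
    · rw [h]

theorem BraidSeq.exists_chain {r : ℕ → Perm ℕ} (h : BraidSeq N r) (h01 : r 0 ≠ r 1) (hN : 4 ≤ N)
    (hr : ∀ i < N, (r i).IsSwap) : ∃ a : ℕ → ℕ, Set.InjOn a (Set.Iic N) ∧
      ∀ i < N, r i = swap (a i) (a (i + 1)) := by
  have hnc : ∀ i, i + 1 < N → ¬ Commute (r i) (r (i + 1)) := fun i hi hc =>
    h.ne_succ h01 hi (h.eq_of_commute hi hc)
  suffices ∀ m, 2 ≤ m → m ≤ N → ∃ a : ℕ → ℕ, Set.InjOn a (Set.Iic m) ∧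
      ∀ i < m, r i = swap (a i) (a (i + 1)) from this N (by omega) le_rfl
  intro m hm
  induction m, hm using Nat.le_induction with
  | base =>
    intro _
    obtain ⟨a, b, hab, h0⟩ := hr 0 (by omega)
    obtain ⟨c, d, hcd, h1⟩ := hr 1 (by omega)
    have := hnc 0 (by omega)
    rw [zero_add, h0, h1, commute_swap_iff hab hcd] at this
    push Not at this
    obtain ⟨h2, h3⟩ := this
    have h5 : ¬ (a = c ∧ b = d) := by rintro ⟨rfl, rfl⟩; exact h3 rfl
    have h6 : ¬ (a = d ∧ b = c) := by rintro ⟨rfl, rfl⟩; exact h3 (swap_comm _ _)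
    obtain ⟨x, y, z, hxy, hyz, hxz, e0, e1⟩ : ∃ x y z : ℕ, x ≠ y ∧ y ≠ z ∧ x ≠ z ∧
        swap a b = swap x y ∧ swap c d = swap y z := by
      by_cases h7 : a = c
      · subst h7
        exact ⟨b, a, d, hab.symm, hcd, fun h => h5 ⟨rfl, h⟩, swap_comm _ _, rfl⟩
      by_cases h8 : a = d
      · subst h8
        exact ⟨b, a, c, hab.symm, hcd.symm, fun h => h6 ⟨rfl, h⟩, swap_comm _ _, swap_comm _ _⟩
      by_cases h9 : b = c
      · subst h9
        exact ⟨a, b, d, hab, hcd, h8, rfl, rfl⟩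
      · have := h2 h7 h8 h9
        subst this
        exact ⟨a, b, c, hab, hcd.symm, h7, rfl, swap_comm _ _⟩
    refine ⟨fun i => if i = 0 then x else if i = 1 then y else z, ?_, fun i hi => ?_⟩
    · intro i hi j hj
      simp only [Set.mem_Iic] at hi hj
      dsimp only
      split_ifs <;> intro <;> omega
    · interval_cases i
      · simp [h0, e0]
      · simp [h1, e1]
  | succ m hm ih =>
    intro hmN
    obtain ⟨a, ha, hra⟩ := ih (by omega)
    obtain ⟨c, d, hcd, hc⟩ := hr m (by omega)
    obtain ⟨m, rfl⟩ : ∃ k, m = k + 2 := ⟨m - 2, by omega⟩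
    have hinj : ∀ i j, i ≤ m + 2 → j ≤ m + 2 → i ≠ j → a i ≠ a j := fun i j hi hj hij he =>
      hij (ha hi hj he)
    have h1 := hnc (m + 1) (by omega)
    have h2 := h.comm m (m + 2) (by omega) (by omega)
    have h3 := h.ne_of_lt h01 hN (i := m) (j := m + 2) (by omega) (by omega)
    rw [hra m (by omega), hc, commute_swap_iff (hinj _ _ (by omega) (by omega)
        (by omega)) hcd] at h2
    rw [hra m (by omega), hc] at h3
    rw [hra (m + 1) (by omega), hc,
      commute_swap_iff (hinj _ _ (by omega) (by omega) (by omega)) hcd] at h1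
    obtain ⟨g1, g2, g3, g4⟩ := h2.resolve_right h3
    push Not at h1
    obtain ⟨x, hx, hx'⟩ : ∃ x, a (m + 2) ≠ x ∧ swap c d = swap (a (m + 2)) x := by
      have := h1.1 g3 g4
      by_cases h : a (m + 1 + 1) = c
      · exact ⟨d, h ▸ hcd, by rw [← h]⟩
      · exact ⟨c, h, by rw [← this h]; exact swap_comm _ _⟩
    have hxa : ∀ i ≤ m + 2, a i ≠ x := by
      rintro i hi rfl
      obtain rfl | rfl | hi : i = m + 2 ∨ i = m + 1 ∨ i ≤ m := by omega
      · exact hx rfl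
      · exact h1.2 (by rw [hx']; exact swap_comm _ _)
      · have h4 := h.comm i (m + 2) (by omega) (by omega)
        have h5 := h.ne_of_lt h01 hN (i := i) (j := m + 2) (by omega) (by omega)
        rw [hc, hx'] at h4 h5
        rw [hra i (by omega)] at h4 h5
        rw [commute_swap_iff (hinj _ _ (by omega) (by omega) (by omega)) hx] at h4
        exact (h4.resolve_right h5).2.1 rfl
    refine ⟨fun i => if i ≤ m + 2 then a i else x, fun i hi j hj => ?_, fun i hi => ?_⟩
    · simp only [Set.mem_Iic] at hi hj
      dsimp only
      split_ifs with h1 h2 h2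
      · exact fun he => ha h1 h2 he
      · exact fun he => absurd he (hxa i h1)
      · exact fun he => absurd he.symm (hxa j h2)
      · omega
    · obtain rfl | hi : i = m + 2 ∨ i < m + 2 := by omega
      · simp [hc, hx']
      · simp [hra i hi, hi.le, Nat.succ_le_of_lt hi]

end Chain

end

/-! ### The permutation action of an injective endomorphism -/

section

open FreeGroup (of)
open Equiv

section

variable {n : ℕ}

theorem mperm_apply_of_le (g : SphereMCG n) {j : ℕ} (hj : n ≤ j) : mperm n g j = j := by
  obtain ⟨w, hw, rfl⟩ := exists_toMCG_eq g
  rw [mperm_toMCG w hw, wperm_apply_of_le hj w hw]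

theorem mperm_apply_lt (g : SphereMCG n) {j : ℕ} (hj : j < n) : mperm n g j < n := by
  by_contra! h
  have := (mperm n g).injective (mperm_apply_of_le g h)
  omega

/-- The permutation of the `n` punctures induced by a mapping class. -/
def fperm (n : ℕ) : SphereMCG n →* Perm (Fin n) where
  toFun g := ⟨fun j => ⟨mperm n g j, mperm_apply_lt g j.2⟩,
    fun j => ⟨mperm n g⁻¹ j, mperm_apply_lt g⁻¹ j.2⟩,
    fun j => Fin.ext (by simp),
    fun j => Fin.ext (by simp)⟩
  map_one' := by ext j; simp
  map_mul' g h := by ext j; simp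

theorem coe_fperm_apply (g : SphereMCG n) (j : Fin n) : (fperm n g j : ℕ) = mperm n g j := rfl

theorem fperm_eq_one_iff {g : SphereMCG n} : fperm n g = 1 ↔ mperm n g = 1 := by
  constructor
  · intro h
    ext j
    rcases Nat.lt_or_ge j n with hj | hj
    · rw [← coe_fperm_apply g ⟨j, hj⟩, h]; rfl
    · exact mperm_apply_of_le g hj
  · intro h
    ext j
    rw [coe_fperm_apply, h]; rfl

theorem isSwap_fperm_iff {g : SphereMCG n} {k l : Fin n} :
    fperm n g = swap k l ↔ mperm n g = swap (k : ℕ) l := by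
  have h : ∀ j : Fin n, ((swap k l j : Fin n) : ℕ) = swap (k : ℕ) l j := fun j => by
    simp only [swap_apply_def, Fin.ext_iff]; split_ifs <;> rfl
  constructor
  · intro hg
    ext j
    rcases Nat.lt_or_ge j n with hj | hj
    · rw [← coe_fperm_apply g ⟨j, hj⟩, hg, h]
    · rw [mperm_apply_of_le g hj, swap_apply_of_ne_of_ne] <;> omega
  · intro hg
    ext j
    rw [coe_fperm_apply, hg, h]

theorem fperm_surjective : Function.Surjective (fperm n) := by
  intro π
  obtain ⟨w, hw, h⟩ := exists_wperm_extending (n := n) (lo := 0) (k := n)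
    (fun i => if h : i < n then π ⟨i, h⟩ else i)
    (fun i hi j hj he => by
      simp only [Set.mem_Iio] at hi hj
      simp only [hi, hj, dif_pos, Fin.val_inj, EmbeddingLike.apply_eq_iff_eq] at he
      simpa using he)
    (fun i hi => by simp [hi]) (by simp) le_rfl (by simp)
  rw [strandsFrom_zero] at hw
  refine ⟨toMCG n w, ?_⟩
  ext j
  rw [coe_fperm_apply, mperm_toMCG w hw, h j j.2]
  simp

theorem isConj_sgen_zero {i : ℕ} (hi : i + 1 < n) : IsConj (sgen n 0) (sgen n i) := by
  rw [isConj_iff]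
  exact ⟨_, by simpa using (sgen_braidSeq n).pow_conj_seg (m := 0) (k := i) (by omega)⟩

theorem mperm_seg (n : ℕ) :
    mperm n (seg (sgen n) 0 (n - 1)) = seg (fun i => swap i (i + 1)) 0 (n - 1) := by
  rw [map_seg]
  exact seg_congr fun i hi hi' => mperm_sgen (by omega)

theorem mperm_seg_sq_ne_one (hn : 4 ≤ n) : mperm n (seg (sgen n) 0 (n - 1) ^ 2) ≠ 1 := by
  intro h
  rw [map_pow, mperm_seg] at h
  have h1 := congrArg (· 0) h
  rw [seg_swap_pow_apply _ _ _ (by omega) (by omega), if_pos (by omega)] at h1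
  simp at h1

theorem cycleType_fperm_seg_cube :
    (fperm 6 (seg (sgen 6) 0 (6 - 1) ^ 3)).cycleType = Multiset.replicate 3 2 := by
  have h : fperm 6 (seg (sgen 6) 0 (6 - 1) ^ 3) = Equiv.addRight (3 : Fin 6) := by
    ext j
    rw [coe_fperm_apply, map_pow, mperm_seg, seg_swap_pow_apply _ _ _ (by omega) (by omega)]
    revert j; decide
  rw [h]
  obtain ⟨k, hk, hσ⟩ := exists_cycleType_eq (σ := Equiv.addRight (3 : Fin 6)) (by decide)
      (by decide)
  have h2 := Perm.sum_cycleType (Equiv.addRight (3 : Fin 6))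
  rw [hσ, show (Equiv.addRight (3 : Fin 6)).support.card = 6 by decide] at h2
  simp at h2
  rw [hσ, show k = 3 by omega]

variable {ρ : SphereMCG n →* SphereMCG n}

theorem fperm_map_sgen_ne (hn : 5 ≤ n) (hρ : Function.Injective ρ) :
    fperm n (ρ (sgen n 0)) ≠ fperm n (ρ (sgen n 1)) := by
  intro h01
  have hB := ((sgen_braidSeq n).map ρ).map (fperm n)
  have hall : ∀ i, i < n - 1 → fperm n (ρ (sgen n i)) = fperm n (ρ (sgen n 0)) := by
    intro i hi
    have hs := hB.conj_seg (m := 0) (by omega)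
    simp only [zero_add, ← h01] at hs
    have hpow := hB.pow_conj_seg (m := 0) (k := i) (by omega)
    simp only [zero_add] at hpow
    rw [← hpow, mul_inv_eq_iff_eq_mul]
    exact (Commute.pow_left (mul_inv_eq_iff_eq_mul.mp hs) i).eq
  obtain ⟨-, hr1, hr2⟩ := sgen_relations n
  have hseg : fperm n (ρ (seg (sgen n) 0 (n - 1))) = fperm n (ρ (sgen n 0)) ^ (n - 1) := by
    rw [map_seg, map_seg, seg_congr (t' := fun _ => fperm n (ρ (sgen n 0)))]
    · have : ∀ (x : Perm (Fin n)) l, seg (fun _ => x) 0 l = x ^ l := fun x l => by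
        induction l with
        | zero => simp [seg]
        | succ l ih => rw [seg, ih, pow_succ]
      exact this _ _
    · intro i _ hi; exact hall i (by omega)
  have hrseg : fperm n (ρ (rseg (sgen n) 0 (n - 1))) = fperm n (ρ (sgen n 0)) ^ (n - 1) := by
    have : ∀ l ≤ n - 1, fperm n (ρ (rseg (sgen n) 0 l)) = fperm n (ρ (sgen n 0)) ^ l := by
      intro l hl
      induction l with
      | zero => simp [rseg]
      | succ l ih => rw [rseg, map_mul, map_mul, ih (by omega), pow_succ', hall _ (by omega)]
    exact this _ le_rfl
  have h1 : fperm n (ρ (seg (sgen n) 0 (n - 1) ^ 2)) = 1 := by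
    rw [map_pow, map_pow, pow_two]
    nth_rw 2 [hseg]
    rw [← hrseg, ← map_mul, ← map_mul, hr1, map_one, map_one]
  have hn3 : 3 ≤ n := by omega
  have hn0 : (n : ℤ) ≠ 0 := by omega
  have hpow : ρ (seg (sgen n) 0 (n - 1) ^ 2) ^ n = 1 := by
    rw [← map_pow, ← pow_mul, mul_comm, pow_mul, hr2, one_pow, map_one]
  have h2 : ρ (seg (sgen n) 0 (n - 1) ^ 2) ∈ pureN n (Finset.range n) :=
    mem_pureN_of_zpow_mem subset_rfl hn3 (fperm_eq_one_iff.mp h1) hn0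
      (by rw [zpow_natCast, hpow]; exact one_mem _)
  rw [pureN_range hn3, Subgroup.mem_bot, map_eq_one_iff ρ hρ] at h2
  exact mperm_seg_sq_ne_one (n := n) (by omega) (by rw [h2, map_one])

theorem fperm_map_sgen_sq (hn : 5 ≤ n) (hρ : Function.Injective ρ) {i : ℕ} (hi : i + 1 < n) :
    fperm n (ρ (sgen n i)) ^ 2 = 1 := by
  have h := (((sgen_braidSeq n).map ρ).map (fperm n)).sq_eq_one hn (fperm_map_sgen_ne hn hρ)
  obtain ⟨c, hc⟩ := isConj_iff.mp (isConj_sgen_zero hi)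
  rw [← hc, map_mul, map_mul, map_mul, map_mul, map_inv, map_inv, conj_pow, h]
  simp

/-- The automorphism of the symmetric group induced by an injective endomorphism. -/
theorem exists_mulEquiv_fperm (hn : 5 ≤ n) (hρ : Function.Injective ρ) :
    ∃ f : Perm (Fin n) ≃* Perm (Fin n), ∀ g, f (fperm n g) = fperm n (ρ g) := by
  have hker : (fperm n).ker ≤ ((fperm n).comp ρ).ker := by
    intro g hg
    obtain ⟨w, hw, rfl⟩ := exists_toMCG_eq g
    rw [MonoidHom.mem_ker, fperm_eq_one_iff, mperm_toMCG w hw] at hg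
    have := (((sgen_braidSeq n).map ρ).map (fperm n)).lift_eq_one_of_sq
      (fun i hi => fperm_map_sgen_sq hn hρ hi) hw hg
    rw [MonoidHom.mem_ker, ← this]
    exact DFunLike.congr_fun (FreeGroup.ext_hom _ _ (fun i => by simp) :
      ((fperm n).comp ρ).comp (toMCG n) = FreeGroup.lift fun i => fperm n (ρ (sgen n i))) w
  set f := (fperm n).liftOfSurjective fperm_surjective ⟨(fperm n).comp ρ, hker⟩
  have hf : ∀ g, f (fperm n g) = fperm n (ρ g) := fun g =>
    MonoidHom.liftOfRightInverse_comp_apply _ _ _ _ g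
  have hinj : Function.Injective f := by
    by_contra hni
    rw [← MonoidHom.ker_eq_bot_iff, ← ne_eq, ← Subgroup.nontrivial_iff_ne_bot] at hni
    have hle := Perm.alternatingGroup_le_of_normal (by simpa using hn) hni
    apply fperm_map_sgen_ne hn hρ
    have hmem : fperm n (sgen n 0 * (sgen n 1)⁻¹) ∈ f.ker := hle (by
      have h01 := isConj_sgen_zero (n := n) (i := 1) (by omega)
      obtain ⟨c, hc⟩ := isConj_iff.mp h01
      rw [Perm.mem_alternatingGroup, ← hc]
      simp only [map_mul, map_inv]
      generalize Perm.sign (fperm n (sgen n 0)) = x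
      generalize Perm.sign (fperm n c) = y
      rw [mul_right_comm, mul_inv_cancel, one_mul, mul_inv_cancel])
    rw [MonoidHom.mem_ker, hf, map_mul, map_mul, map_inv, map_inv, mul_inv_eq_one] at hmem
    exact hmem
  exact ⟨MulEquiv.ofBijective f (Finite.injective_iff_bijective.mp hinj), hf⟩

theorem isSwap_mperm_map_sgen (hn : 5 ≤ n) (hρ : Function.Injective ρ) {i : ℕ} (hi : i + 1 < n) :
    ∃ k l : Fin n, k ≠ l ∧ fperm n (ρ (sgen n i)) = swap k l := by
  obtain ⟨f, hf⟩ := exists_mulEquiv_fperm hn hρ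
  have h1 : (fperm n (sgen n i)).IsSwap := ⟨⟨i, by omega⟩, ⟨i + 1, by omega⟩,
    by simp, isSwap_fperm_iff.mpr (mperm_sgen hi)⟩
  rcases isSwap_map_or hn f (c := fperm n (seg (sgen n) 0 (n - 1) ^ 3)) h1 (by
    rintro rfl; exact cycleType_fperm_seg_cube) with h | ⟨h6, k, l, hkl, h⟩
  · rw [hf] at h
    obtain ⟨k, l, hkl, h⟩ := h
    exact ⟨k, l, hkl, h⟩
  · subst h6
    rw [hf, isSwap_fperm_iff] at h
    refine absurd h (mperm_ne_swap_of_sq_eq_one ?_ k.2 l.2 (by simpa [Fin.ext_iff] using hkl))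
    rw [← map_pow, ← pow_mul, show 3 * 2 = 6 by rfl, (sgen_relations 6).2.2, map_one]

/-- Up to conjugation, an injective endomorphism acts on the punctures in the standard way. -/
theorem exists_mperm_map_eq (hn : 5 ≤ n) (hρ : Function.Injective ρ) :
    ∃ g : SphereMCG n, ∀ x, mperm n (ρ x) = mperm n (g * x * g⁻¹) := by
  have hB := ((sgen_braidSeq n).map ρ).map (mperm n)
  obtain ⟨a, hinj, ha⟩ := hB.exists_chain
    (fun h => fperm_map_sgen_ne hn hρ (Equiv.ext fun j => Fin.ext (by
      rw [coe_fperm_apply, coe_fperm_apply, h])))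
    (by omega) fun i hi => by
      obtain ⟨k, l, hkl, h⟩ := isSwap_mperm_map_sgen hn hρ (i := i) (by omega)
      exact ⟨k, l, by simpa [Fin.ext_iff] using hkl, isSwap_fperm_iff.mp h⟩
  have hne : ∀ i j, i < n → j < n → i ≠ j → a i ≠ a j := fun i j hi hj hij h =>
    hij (hinj (show i ≤ n - 1 by omega) (show j ≤ n - 1 by omega) h)
  have hlt : ∀ i < n, a i < n := by
    have key : ∀ i < n - 1, a i < n ∧ a (i + 1) < n := by
      intro i hi
      have h1 := hne i (i + 1) (by omega) (by omega) (by omega)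
      constructor
      · by_contra! h
        have := mperm_apply_of_le (ρ (sgen n i)) h
        rw [ha i hi, swap_apply_left] at this
        exact h1 this.symm
      · by_contra! h
        have := mperm_apply_of_le (ρ (sgen n i)) h
        rw [ha i hi, swap_apply_right] at this
        exact h1 this
    intro i hi
    rcases Nat.lt_or_ge i (n - 1) with h | h
    · exact (key i h).1
    · have := (key (i - 1) (by omega)).2
      rwa [Nat.sub_add_cancel (by omega)] at this
  obtain ⟨b, hb, hba⟩ := exists_wperm_extending (n := n) (lo := 0) (k := n) a
    (fun i hi j hj he => by
      by_contra hij; exact hne i j hi hj hij he) hlt (by simp) le_rfl (by simp)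
  rw [strandsFrom_zero] at hb
  refine ⟨toMCG n b, fun x => ?_⟩
  obtain ⟨w, hw, rfl⟩ := exists_toMCG_eq x
  rw [map_mul, map_mul, map_inv, mperm_toMCG b hb]
  induction hw using Subgroup.closure_induction with
  | mem x hx =>
    obtain ⟨i, hi, rfl⟩ := hx
    have hi : i + 1 < n := hi
    rw [toMCG_of, ha i (by omega), mperm_sgen hi, ← hba i (by omega), ← hba (i + 1) (by omega)]
    exact swap_apply_apply _ _ _
  | one => simp
  | mul x y _ _ hx hy => rw [map_mul, map_mul, map_mul, hx, hy, map_mul]; group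
  | inv x _ hx => rw [map_inv, map_inv, map_inv, hx, map_inv]; group

end

end

/-! ### Squares of half twists and their images -/

section

open FreeGroup (of)
open Equiv

section

variable {n : ℕ} {T : Finset ℕ} {s t z g : SphereMCG n}

theorem mem_pureN_of_commute_sq_pow (hT : T ⊆ Finset.range n) (hn : 3 ≤ n) {k l m j : ℕ}
    (hk : k ∈ T)
    (hl : l ∈ T) (hm : m ∈ T) (hj : j ∈ T) (hkl : k ≠ l) (hkm : k ≠ m) (hlm : l ≠ m) (hkj : k ≠ j)
    (hlj : l ≠ j) (hmj : m ≠ j) (hc : 5 ≤ T.card) (hs : mperm n s = swap k l)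
    (ht : mperm n t = swap l m) (hst : s * t * s = t * s * t) (hsk : s ^ 2 ∈ pureN n (T.erase k))
    (hzk : z ∈ pureN n (T.erase k)) (hzj : z ∈ pureN n (T.erase j)) {M : ℕ} (hM : M ≠ 0)
    (h : z * (s ^ 2) ^ M * z⁻¹ * ((s ^ 2) ^ M)⁻¹ ∈ pureN n T) : z ∈ pureN n T := by
  by_contra hz
  have hTj : T.erase j ⊆ Finset.range n := (Finset.erase_subset _ _).trans hT
  have hs1 : mperm n (s ^ 2) = 1 := by rw [map_pow, hs, pow_two, swap_mul_self]
  have hs2 : s ^ 2 ∉ pureN n (T.erase j) := by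
    intro h2
    have hcard : ({k, l, m} : Finset ℕ).card = 3 := by
      rw [Finset.card_insert_of_notMem (by simp [hkl, hkm]), Finset.card_pair hlm]
    obtain ⟨I, h3, h4, h5⟩ := Finset.exists_subsuperset_card_eq (s := {k, l, m}) (t := T.erase j)
      (n := 4) (by
        intro x hx
        simp only [Finset.mem_insert, Finset.mem_singleton] at hx
        rcases hx with rfl | rfl | rfl <;> simp [*])
      (by omega) (by rw [Finset.card_erase_of_mem hj]; omega)
    exact sq_notMem (h4.trans hTj) h5 (h3 (by simp)) (h3 (by simp)) (h3 (by simp)) hkl hkm hlm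
      hs ht hst (pureN_anti h4 h2)
  have hsM : (s ^ 2) ^ M ∉ pureN n T := fun h3 => hs2 <|
    mem_pureN_of_zpow_mem hTj hn hs1 (k := M) (by exact_mod_cast hM)
      (by rw [zpow_natCast]; exact pureN_anti (Finset.erase_subset _ _) h3)
  obtain ⟨p, q, _, hq, hpq⟩ := exists_zpow_mul_inv_mem_pureN hT hk (by omega) hzk (pow_mem hsk M) hz
    hsM h
  have h6 : ((s ^ 2) ^ M) ^ q ∈ pureN n (T.erase j) := by
    have h7 := mul_mem (inv_mem (pureN_anti (Finset.erase_subset j T) hpq)) (zpow_mem hzj p)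
    simpa using h7
  rw [← zpow_natCast, ← zpow_mul] at h6
  exact hs2 (mem_pureN_of_zpow_mem hTj hn hs1 (mul_ne_zero (by exact_mod_cast hM) hq) h6)

theorem Commute.mul_mul_inv_mul_inv {G : Type*} [Group G] {a b : G} (h : Commute a b) :
    a * b * a⁻¹ * b⁻¹ = 1 := by rw [h.eq, mul_inv_cancel_right, mul_inv_cancel]

theorem toMCG_commute_of_mem_strandsFrom {lo i : ℕ} (hi : i + 2 ≤ lo) {w : FreeGroup ℕ}
    (hw : w ∈ strandsFrom lo n) : Commute (toMCG n w) (sgen n i) := by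
  induction hw using Subgroup.closure_induction with
  | mem x hx =>
    obtain ⟨j, ⟨h1, h2⟩, rfl⟩ := hx
    rw [toMCG_of]
    exact ((sgen_braidSeq n).comm i j (by omega) (by omega)).symm
  | one => rw [map_one]; exact Commute.one_left _
  | mul x y _ _ hx hy => rw [map_mul]; exact hx.mul_left hy
  | inv x _ hx => rw [map_inv]; exact hx.inv_left

theorem exists_conj_sgen_zero (hn : 5 ≤ n) (g : SphereMCG n) {k l m : ℕ} (hkn : k < n) (hln : l < n)
    (hmn : m < n) (hkl : k ≠ l) (hkm : k ≠ m) (hlm : l ≠ m)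
    (hg : ∀ x, x = k ∨ x = l ∨ x = m → x ≠ mperm n g 0 ∧ x ≠ mperm n g 1) :
    ∃ g', g' * sgen n 0 * g'⁻¹ = g * sgen n 0 * g⁻¹ ∧ mperm n g' 2 = k ∧ mperm n g' 3 = l ∧
      mperm n g' 4 = m := by
  set π := mperm n g
  have hlt : ∀ x < n, π.symm x < n := fun x hx => by
    have := mperm_apply_lt g⁻¹ hx; rwa [map_inv] at this
  have h0 : ∀ x, x ≠ π 0 → π.symm x ≠ 0 := fun x hx h => hx (by rw [← h, apply_symm_apply])
  have h1 : ∀ x, x ≠ π 1 → π.symm x ≠ 1 := fun x hx h => hx (by rw [← h, apply_symm_apply])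
  have hne : ∀ x y, x ≠ y → π.symm x ≠ π.symm y := fun x y h he => h (π.symm.injective he)
  have := hne k l hkl
  have := hne k m hkm
  have := hne l m hlm
  have := h0 k (hg k (by simp)).1
  have := h0 l (hg l (by simp)).1
  have := h0 m (hg m (by simp)).1
  have := h1 k (hg k (by simp)).2
  have := h1 l (hg l (by simp)).2
  have := h1 m (hg m (by simp)).2
  have := hlt k hkn
  have := hlt l hln
  have := hlt m hmn
  obtain ⟨b, hb, hbf⟩ := exists_wperm_extending (n := n) (lo := 2) (k := 5)
    (fun i => if i < 2 then i else if i = 2 then π.symm k else if i = 3 then π.symm l else π.symm m)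
    (by
      intro i hi j hj
      simp only [Set.mem_Iio] at hi hj
      dsimp only
      split_ifs <;> intro <;> omega)
    (by intro i hi; split_ifs <;> omega)
    (by intro i hi; simp [hi]) hn (by norm_num)
  have hbm := mperm_toMCG b (strandsFrom_le _ _ hb)
  refine ⟨g * toMCG n b, ?_, ?_, ?_, ?_⟩
  · have := (toMCG_commute_of_mem_strandsFrom (i := 0) le_rfl hb).eq
    rw [mul_assoc g, this]
    group
  all_goals rw [map_mul, hbm, Perm.mul_apply, hbf _ (by norm_num)]; simp [π]

variable {ρ : SphereMCG n →* SphereMCG n}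

theorem exists_three_mem {U : Finset ℕ} (h : 3 ≤ U.card) : ∃ k ∈ U, ∃ l ∈ U, ∃ m ∈ U,
    k ≠ l ∧ k ≠ m ∧ l ≠ m := by
  obtain ⟨k, l, m, hk, hl, hm, h1, h2, h3⟩ := Finset.two_lt_card_iff.mp (show 2 < U.card by omega)
  exact ⟨k, hk, l, hl, m, hm, h1, h2, h3⟩

theorem exists_four_mem {U : Finset ℕ} (h : 4 ≤ U.card) : ∃ k ∈ U, ∃ l ∈ U, ∃ m ∈ U, ∃ j ∈ U,
    k ≠ l ∧ k ≠ m ∧ l ≠ m ∧ k ≠ j ∧ l ≠ j ∧ m ≠ j := by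
  obtain ⟨j, hj⟩ := Finset.card_pos.mp (show 0 < U.card by omega)
  obtain ⟨k, hk, l, hl, m, hm, h1, h2, h3⟩ := exists_three_mem (U := U.erase j)
    (by rw [Finset.card_erase_of_mem hj]; omega)
  simp only [Finset.mem_erase] at hk hl hm
  exact ⟨k, hk.2, l, hl.2, m, hm.2, j, hj, h1, h2, h3, hk.1, hl.1, hm.1⟩

/-- A homomorphism that induces the identity on the punctures maps the square of a half twist to
a mapping class that becomes trivial when one of the two twisted punctures is filled in. -/
theorem map_conj_sq_mem_pureN (hn : 5 ≤ n) (hρ : ∀ x, mperm n (ρ x) = mperm n x)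
    (hT : T ⊆ Finset.range n) (hg : mperm n g 0 ∉ T ∨ mperm n g 1 ∉ T) :
    ρ (g * sgen n 0 ^ 2 * g⁻¹) ∈ pureN n T := by
  have hpure : ∀ g, mperm n (ρ (g * sgen n 0 ^ 2 * g⁻¹)) = 1 := fun g => by
    rw [hρ, map_mul, map_mul, map_pow, mperm_sgen (by omega), pow_two, swap_mul_self, map_inv]
    simp
  induction hc : T.card using Nat.strong_induction_on generalizing T g with | _ c ih =>
  rcases Nat.lt_or_ge c 4 with h4 | h4
  · exact ker_le_pureN_of_card (by omega) hT (by omega) (hpure g)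
  set U := (T.erase (mperm n g 0)).erase (mperm n g 1)
  have hU : T.card ≤ U.card + 1 := by
    have h0 := Finset.pred_card_le_card_erase (s := T) (a := mperm n g 0)
    have h1 := Finset.pred_card_le_card_erase (s := T.erase (mperm n g 0)) (a := mperm n g 1)
    rcases hg with hg | hg
    · have h2 := congrArg Finset.card (Finset.erase_eq_of_notMem hg)
      simp only [U]; omega
    · have h2 := congrArg Finset.card (Finset.erase_eq_of_notMem (s := T.erase (mperm n g 0))
        fun h => hg (Finset.mem_of_mem_erase h))
      simp only [U]; omega
  have hUT : ∀ x ∈ U, x ∈ T ∧ x < n ∧ x ≠ mperm n g 0 ∧ x ≠ mperm n g 1 := fun x hx => by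
    simp only [U, Finset.mem_erase] at hx
    exact ⟨hx.2.2, Finset.mem_range.mp (hT hx.2.2), hx.2.1, hx.1⟩
  have hcomm : ∀ g' : SphereMCG n, g' * sgen n 0 * g'⁻¹ = g * sgen n 0 * g⁻¹ → ∀ i, 2 ≤ i →
      i + 1 < n → Commute (ρ (g * sgen n 0 ^ 2 * g⁻¹)) (ρ (g' * sgen n i * g'⁻¹)) := by
    intro g' h i hi hin
    rw [← conj_pow, ← h, conj_pow]
    refine Commute.map ?_ ρ
    have := ((sgen_braidSeq n).comm 0 i (by omega) (by omega)).pow_left 2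
    exact this.map (MulAut.conj g').toMonoidHom
  have hbraid : ∀ g', ρ (g' * sgen n 2 * g'⁻¹) * ρ (g' * sgen n 3 * g'⁻¹) * ρ (g' * sgen n 2 * g'⁻¹)
      = ρ (g' * sgen n 3 * g'⁻¹) * ρ (g' * sgen n 2 * g'⁻¹) * ρ (g' * sgen n 3 * g'⁻¹) := by
    intro g'
    have := (((sgen_braidSeq n).map (MulAut.conj g').toMonoidHom).map ρ).braid 2 (by omega)
    simpa using this
  have hsw : ∀ g' i, i + 1 < n → mperm n (ρ (g' * sgen n i * g'⁻¹)) =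
      swap (mperm n g' i) (mperm n g' (i + 1)) := fun g' i hi => by
    rw [hρ, map_mul, map_mul, map_inv, mperm_sgen hi]
    exact (swap_apply_apply _ _ _).symm
  rcases Nat.eq_or_lt_of_le h4 with rfl | h5
  · obtain ⟨k, hk, l, hl, m, hm, hkl, hkm, hlm⟩ := exists_three_mem (U := U) (by omega)
    obtain ⟨g', h, rfl, rfl, rfl⟩ := exists_conj_sgen_zero hn g (hUT k hk).2.1 (hUT l hl).2.1
      (hUT m hm).2.1 hkl hkm hlm (by rintro x (rfl | rfl | rfl) <;> exact (hUT _ ‹_›).2.2)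
    by_contra hmem
    refine false_of_commute hT hc (hUT _ hk).1 (hUT _ hl).1 (hUT _ hm).1 hkl hkm hlm (hpure g) hmem
      (hsw g' 2 (by omega)) (hsw g' 3 (by omega)) ?_ ?_
    · rw [(hcomm g' h 2 le_rfl (by omega)).symm.mul_mul_inv_mul_inv]; exact one_mem _
    · rw [(hcomm g' h 3 (by omega) (by omega)).symm.mul_mul_inv_mul_inv]; exact one_mem _
  · obtain ⟨k, hk, l, hl, m, hm, j, hj, hkl, hkm, hlm, hkj, hlj, hmj⟩ :=
      exists_four_mem (U := U) (by omega)
    obtain ⟨g', h, h2, h3, h4⟩ := exists_conj_sgen_zero hn g (hUT k hk).2.1 (hUT l hl).2.1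
      (hUT m hm).2.1 hkl hkm hlm (by rintro x (rfl | rfl | rfl) <;> exact (hUT _ ‹_›).2.2)
    have he : ∀ x ∈ U, ρ (g * sgen n 0 ^ 2 * g⁻¹) ∈ pureN n (T.erase x) := fun x hx => by
      refine ih _ ?_ ((Finset.erase_subset _ _).trans hT)
        (hg.imp (fun h h' => h (Finset.mem_of_mem_erase h')) fun h h' =>
          h (Finset.mem_of_mem_erase h')) rfl
      rw [Finset.card_erase_of_mem (hUT x hx).1]; omega
    refine mem_pureN_of_commute_sq_pow hT (by omega) (hUT k hk).1 (hUT l hl).1 (hUT m hm).1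
      (hUT j hj).1 hkl hkm hlm hkj hlj hmj (by omega) (s := ρ (g' * sgen n 2 * g'⁻¹))
      (t := ρ (g' * sgen n 3 * g'⁻¹)) ?_ ?_ (hbraid g') ?_ (he k hk) (he j hj) one_ne_zero ?_
    · rw [hsw _ _ (by omega), h2, h3]
    · rw [hsw _ _ (by omega), h3, h4]
    · have hd := (sgen_braidSeq n).pow_conj_seg (m := 0) (k := 2) (by omega)
      set d := seg (sgen n) 0 (n - 1) ^ 2 with hd'
      have hmd : ∀ i < 2, mperm n d i = i + 2 := fun i hi => by
        rw [hd', map_pow, mperm_seg, seg_swap_pow_apply _ _ _ (by omega) (by omega),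
          if_pos (by omega)]
      rw [← map_pow, conj_pow, ← zero_add 2, ← hd, conj_pow]
      rw [show g' * (d * sgen n 0 ^ (0 + 2) * d⁻¹) * g'⁻¹ = g' * d * sgen n 0 ^ 2 * (g' * d)⁻¹ by
        simp only [zero_add]; group]
      refine ih _ ?_ ((Finset.erase_subset _ _).trans hT) (g := g' * d) (Or.inl ?_) rfl
      · rw [Finset.card_erase_of_mem (hUT k hk).1]; omega
      · rw [map_mul, Perm.mul_apply, hmd 0 (by norm_num), h2]; simp
    · rw [pow_one, ((hcomm g' h 2 le_rfl (by omega)).pow_right 2).mul_mul_inv_mul_inv]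
      exact one_mem _

end

end

/-! ### Elements supported away from a puncture -/

section

open FreeGroup (of)
open Equiv

section

variable {n : ℕ} {T : Finset ℕ} {z : SphereMCG n} {ρ : SphereMCG n →* SphereMCG n}

/-- An element of the kernel of filling in all punctures but `n - 1`, some powers of which commute
with the images of all half twists supported away from the last two punctures, up to elements that
die when the puncture `n - 2` is filled in, dies itself when that puncture is filled in. -/
theorem mem_pureN_of_forall_exists_pow (hn : 5 ≤ n) (hρ : ∀ x, mperm n (ρ x) = mperm n x)
    (hz : z ∈ pureN n (Finset.range (n - 1)))
    (h : ∀ b ∈ strands (n - 2), ∃ M, 0 < M ∧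
      ρ (toMCG n b * sgen n 0 ^ 2 * (toMCG n b)⁻¹) ^ M * z *
        (ρ (toMCG n b * sgen n 0 ^ 2 * (toMCG n b)⁻¹) ^ M)⁻¹ * z⁻¹ ∈
          pureN n (insert (n - 1) (Finset.range (n - 2)))) :
    ∀ T ⊆ insert (n - 1) (Finset.range (n - 2)), z ∈ pureN n T := by
  intro T hT
  have hz1 : mperm n z = 1 := pureN_le_ker hz
  have hTn : T ⊆ Finset.range n := hT.trans fun x hx => by
    simp only [Finset.mem_insert, Finset.mem_range] at hx ⊢; omega
  induction hc : T.card using Nat.strong_induction_on generalizing T with | _ c ih =>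
  rcases Nat.lt_or_ge c 4 with h4 | h4
  · exact ker_le_pureN_of_card (by omega) hTn (by omega) hz1
  by_cases hnT : n - 1 ∈ T
  swap
  · refine pureN_anti (fun x hx => ?_) hz
    have := hT hx
    simp only [Finset.mem_insert, Finset.mem_range] at this ⊢
    rcases this with rfl | h
    exacts [absurd hx hnT, by omega]
  have hU : ∀ x ∈ T.erase (n - 1), x ∈ T ∧ x < n - 2 ∧ x ≠ n - 1 := fun x hx => by
    rw [Finset.mem_erase] at hx
    have := hT hx.2
    simp only [Finset.mem_insert, Finset.mem_range, hx.1, false_or] at this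
    exact ⟨hx.2, this, hx.1⟩
  have hUc : (T.erase (n - 1)).card = c - 1 := by rw [Finset.card_erase_of_mem hnT, hc]
  have hlift : ∀ k l m, k < n - 2 → l < n - 2 → m < n - 2 → k ≠ l → k ≠ m → l ≠ m →
      ∃ b ∈ strands (n - 2), mperm n (toMCG n b) 0 = k ∧ mperm n (toMCG n b) 1 = l ∧
        mperm n (toMCG n b) 2 = m := fun k l m hk hl hm hkl hkm hlm => by
    obtain ⟨b, hb, hbf⟩ := exists_wperm_extending (n := n - 2) (lo := 0) (k := 3)
      (fun i => if i = 0 then k else if i = 1 then l else m)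
      (by
        intro i hi j hj
        simp only [Set.mem_Iio] at hi hj
        dsimp only
        split_ifs <;> intro <;> omega)
      (by intro i hi; split_ifs <;> omega)
      (by intro i hi; omega) (by omega) (by norm_num)
    rw [strandsFrom_zero] at hb
    have hbm := mperm_toMCG b (strands_mono (by omega : n - 2 ≤ n) hb)
    exact ⟨b, hb, by simp [hbm, hbf], by simp [hbm, hbf], by simp [hbm, hbf]⟩
  have hsw : ∀ b i, i + 1 < n → mperm n (ρ (toMCG n b * sgen n i * (toMCG n b)⁻¹)) =
      swap (mperm n (toMCG n b) i) (mperm n (toMCG n b) (i + 1)) := fun b i hi => by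
    rw [hρ, map_mul, map_mul, map_inv, mperm_sgen hi]
    exact (swap_apply_apply _ _ _).symm
  have hst : ∀ b, ρ (toMCG n b * sgen n 0 * (toMCG n b)⁻¹) * ρ (toMCG n b * sgen n 1 *
      (toMCG n b)⁻¹)
      * ρ (toMCG n b * sgen n 0 * (toMCG n b)⁻¹) = ρ (toMCG n b * sgen n 1 * (toMCG n b)⁻¹) *
      ρ (toMCG n b * sgen n 0 * (toMCG n b)⁻¹) * ρ (toMCG n b * sgen n 1 * (toMCG n b)⁻¹) := by
    intro b
    have := (((sgen_braidSeq n).map (MulAut.conj (toMCG n b)).toMonoidHom).map ρ).braid 0 (by omega)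
    simpa using this
  have h0 : ∀ b ∈ strands (n - 2), ∃ M, M ≠ 0 ∧
      z * (ρ (toMCG n b * sgen n 0 * (toMCG n b)⁻¹) ^ 2) ^ M * z⁻¹ *
        ((ρ (toMCG n b * sgen n 0 * (toMCG n b)⁻¹) ^ 2) ^ M)⁻¹ ∈ pureN n T := fun b hb => by
    obtain ⟨M, hM, hb⟩ := h b hb
    refine ⟨M, hM.ne', ?_⟩
    rw [← map_pow ρ, conj_pow]
    have := inv_mem (pureN_anti hT hb)
    simpa only [mul_inv_rev, inv_inv, mul_assoc] using this
  have h1 : ∀ b ∈ strands (n - 2), ∃ M, M ≠ 0 ∧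
      z * (ρ (toMCG n b * sgen n 1 * (toMCG n b)⁻¹) ^ 2) ^ M * z⁻¹ *
        ((ρ (toMCG n b * sgen n 1 * (toMCG n b)⁻¹) ^ 2) ^ M)⁻¹ ∈ pureN n T := fun b hb => by
    have := h0 (b * (of 0 * of 1)) (mul_mem hb (mul_mem (of_mem_strands (by omega))
      (of_mem_strands (by omega))))
    have hd : toMCG n (b * (of 0 * of 1)) * sgen n 0 * (toMCG n (b * (of 0 * of 1)))⁻¹ =
        toMCG n b * sgen n 1 * (toMCG n b)⁻¹ := by
      have hbr := (sgen_braidSeq n).braid 0 (by omega)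
      rw [zero_add] at hbr
      rw [map_mul, map_mul, toMCG_of, toMCG_of, mul_inv_rev, mul_assoc (toMCG n b), hbr]
      group
    rwa [hd] at this
  rcases Nat.eq_or_lt_of_le h4 with rfl | h5
  · obtain ⟨k, hk, l, hl, m, hm, hkl, hkm, hlm⟩ := exists_three_mem (U := T.erase (n - 1))
        (by omega)
    obtain ⟨b, hb, rfl, rfl, rfl⟩ := hlift k l m (hU k hk).2.1 (hU l hl).2.1
        (hU m hm).2.1 hkl hkm hlm
    obtain ⟨A, hA, hA'⟩ := h0 b hb
    obtain ⟨B, hB, hB'⟩ := h1 b hb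
    exact mem_pureN_of_commute_pow hTn hc (hU _ hk).1 (hU _ hl).1 (hU _ hm).1 hkl hkm hlm hz1
      (hsw b 0 (by omega)) (hsw b 1 (by omega)) (hst b) hA hB hA' hB'
  · obtain ⟨k, hk, l, hl, m, hm, j, hj, hkl, hkm, hlm, hkj, hlj, hmj⟩ :=
      exists_four_mem (U := T.erase (n - 1)) (by omega)
    obtain ⟨b, hb, hb0, hb1, hb2⟩ := hlift k l m (hU k hk).2.1 (hU l hl).2.1
        (hU m hm).2.1 hkl hkm hlm
    obtain ⟨A, hA, hA'⟩ := h0 b hb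
    have he : ∀ x ∈ T.erase (n - 1), z ∈ pureN n (T.erase x) := fun x hx =>
      ih _ (by rw [Finset.card_erase_of_mem (hU x hx).1]; omega) _
          ((Finset.erase_subset _ _).trans hT)
        ((Finset.erase_subset _ _).trans hTn) rfl
    refine mem_pureN_of_commute_sq_pow hTn (by omega) (hU k hk).1 (hU l hl).1 (hU m hm).1
      (hU j hj).1 hkl hkm hlm hkj hlj hmj (by omega) ?_ ?_ (hst b) ?_ (he k hk) (he j hj) hA hA'
    · rw [hsw _ _ (by omega), hb0, hb1]
    · rw [hsw _ _ (by omega), hb1, hb2]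
    · rw [← map_pow, conj_pow]
      exact map_conj_sq_mem_pureN hn hρ ((Finset.erase_subset _ _).trans hTn)
        (Or.inl (by rw [hb0]; simp))

end

end

/-! ### A free basis of the point pushing group -/

section

open FreeGroup (of)

section

variable {n : ℕ}

/-- The index in `FreeGroup ℕ` of a free generator of the point pushing group. -/
def pushIdx (n : ℕ) (j : Fin (n - 2)) : ℕ := j + 1

/-- The point pushing homomorphism along the last puncture, on a free basis. -/
def pushFree (n : ℕ) : FreeGroup (Fin (n - 2)) →* SphereMCG n :=
  (pushHom (sgen n) n).comp (FreeGroup.map (pushIdx n))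

theorem pushFree_of (j : Fin (n - 2)) : pushFree n (of j) = pushGen (sgen n) n (j + 1) := by
  simp [pushFree, pushIdx]

theorem pushFree_of_last (hn : 3 ≤ n) :
    pushFree n (of ⟨n - 3, by omega⟩) = sgen n (n - 2) ^ 2 := by
  obtain ⟨m, rfl⟩ : ∃ m, n = m + 3 := ⟨n - 3, by omega⟩
  rw [pushFree_of]
  exact pushGen_last _

theorem fillHom_map (u : FreeGroup (Fin (n - 2))) :
    fillHom (n - 1) (FreeGroup.map (pushIdx n) u) =
      FreeGroup.map (pushIdx n) u := by
  have : (fillHom (n - 1)).comp (FreeGroup.map (pushIdx n)) =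
      FreeGroup.map (pushIdx n) := FreeGroup.ext_hom _ _ fun i => by
    have := i.2
    simp [pushIdx, fillHom_of (m := n - 1) (j := i + 1) (by omega) (by omega)]
  exact DFunLike.congr_fun this u

theorem fillHom_mem_range_map (u : FreeGroup ℕ) :
    fillHom (n - 1) u ∈ (FreeGroup.map (pushIdx n)).range := by
  have hof : ∀ j, 1 ≤ j → j < n - 1 →
      of j ∈ (FreeGroup.map (pushIdx n)).range := fun j h1 h2 =>
    ⟨of ⟨j - 1, by omega⟩, by simp [pushIdx, Nat.sub_add_cancel h1]⟩
  have key : ∀ j, fillHom (n - 1) (of j) ∈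
      (FreeGroup.map (pushIdx n)).range := fun j => by
    rw [fillHom, FreeGroup.lift_apply_of]
    split_ifs with h1 h2
    · exact inv_mem (seg_mem fun m h3 h4 => hof m h3 (by omega))
    · exact hof j (by omega) h2
    · exact one_mem _
  induction u using FreeGroup.induction_on with
  | C1 => rw [map_one]; exact one_mem _
  | of j => exact key j
  | inv_of j _ => rw [map_inv]; exact inv_mem (key j)
  | mul x y hx hy => rw [map_mul]; exact mul_mem hx hy

theorem pushFree_mem_pureN (u : FreeGroup (Fin (n - 2))) :
    pushFree n u ∈ pureN n (Finset.range (n - 1)) := by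
  have := toMCG_pushHom_mem_pureN le_rfl (n := n) (FreeGroup.map (pushIdx n) u)
  rwa [toMCG_pushHom] at this

theorem exists_pushFree_eq_pushHom (hn : 2 ≤ n) (u : FreeGroup ℕ) :
    ∃ v, pushFree n v = pushHom (sgen n) n u := by
  obtain ⟨v, hv⟩ := fillHom_mem_range_map (n := n) u
  refine ⟨v, ?_⟩
  have h := toMCG_pushHom_eq_one hn (u := FreeGroup.map (pushIdx n) v * u⁻¹)
    (by rw [map_mul, fillHom_map, map_inv, hv, mul_inv_cancel])
  rw [toMCG_pushHom, map_mul, map_inv, mul_inv_eq_one] at h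
  exact h

theorem exists_pushFree_eq (hn : 4 ≤ n) {g : SphereMCG n}
    (hg : g ∈ pureN n (Finset.range (n - 1))) : ∃ v, pushFree n v = g := by
  obtain ⟨u, hu⟩ := exists_toMCG_pushHom hn le_rfl hg
  rw [pureN_range (by omega), Subgroup.mem_bot, mul_inv_eq_one, toMCG_pushHom] at hu
  rw [hu]
  exact exists_pushFree_eq_pushHom (by omega) u

theorem pushFree_injective (hn : 4 ≤ n) : Function.Injective (pushFree n) := by
  rw [injective_iff_map_eq_one]
  intro u hu
  have h := (toMCG_pushHom_mem_pureN_iff hn le_rfl (FreeGroup.map (pushIdx n) u)).mp (by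
    rw [toMCG_pushHom]
    change pushFree n u ∈ _
    rw [hu]; exact one_mem _)
  rw [fillHom_map] at h
  refine FreeGroup.map_injective (f := pushIdx n) ?_ (h.trans (map_one _).symm)
  intro i j hij
  exact Fin.ext (by simpa [pushIdx] using hij)

theorem pushFree_mem_ker (u : FreeGroup (Fin (n - 2))) : mperm n (pushFree n u) = 1 :=
  pureN_le_ker (pushFree_mem_pureN u)

/-- The pushes that die when the puncture `n - 2` is filled in. -/
theorem pushFree_mem_pureN_insert_iff (hn : 5 ≤ n) (u : FreeGroup (Fin (n - 2))) :
    pushFree n u ∈ pureN n (insert (n - 1) (Finset.range (n - 2))) ↔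
      u ∈ Subgroup.normalClosure {of (⟨n - 3, by omega⟩ : Fin (n - 2))} := by
  set N := Subgroup.normalClosure {of (⟨n - 3, by omega⟩ : Fin (n - 2))}
  constructor
  · intro h
    have hT : insert (n - 1) (Finset.range (n - 2)) ⊆ Finset.range n := fun x hx => by
      simp only [Finset.mem_insert, Finset.mem_range] at hx ⊢; omega
    change pushHom (sgen n) n (FreeGroup.map _ u) ∈ _ at h
    rw [← toMCG_pushHom, toMCG_mem_pureN_iff hT (pushHom_mem_strands n _)] at h
    have h1 := mem_puncRel_of_pushHom_mem_innerW' hn h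
    let r : FreeGroup ℕ →* FreeGroup (Fin (n - 2)) ⧸ N :=
      FreeGroup.lift fun j => if h : j - 1 < n - 2 then QuotientGroup.mk' N (of ⟨j - 1, h⟩) else 1
    have hr : (r.comp (fillHom (n - 2))).comp (FreeGroup.map (pushIdx n)) =
        QuotientGroup.mk' N := FreeGroup.ext_hom _ _ fun i => by
      have hi := i.2
      rcases Nat.lt_or_ge ((i : ℕ) + 1) (n - 2) with h | h
      · simp [pushIdx, fillHom_of (m := n - 2) (j := i + 1) (by omega) h, r]
      · have : fillHom (n - 2) (of ((i : ℕ) + 1)) = 1 := by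
          rw [fillHom, FreeGroup.lift_apply_of, if_neg (by omega), if_neg (by omega)]
        rw [MonoidHom.comp_apply, MonoidHom.comp_apply, FreeGroup.map.of, pushIdx, this, map_one,
            eq_comm,
          QuotientGroup.mk'_apply, QuotientGroup.eq_one_iff]
        rw [show i = ⟨n - 3, by omega⟩ from Fin.ext (by simp only; omega)]
        exact Subgroup.subset_normalClosure rfl
    have h2 := DFunLike.congr_fun hr u
    rw [MonoidHom.comp_apply, MonoidHom.comp_apply, h1, map_one, eq_comm, QuotientGroup.mk'_apply,
      QuotientGroup.eq_one_iff] at h2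
    exact h2
  · intro h
    have hnorm : ((pureN n (insert (n - 1) (Finset.range (n - 2)))).comap (pushFree n)).Normal := by
      refine ⟨fun v hv g => ?_⟩
      rw [Subgroup.mem_comap, map_mul, map_mul, map_inv]
      exact conj_mem_pureN_of_pure (pushFree_mem_ker g) hv
    refine Subgroup.normalClosure_le_normal (N := (pureN n _).comap (pushFree n)) ?_ h
    rintro _ rfl
    rw [SetLike.mem_coe, Subgroup.mem_comap, pushFree_of_last (by omega)]
    have := conj_sgen_sq_mem_pureN (T := insert (n - 1) (Finset.range (n - 2))) (1 : SphereMCG n)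
      (i := n - 2) (by omega) (Or.inl (by rw [map_one]; simp; omega))
    simpa using this

theorem conj_pushFree (hn : 4 ≤ n) {h : SphereMCG n} (hh : mperm n h (n - 1) = n - 1)
    (u : FreeGroup (Fin (n - 2))) : ∃ v, pushFree n v = h * pushFree n u * h⁻¹ := by
  apply exists_pushFree_eq hn
  have := conj_mem_pureN h (pushFree_mem_pureN u)
  have hsub : (Finset.range (n - 1)).map (mperm n h).toEmbedding ⊆ Finset.range (n - 1) := by
    intro x hx
    obtain ⟨y, hy, rfl⟩ := Finset.mem_map.mp hx
    rw [Finset.mem_range] at hy ⊢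
    have h1 := mperm_apply_lt h (show y < n by omega)
    have h2 : mperm n h y ≠ n - 1 := fun he => by
      have := (mperm n h).injective (he.trans hh.symm); omega
    change mperm n h y < _
    omega
  rwa [Finset.eq_of_subset_of_card_le hsub (by rw [Finset.card_map])] at this

theorem conj_pushGen (hn : 4 ≤ n) {h : SphereMCG n} (hh : mperm n h = 1) (j : ℕ) :
    ∃ d, h * pushGen (sgen n) n j * h⁻¹ =
      pushFree n d * pushGen (sgen n) n j * (pushFree n d)⁻¹ := by
  obtain ⟨w, hw, hwp, hk⟩ := exists_mul_inv_mem_pureN (m := n - 1) (by omega) h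
    (fun j _ _ => by rw [hh]; rfl)
  obtain ⟨k, hk⟩ := exists_pushFree_eq hn hk
  obtain ⟨c, hc⟩ := isConj_iff.mp (permLike_act w j)
  rw [hwp, hh, Equiv.Perm.one_apply] at hc
  obtain ⟨c', hc'⟩ := exists_pushFree_eq_pushHom (n := n) (by omega) c
  refine ⟨k * c', ?_⟩
  have h1 := (sgen_braidSeq n).pushHom_act hw (of j)
  rw [← hc, map_mul, map_mul, map_inv, ← hc', pushHom_of] at h1
  change _ = toMCG n w * _ * (toMCG n w)⁻¹ at h1
  rw [map_mul, hk]
  have h2 : h * pushGen (sgen n) n j * h⁻¹ = h * (toMCG n w)⁻¹ *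
    (toMCG n w * pushGen (sgen n) n j * (toMCG n w)⁻¹) * (h * (toMCG n w)⁻¹)⁻¹ := by group
  rw [h2, ← h1]
  group

theorem exists_mulAut_pushFree (hn : 4 ≤ n) {h : SphereMCG n} (hh : mperm n h = 1) :
    ∃ α : MulAut (FreeGroup (Fin (n - 2))), (∀ u, pushFree n (α u) = h * pushFree n u * h⁻¹) ∧
      ∀ j, IsConj (of j) (α (of j)) := by
  have hmem : h ∈ Subgroup.normalizer ((pushFree n).range : Set (SphereMCG n)) := by
    rw [Subgroup.mem_normalizer_iff]
    refine fun x => ⟨?_, fun ⟨u, hu⟩ => ?_⟩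
    · rintro ⟨u, rfl⟩
      exact conj_pushFree hn (by rw [hh]; rfl) u
    · obtain ⟨v, hv⟩ := conj_pushFree hn (h := h⁻¹) (by rw [map_inv, hh]; simp) u
      exact ⟨v, by rw [hv, hu]; group⟩
  let e := MonoidHom.ofInjective (pushFree_injective hn)
  let α : MulAut (FreeGroup (Fin (n - 2))) :=
    (e.trans (Subgroup.normalizerMonoidHom _ ⟨h, hmem⟩)).trans e.symm
  have hα : ∀ u, pushFree n (α u) = h * pushFree n u * h⁻¹ := fun u => by
    have : e (α u) = Subgroup.normalizerMonoidHom _ ⟨h, hmem⟩ (e u) := e.apply_symm_apply _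
    exact congrArg Subtype.val this
  refine ⟨α, hα, fun j => ?_⟩
  obtain ⟨d, hd⟩ := conj_pushGen hn hh (j + 1)
  refine isConj_iff.mpr ⟨d, pushFree_injective hn ?_⟩
  rw [hα, map_mul, map_mul, map_inv, pushFree_of, hd]

end

end

/-! ### Images of point pushes -/

section

open FreeGroup (of)

section

variable {n : ℕ} {ρ : SphereMCG n →* SphereMCG n}

theorem toMCG_commute_sgen {i m : ℕ} (hi : i + 1 < n) {w : FreeGroup ℕ}
    (hw : w ∈ strands m) (hmi : m ≤ i) : Commute (toMCG n w) (sgen n i) := by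
  induction hw using Subgroup.closure_induction with
  | mem x hx =>
    obtain ⟨j, hj, rfl⟩ := hx
    change j + 1 < m at hj
    rw [toMCG_of]
    exact (sgen_braidSeq n).comm j i (by omega) (by omega)
  | one => rw [map_one]; exact Commute.one_left _
  | mul x y _ _ hx hy => rw [map_mul]; exact hx.mul_left hy
  | inv x _ hx => rw [map_inv]; exact hx.inv_left

theorem map_sgen_sq_mem_pureN (hn : 5 ≤ n) (hρ : ∀ x, mperm n (ρ x) = mperm n x) {T : Finset ℕ}
    (hT : T ⊆ Finset.range n) {i : ℕ} (hi : i + 1 < n) (h : i ∉ T ∨ i + 1 ∉ T) :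
    ρ (sgen n i ^ 2) ∈ pureN n T := by
  have hd := (sgen_braidSeq n).pow_conj_seg (m := 0) (k := i) (by omega)
  set d := seg (sgen n) 0 (n - 1) ^ i with hd'
  have hmd : ∀ j < 2, mperm n d j = i + j := fun j hj => by
    rw [hd', map_pow, mperm_seg, seg_swap_pow_apply _ _ _ (by omega) (by omega),
      if_pos (by omega), add_comm]
  rw [zero_add] at hd
  rw [← hd, conj_pow]
  exact map_conj_sq_mem_pureN hn hρ hT (by rwa [hmd 0 (by norm_num), hmd 1 (by norm_num)])

/-- An injective endomorphism inducing the identity on the punctures maps the square of the last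
half twist to a conjugate, by a point push, of a power of itself. -/
theorem exists_map_sgen_sq_eq (hn : 5 ≤ n) (hρ : ∀ x, mperm n (ρ x) = mperm n x) :
    ∃ c, ∃ l : ℤ, ρ (sgen n (n - 2) ^ 2) =
      pushFree n c * (sgen n (n - 2) ^ 2) ^ l * (pushFree n c)⁻¹ := by
  obtain ⟨w, hw⟩ := exists_pushFree_eq (by omega) <|
    map_sgen_sq_mem_pureN (T := Finset.range (n - 1)) (i := n - 2) hn hρ
      (Finset.range_mono (by omega)) (by omega) (Or.inr (by simp; omega))
  have hu : ∀ b : strands (n - 2),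
      mperm n (ρ (toMCG n b * sgen n 0 ^ 2 * (toMCG n b)⁻¹)) = 1 := fun b => by
    rw [hρ, map_mul, map_mul, map_inv, map_pow, mperm_sgen (by omega), pow_two,
      Equiv.swap_mul_self]
    simp
  choose α hα hαc using fun b => exists_mulAut_pushFree (by omega : 4 ≤ n) (hu b)
  have hins : insert (n - 1) (Finset.range (n - 2)) ⊆ Finset.range n := fun x hx => by
    simp only [Finset.mem_insert, Finset.mem_range] at hx ⊢; omega
  have hpow : ∀ b M v, pushFree n ((α b ^ M) v) =
      ρ (toMCG n b * sgen n 0 ^ 2 * (toMCG n b)⁻¹) ^ M * pushFree n v *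
        (ρ (toMCG n b * sgen n 0 ^ 2 * (toMCG n b)⁻¹) ^ M)⁻¹ := fun b M => by
    induction M with
    | zero => simp
    | succ M ih =>
      intro v
      rw [pow_succ, MulAut.mul_apply, ih, hα, pow_succ]
      group
  have key : ∃ c, ∃ l : ℤ, w = c * of (⟨n - 3, by omega⟩ : Fin (n - 2)) ^ l * c⁻¹ := by
    refine exists_conj_zpow_of_mem_normalClosure (t := (⟨n - 3, by omega⟩ : Fin (n - 2)))
      α (fun b => hαc b _) (fun z hz => ?_) (w := w) ?_ fun b => ?_
    · rw [← pushFree_mem_pureN_insert_iff hn]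
      refine mem_pureN_of_forall_exists_pow hn hρ (pushFree_mem_pureN z)
          (fun b hb => ?_) _ subset_rfl
      obtain ⟨M, hM, h⟩ := hz ⟨b, hb⟩
      refine ⟨M, hM, ?_⟩
      rwa [← pushFree_mem_pureN_insert_iff hn, map_mul, map_inv, hpow] at h
    · rw [← pushFree_mem_pureN_insert_iff hn, hw]
      exact map_sgen_sq_mem_pureN hn hρ hins (by omega) (Or.inl (by simp; omega))
    · apply pushFree_injective (by omega)
      have h1 := toMCG_commute_sgen (n := n) (i := n - 2) (by omega) b.2 le_rfl
      have h2 : Commute (sgen n 0) (sgen n (n - 2)) :=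
        (sgen_braidSeq n).comm _ _ (by omega) (by omega)
      have h3 := ((((h1.mul_left (h2.pow_left 2)).mul_left h1.inv_left).pow_right 2).map ρ).eq
      rw [hα, hw, h3, mul_inv_cancel_right]
  obtain ⟨c, l, h⟩ := key
  refine ⟨c, l, ?_⟩
  rw [← hw, h, map_mul, map_mul, map_zpow, map_inv, pushFree_of_last (by omega)]

theorem exists_map_pushGen_eq (hn : 5 ≤ n) (hρ : ∀ x, mperm n (ρ x) = mperm n x) :
    ∃ l : ℤ, ∀ j, j + 1 < n → ∃ c, ρ (pushGen (sgen n) n j) =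
      pushFree n c * pushGen (sgen n) n j ^ l * (pushFree n c)⁻¹ := by
  obtain ⟨c, l, h⟩ := exists_map_sgen_sq_eq hn hρ
  refine ⟨l, fun j hj => ?_⟩
  obtain ⟨r, hr⟩ : ∃ r, r = (rseg (sgen n) j (n - 2 - j))⁻¹ := ⟨_, rfl⟩
  have hy : pushGen (sgen n) n j = r * sgen n (n - 2) ^ 2 * r⁻¹ := by
    rw [pushGen, if_pos (by omega), hr, inv_inv]
  have hrn : mperm n r (n - 1) = n - 1 := by
    have : rseg (sgen n) j (n - 2 - j) ∈
        (MulAction.stabilizer (Equiv.Perm ℕ) (n - 1)).comap (mperm n) :=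
      rseg_mem fun m _ h2 => by
        rw [Subgroup.mem_comap, MulAction.mem_stabilizer_iff, mperm_sgen (by omega)]
        exact Equiv.swap_apply_of_ne_of_ne (by omega) (by omega)
    have := inv_mem this
    rwa [← hr, Subgroup.mem_comap, MulAction.mem_stabilizer_iff] at this
  obtain ⟨c', hc'⟩ := conj_pushFree (by omega) hrn c
  have hq : mperm n (ρ r * r⁻¹) = 1 := by rw [map_mul, hρ, map_inv, mul_inv_cancel]
  obtain ⟨d, hd⟩ := conj_pushGen (by omega) hq j
  obtain ⟨c'', hc''⟩ := conj_pushFree (by omega) (h := ρ r * r⁻¹) (by rw [hq]; rfl) c'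
  refine ⟨c'' * d, ?_⟩
  have e1 : ρ (pushGen (sgen n) n j) = (ρ r * r⁻¹) * (r * pushFree n c * r⁻¹) *
      (r * sgen n (n - 2) ^ 2 * r⁻¹) ^ l * ((ρ r * r⁻¹) * (r * pushFree n c * r⁻¹))⁻¹ := by
    rw [hy, map_mul, map_mul, map_inv, h, conj_zpow]
    group
  have e2 : (ρ r * r⁻¹) * pushFree n c' = pushFree n c'' * (ρ r * r⁻¹) := by
    rw [hc'']; group
  rw [e1, ← hc', ← hy, e2, map_mul]
  have e3 := congrArg (· ^ l) hd
  simp only [conj_zpow] at e3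
  calc _ = pushFree n c'' * ((ρ r * r⁻¹) * pushGen (sgen n) n j ^ l * (ρ r * r⁻¹)⁻¹) *
        (pushFree n c'')⁻¹ := by group
    _ = _ := by rw [e3]; group

end

end

/-! ### Products of conjugates of powers of generators -/

section

open FreeGroup (of)

section

/-- Adds one to the first coordinate on the zero level of the second one. -/
def shearPerm (N : ℕ) : Equiv.Perm (ZMod N × ZMod N) where
  toFun p := (p.1 + if p.2 = 0 then 1 else 0, p.2)
  invFun p := (p.1 - if p.2 = 0 then 1 else 0, p.2)
  left_inv p := by simp
  right_inv p := by simp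

/-- Adds one to the second coordinate. -/
def shiftPerm (N : ℕ) : Equiv.Perm (ZMod N × ZMod N) where
  toFun p := (p.1, p.2 + 1)
  invFun p := (p.1, p.2 - 1)
  left_inv p := by simp
  right_inv p := by simp

theorem shearPerm_pow_apply (N k : ℕ) (p : ZMod N × ZMod N) :
    (shearPerm N ^ k) p = (p.1 + if p.2 = 0 then (k : ZMod N) else 0, p.2) := by
  induction k with
  | zero => simp
  | succ k ih =>
    rw [pow_succ', Equiv.Perm.mul_apply, ih]
    simp only [shearPerm, Equiv.coe_fn_mk, Nat.cast_succ]
    split_ifs <;> simp [add_assoc]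

theorem shearPerm_pow (N : ℕ) : shearPerm N ^ N = 1 :=
  Equiv.ext fun p => by simp [shearPerm_pow_apply]

theorem shiftPerm_pow_apply (N k : ℕ) (p : ZMod N × ZMod N) :
    (shiftPerm N ^ k) p = (p.1, p.2 + k) := by
  induction k with
  | zero => simp
  | succ k ih =>
    rw [pow_succ', Equiv.Perm.mul_apply, ih]
    simp [shiftPerm, add_assoc]

theorem shiftPerm_pow (N : ℕ) : shiftPerm N ^ N = 1 :=
  Equiv.ext fun p => by simp [shiftPerm_pow_apply]

theorem shearPerm_mul_shiftPerm_pow_ne_one {N : ℕ} (hN : 2 ≤ N) :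
    (shearPerm N * shiftPerm N) ^ N ≠ 1 := by
  have key : ∀ k < N, ((shearPerm N * shiftPerm N) ^ k) (0, 0) = (0, (k : ZMod N)) := by
    intro k
    induction k with
    | zero => simp
    | succ k ih =>
      intro hk
      rw [pow_succ', Equiv.Perm.mul_apply, ih (by omega)]
      have : (k : ZMod N) + 1 ≠ 0 := by
        rw [← Nat.cast_succ, Ne, ZMod.natCast_eq_zero_iff]
        exact fun h => absurd (Nat.le_of_dvd (by omega) h) (by omega)
      simp [shearPerm, shiftPerm, this]
  intro h
  obtain ⟨m, rfl⟩ : ∃ m, N = m + 1 := ⟨N - 1, by omega⟩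
  have h1 := congrArg (fun f => (f (0, 0)).1) h
  have h2 : ((m : ZMod (m + 1))) + 1 = 0 := by
    rw [← Nat.cast_succ]; exact ZMod.natCast_self _
  simp only [pow_succ' _ m, Equiv.Perm.mul_apply] at h1
  rw [key m (by omega)] at h1
  simp only [shearPerm, shiftPerm, Equiv.coe_fn_mk, h2, if_true, Equiv.Perm.one_apply,
      zero_add] at h1
  have : Fact (1 < m + 1) := ⟨by omega⟩
  exact one_ne_zero h1

variable {m : ℕ} {c : Fin m → FreeGroup (Fin m)} {c₀ : FreeGroup (Fin m)} {l : ℤ}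

theorem natAbs_le_one_of_prod_conj_zpow (hm : 2 ≤ m)
    (h : (List.ofFn fun j => c j * of j ^ l * (c j)⁻¹).prod =
      c₀ * (List.ofFn fun j : Fin m => of j).prod ^ l * c₀⁻¹) : l.natAbs ≤ 1 := by
  by_contra hl
  push Not at hl
  obtain ⟨k, rfl⟩ : ∃ k, m = k + 2 := ⟨m - 2, by omega⟩
  let f : Fin (k + 2) → Equiv.Perm (ZMod l.natAbs × ZMod l.natAbs) := fun j =>
    if j = 0 then shearPerm _ else if j = 1 then shiftPerm _ else 1
  have hzpow : ∀ {G : Type} [Group G] (g : G), g ^ l = 1 ↔ g ^ l.natAbs = 1 := fun g => by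
    rcases Int.natAbs_eq l with hl | hl
    · conv_lhs => rw [hl]
      rw [zpow_natCast]
    · conv_lhs => rw [hl]
      rw [zpow_neg, zpow_natCast, inv_eq_one]
  have hf : ∀ j, f j ^ l = 1 := fun j => by
    rw [hzpow]
    simp only [f]
    split_ifs
    exacts [shearPerm_pow _, shiftPerm_pow _, one_pow _]
  have h1 := congrArg (FreeGroup.lift f) h
  rw [map_list_prod, List.map_ofFn, map_mul, map_mul, map_zpow, map_inv, map_list_prod,
    List.map_ofFn] at h1
  have h2 : (FreeGroup.lift f ∘ fun j => c j * of j ^ l * (c j)⁻¹) = fun _ => 1 := by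
    funext j
    simp [hf]
  have h3 : (FreeGroup.lift f ∘ fun j => of j) = f := by funext j; simp
  have h4 : (List.ofFn f).prod = shearPerm _ * shiftPerm _ := by
    rw [List.ofFn_succ, List.ofFn_succ, List.prod_cons, List.prod_cons]
    have : (fun i : Fin k => f i.succ.succ) = fun _ => 1 := by
      funext i
      have e1 : i.succ.succ ≠ 0 := Fin.succ_ne_zero _
      have e2 : i.succ.succ ≠ 1 := by
        intro h; have := congrArg Fin.val h; simp at this
      simp [f, e1, e2]
    rw [this]
    simp [f]
  rw [h2, h3, h4] at h1
  rw [List.ofFn_const, List.prod_replicate, one_pow, eq_comm, mul_inv_eq_one, mul_eq_left,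
      hzpow] at h1
  exact shearPerm_mul_shiftPerm_pow_ne_one hl h1

theorem closure_conj_eq_top_of_prod_eq (s : List (FreeGroup (Fin m) × Fin m)) (hs : s.length = m)
    (hj : ∀ j, ∃ p ∈ s, p.2 = j)
    (h : FreeGroup.norm (s.map FreeGroup.cj).prod ≤ m) :
    Subgroup.closure {b | ∃ q ∈ s, FreeGroup.cj q = b} = ⊤ := by
  have h1 := FreeGroup.of_mem_closure_of_norm_prod_le _ s le_rfl (by rwa [hs])
  rw [eq_top_iff, ← FreeGroup.closure_range_of, Subgroup.closure_le]
  rintro _ ⟨j, rfl⟩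
  obtain ⟨p, hp, rfl⟩ := hj j
  exact h1 p hp

/-- Conjugates of powers of the free generators whose product is conjugate to the power of the
product of the free generators, generate the free group. -/
theorem closure_conj_zpow_eq_top (hm : 2 ≤ m) (hl : l ≠ 0)
    (h : (List.ofFn fun j => c j * of j ^ l * (c j)⁻¹).prod =
      c₀ * (List.ofFn fun j : Fin m => of j).prod ^ l * c₀⁻¹) :
    Subgroup.closure (Set.range fun j => c j * of j ^ l * (c j)⁻¹) = ⊤ := by
  have hl1 := natAbs_le_one_of_prod_conj_zpow hm h
  set b : List (FreeGroup (Fin m) × Fin m) := List.ofFn fun j => (c₀⁻¹ * c j, j) with hb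
  set Y := (List.ofFn fun j : Fin m => of j).prod with hY
  have hbl : b.length = m := by simp [hb]
  have hbj : ∀ j, ∃ p ∈ b, p.2 = j := fun j => ⟨_, List.mem_ofFn.mpr ⟨j, rfl⟩, rfl⟩
  have hnorm : FreeGroup.norm Y ≤ m := by
    have : ∀ s : List (Fin m), FreeGroup.norm (s.map of).prod ≤ s.length := fun s => by
      induction s with
      | nil => simp
      | cons a s ih =>
        rw [List.map_cons, List.prod_cons, List.length_cons]
        refine (FreeGroup.norm_mul_le _ _).trans ?_
        rw [FreeGroup.norm_of]; omega
    have h1 := this (List.ofFn id)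
    rw [List.map_ofFn, List.length_ofFn] at h1
    exact h1
  have hprod : (b.map fun p => FreeGroup.cj p ^ l).prod = Y ^ l := by
    have h1 := congrArg (MulAut.conj c₀⁻¹) h
    rw [map_list_prod, List.map_ofFn] at h1
    rw [hb, List.map_ofFn]
    have h2 : ((fun p => FreeGroup.cj p ^ l) ∘ fun j => (c₀⁻¹ * c j, j)) =
        MulAut.conj c₀⁻¹ ∘ fun j => c j * of j ^ l * (c j)⁻¹ := by
      funext j
      simp only [Function.comp_apply, FreeGroup.cj, MulAut.conj_apply, conj_zpow]
      group
    rw [h2, h1, MulAut.conj_apply]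
    group
  have htop : Subgroup.closure {x | ∃ q ∈ b, FreeGroup.cj q = x} = ⊤ := by
    rcases (by omega : l = 1 ∨ l = -1) with rfl | rfl
    · simp only [zpow_one] at hprod
      exact closure_conj_eq_top_of_prod_eq b hbl hbj (by rw [hprod]; exact hnorm)
    · have h1 := congrArg (·⁻¹) hprod
      simp only [zpow_neg, zpow_one, inv_inv, List.prod_inv_reverse, List.map_map] at h1
      have := closure_conj_eq_top_of_prod_eq b.reverse (by rw [List.length_reverse, hbl])
        (fun j => by simpa using hbj j) (by
          rw [List.map_reverse]
          have h2 : ((fun x => x⁻¹) ∘ fun p : FreeGroup (Fin m) × Fin m => (FreeGroup.cj p)⁻¹) =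
              FreeGroup.cj := by funext x; simp
          rw [← h2, h1]
          exact hnorm)
      simpa using this
  set H := Subgroup.closure (Set.range fun j => c j * of j ^ l * (c j)⁻¹)
  have hH : Subgroup.closure {x | ∃ q ∈ b, FreeGroup.cj q = x} ≤
      H.comap (MulAut.conj c₀).toMonoidHom := by
    rw [Subgroup.closure_le]
    rintro _ ⟨q, hq, rfl⟩
    obtain ⟨j, rfl⟩ := List.mem_ofFn.mp hq
    have h1 : c j * of j ^ l * (c j)⁻¹ ∈ H := Subgroup.subset_closure ⟨j, rfl⟩
    have h2 : c j * of j * (c j)⁻¹ ∈ H := by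
      rcases (by omega : l = 1 ∨ l = -1) with rfl | rfl
      · simpa using h1
      · simpa [mul_assoc] using inv_mem h1
    rw [SetLike.mem_coe, Subgroup.mem_comap]
    convert h2 using 1
    simp only [FreeGroup.cj, MulEquiv.toMonoidHom_eq_coe, MonoidHom.coe_coe, MulAut.conj_apply]
    group
  rw [htop] at hH
  rw [eq_top_iff]
  intro x _
  have := hH (Subgroup.mem_top (c₀⁻¹ * x * c₀))
  rw [Subgroup.mem_comap] at this
  convert this using 1
  simp only [MulEquiv.toMonoidHom_eq_coe, MonoidHom.coe_coe, MulAut.conj_apply]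
  group

end

end

/-! ### Surjectivity -/

section

open FreeGroup (of)

section

variable {n : ℕ} {ρ : SphereMCG n →* SphereMCG n}

theorem pushGen_zero_eq (hn : 2 ≤ n) : pushGen (sgen n) n 0 =
    (pushFree n (List.ofFn fun j : Fin (n - 2) => of j).prod)⁻¹ := by
  have h := (sgen_braidSeq n).pushHom_seg (m := n) (by omega)
  rw [mul_eq_one_comm.mp (sgen_relations n).2.1, map_seg] at h
  simp only [pushHom_of] at h
  obtain ⟨k, rfl⟩ : ∃ k, n = k + 2 := ⟨n - 2, by omega⟩
  rw [seg, zero_add, pushGen_of_lt (j := k + 1) (by omega), mul_one, seg_succ', zero_add] at h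
  rw [eq_inv_of_mul_eq_one_left h, map_list_prod, List.map_ofFn,
    show seg (fun i => pushGen (sgen (k + 2)) (k + 2) i) 1 k =
      seg (fun i => pushGen (sgen (k + 2)) (k + 2) (i + 1)) 0 k by
        rw [seg_shift_index, zero_add], ← (prod_ofFn_eq_seg _ _).1]
  congr 3
  funext j
  exact (pushFree_of (n := k + 2) j).symm

theorem pushFree_mem_range (hn : 5 ≤ n) (hi : Function.Injective ρ)
    (hρ : ∀ x, mperm n (ρ x) = mperm n x) (u : FreeGroup (Fin (n - 2))) :
    pushFree n u ∈ ρ.range := by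
  obtain ⟨l, hl⟩ := exists_map_pushGen_eq hn hρ
  obtain ⟨c₀, h0⟩ := hl 0 (by omega)
  have hl' : ∀ j : Fin (n - 2), ∃ c, ρ (pushFree n (of j)) = pushFree n (c * of j ^ l * c⁻¹) :=
    fun j => by
      obtain ⟨c, hc⟩ := hl (j + 1) (by omega)
      exact ⟨c, by rw [pushFree_of, hc, map_mul, map_mul, map_zpow, map_inv, pushFree_of]⟩
  choose c hc using hl'
  have hl0 : l ≠ 0 := by
    rintro rfl
    have h1 := hc ⟨0, by omega⟩
    rw [zpow_zero, mul_one, mul_inv_cancel, map_one, ← map_one ρ] at h1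
    exact FreeGroup.of_ne_one _ (pushFree_injective (by omega) ((hi h1).trans (map_one _).symm))
  have key : (List.ofFn fun j => c j * of j ^ l * (c j)⁻¹).prod =
      c₀ * (List.ofFn fun j : Fin (n - 2) => of j).prod ^ l * c₀⁻¹ := by
    apply pushFree_injective (by omega : 4 ≤ n)
    have h1 : ρ (pushFree n (List.ofFn fun j : Fin (n - 2) => of j).prod) =
        pushFree n (List.ofFn fun j => c j * of j ^ l * (c j)⁻¹).prod := by
      rw [map_list_prod, map_list_prod, map_list_prod, List.map_ofFn, List.map_ofFn, List.map_ofFn]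
      congr 2
      funext j
      exact hc j
    rw [← h1, map_mul, map_mul, map_zpow, map_inv]
    rw [pushGen_zero_eq (by omega), map_inv, inv_zpow] at h0
    rw [← inv_inj, h0]
    group
  have htop := closure_conj_zpow_eq_top (by omega) hl0 key
  have hle : Subgroup.closure (Set.range fun j => c j * of j ^ l * (c j)⁻¹) ≤
      ρ.range.comap (pushFree n) := by
    rw [Subgroup.closure_le]
    rintro _ ⟨j, rfl⟩
    exact ⟨_, hc j⟩
  rw [htop] at hle
  exact hle (Subgroup.mem_top u)

/-- The pure mapping class group is normally generated by the square of a half twist. -/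
theorem ker_mperm_le_normalClosure {i : ℕ} (hi : i + 1 < n) :
    (mperm n).ker ≤ Subgroup.normalClosure {sgen n i ^ 2} := by
  intro x hx
  obtain ⟨w, hw, rfl⟩ := exists_toMCG_eq x
  rw [MonoidHom.mem_ker, mperm_toMCG w hw] at hx
  set q := QuotientGroup.mk' (Subgroup.normalClosure {sgen n i ^ 2})
  have h := ((sgen_braidSeq n).map q).lift_eq_one_of_sq (fun j hj => ?_) hw hx
  · have h1 : FreeGroup.lift (fun j => q (sgen n j)) = q.comp (toMCG n) :=
      FreeGroup.ext_hom _ _ fun j => by simp [toMCG_of]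
    rw [h1] at h
    exact (QuotientGroup.eq_one_iff _).mp h
  · rw [← map_pow]
    refine (QuotientGroup.eq_one_iff _).mpr ?_
    obtain ⟨c, hc⟩ := isConj_iff.mp
      (IsConj.trans (isConj_comm.mp (isConj_sgen_zero hi)) (isConj_sgen_zero hj))
    rw [← hc, conj_pow]
    have h2 : sgen n i ^ 2 ∈ Subgroup.normalClosure {sgen n i ^ 2} :=
      Subgroup.subset_normalClosure (Set.mem_singleton _)
    exact Subgroup.normalClosure_normal.conj_mem _ h2 c

theorem surjective_of_mperm_map (hn : 5 ≤ n) (hi : Function.Injective ρ)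
    (hρ : ∀ x, mperm n (ρ x) = mperm n x) : Function.Surjective ρ := by
  have hP : (mperm n).ker ≤ ρ.range := by
    refine (ker_mperm_le_normalClosure (i := n - 2) (by omega)).trans ?_
    rw [Subgroup.normalClosure, Subgroup.closure_le]
    intro x hx
    obtain ⟨_, rfl, hx⟩ := Group.mem_conjugatesOfSet_iff.mp hx
    obtain ⟨g, rfl⟩ := isConj_iff.mp hx
    have hp : mperm n ((ρ g)⁻¹ * g) = 1 := by rw [map_mul, map_inv, hρ, inv_mul_cancel]
    obtain ⟨v, hv⟩ := conj_pushFree (by omega) (h := (ρ g)⁻¹ * g) (by rw [hp]; rfl)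
      (of ⟨n - 3, by omega⟩)
    obtain ⟨y, hy⟩ := pushFree_mem_range hn hi hρ v
    refine ⟨g * y * g⁻¹, ?_⟩
    rw [map_mul, map_mul, map_inv, hy, hv, pushFree_of_last (by omega)]
    group
  intro x
  obtain ⟨y, hy⟩ := hP (show (ρ x)⁻¹ * x ∈ (mperm n).ker by
    rw [MonoidHom.mem_ker, map_mul, map_inv, hρ, inv_mul_cancel])
  exact ⟨x * y, by rw [map_mul, hy, mul_inv_cancel_left]⟩

end

end

/-- For `n ≥ 5`, the mapping class group of the `n`-punctured sphere is
co-Hopfian: every injective endomorphism is surjective. -/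
theorem sphereMCG_coHopfian (n : ℕ) (hn : 5 ≤ n)
    (ρ : SphereMCG n →* SphereMCG n) (hρ : Function.Injective ρ) :
    Function.Surjective ρ := by
  obtain ⟨g, hg⟩ := exists_mperm_map_eq hn hρ
  have h := surjective_of_mperm_map (ρ := (MulAut.conj g⁻¹).toMonoidHom.comp ρ) hn
    ((MulAut.conj g⁻¹).injective.comp hρ) fun x => by
      change mperm n (g⁻¹ * ρ x * g⁻¹⁻¹) = _
      rw [map_mul, map_mul, hg, ← map_mul, ← map_mul]
      group
  intro y
  obtain ⟨x, hx⟩ := h (g⁻¹ * y * g)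
  refine ⟨x, ?_⟩
  simp only [MonoidHom.comp_apply, MulEquiv.toMonoidHom_eq_coe, MonoidHom.coe_coe,
    MulAut.conj_apply, inv_inv] at hx
  exact mul_left_cancel (mul_right_cancel hx)
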